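/- Let μ, μ' ∈ C([0,∞); P₂^ν(ℝ²)) be global measure-valued solutions of the nonlocal continuity equation with F ∈ F^ν_{A,B,I,M}(κ,γ). Then for all t ≥ 0: (i) d₁(μ_t, μ'_t) ≤ d₁(μ₀, μ'₀) e^{κ(M+I)t}; (ii) the barycenters x_c(t) := ∫ x μ_t(dx,dω) and x'_c(t) := ∫ x μ'_t(dx,dω) satisfy |x_c(t) − x'_c(t)| ≤ |x_c(0) − x'_c(0)| + d₁(μ₀, μ'₀)(e^{κ(M+I)t} − 1); (iii) d₂(μ_t, μ'_t) ≤ d₂(μ₀, μ'₀) e^{κ(M+I)t}. -/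

import Mathlib

set_option autoImplicit false

open MeasureTheory Set Real Filter

noncomputable section

/-- The (topological) support of a measure: points all of whose open neighborhoods
have positive measure. -/
def msupp {E : Type*} [TopologicalSpace E] [MeasurableSpace E] (μ : Measure E) : Set E :=
  {z | ∀ U : Set E, IsOpen U → z ∈ U → μ U ≠ 0}

/-- `pl` is a coupling of `μ` and `ν`. -/
def IsCoupling {E F : Type*} [MeasurableSpace E] [MeasurableSpace F]
    (pl : Measure (E × F)) (μ : Measure E) (ν : Measure F) : Prop :=
  pl.map Prod.fst = μ ∧ pl.map Prod.snd = ν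

/-- The 1-Wasserstein distance. -/
def W1 {E : Type*} [MeasurableSpace E] [PseudoMetricSpace E] (μ ν : Measure E) : ℝ :=
  ⨅ pl : {pl : Measure (E × E) // IsCoupling pl μ ν}, ∫ q, dist q.1 q.2 ∂(pl.1)

/-- The 2-Wasserstein distance. -/
def W2 {E : Type*} [MeasurableSpace E] [PseudoMetricSpace E] (μ ν : Measure E) : ℝ :=
  ⨅ pl : {pl : Measure (E × E) // IsCoupling pl μ ν},
    Real.sqrt (∫ q, dist q.1 q.2 ^ 2 ∂(pl.1))

/-- Partial derivative `∂ₓ F[μ](x,ω)` of a nonlocal velocity field. -/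
def Fx (F : Measure (ℝ × ℝ) → ℝ × ℝ → ℝ) (μ : Measure (ℝ × ℝ)) (z : ℝ × ℝ) : ℝ :=
  deriv (fun x => F μ (x, z.2)) z.1

/-- Second partial derivative `∂ₓ² F[μ](x,ω)`. -/
def Fxx (F : Measure (ℝ × ℝ) → ℝ × ℝ → ℝ) (μ : Measure (ℝ × ℝ)) (z : ℝ × ℝ) : ℝ :=
  deriv (fun x => Fx F μ (x, z.2)) z.1

/-- Partial derivative `∂_ω F[μ](x,ω)`. -/
def Fw (F : Measure (ℝ × ℝ) → ℝ × ℝ → ℝ) (μ : Measure (ℝ × ℝ)) (z : ℝ × ℝ) : ℝ :=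
  deriv (fun w => F μ (z.1, w)) z.2

/-- The spatial average (barycenter) `x_c[μ] = ∫ x μ(dx,dω)`. -/
def xc (μ : Measure (ℝ × ℝ)) : ℝ := ∫ z, z.1 ∂μ

/-- The mean frequency `ω_c = ∫ ω ν(dω)`. -/
def wc (ν : Measure ℝ) : ℝ := ∫ ω, ω ∂ν

/-- The measure `δ_x ⊗ ν`. -/
def diracProd (x : ℝ) (ν : Measure ℝ) : Measure (ℝ × ℝ) := (Measure.dirac x).prod ν

/-- `P₂^ν(ℝ²)`: probability measures on `ℝ²` with finite second moment and
`ω`-marginal `ν`. -/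
def P2nu (ν : Measure ℝ) : Set (Measure (ℝ × ℝ)) :=
  {μ | IsProbabilityMeasure μ ∧ Integrable (fun z : ℝ × ℝ => z.1 ^ 2 + z.2 ^ 2) μ ∧
    μ.map Prod.snd = ν}

/-- The diameter in `x` of the support of `μ`. -/
def diamx (μ : Measure (ℝ × ℝ)) : ℝ :=
  sSup {d : ℝ | ∃ z ∈ msupp μ, ∃ z' ∈ msupp μ, d = |z.1 - z'.1|}

/-- The structural assumptions `(A1)–(A5)` defining the class `F^ν_{A,B,I,M}(κ,γ)`. -/
structure Framework (ν : Measure ℝ) (F : Measure (ℝ × ℝ) → ℝ × ℝ → ℝ)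
    (A B I M κ γ : ℝ) : Prop where
  /-- (A1) mean-field regularity -/
  hA1 : ∀ μ ∈ P2nu ν, ∀ μ' ∈ P2nu ν, ∀ x : ℝ, ∀ ω ∈ msupp ν,
    |F μ (x, ω) - F μ' (x, ω)| ≤ κ * M * W1 μ μ' ∧
    |Fx F μ (x, ω) - Fx F μ' (x, ω)| ≤ κ * M * W1 μ μ'
  /-- (A2) space regularity -/
  hA2 : ∀ μ ∈ P2nu ν, ContDiff ℝ 2 (F μ) ∧
    (∀ z : ℝ × ℝ, |Fx F μ z| ≤ κ * I) ∧ (∀ z : ℝ × ℝ, |Fxx F μ z| ≤ κ * I) ∧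
    (∀ z : ℝ × ℝ, |Fw F μ z| ≤ I)
  /-- (A3) lifted periodicity -/
  hA3 : ∀ μ ∈ P2nu ν, ∀ z : ℝ × ℝ,
    F (μ.map fun w : ℝ × ℝ => (w.1 + 2 * π, w.2)) (z.1 + 2 * π, z.2) = F μ z
  /-- (A4) no stationarity -/
  hA4 : ∀ x : ℝ, A ≤ F (diracProd x ν) (x, wc ν)
  /-- (A5) synchronization -/
  hA5 : (∫ x in (0:ℝ)..(2 * π),
      Fx F (diracProd x ν) (x, wc ν) / F (diracProd x ν) (x, wc ν)) ≤ -(κ * B)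

/-- `μ` is a measure-valued solution of the nonlocal continuity equation
`∂ₜ μ + ∂ₓ (F[μ] μ) = 0` on `[0,∞)`. -/
def IsSol (F : Measure (ℝ × ℝ) → ℝ × ℝ → ℝ) (μ : ℝ → Measure (ℝ × ℝ)) : Prop :=
  (∀ φ : ℝ × ℝ → ℝ, Continuous φ → HasCompactSupport φ →
    ContinuousOn (fun t => ∫ z, φ z ∂(μ t)) (Ici 0)) ∧
  (∀ φ : ℝ → ℝ × ℝ → ℝ,
    ContDiff ℝ 1 (fun q : ℝ × (ℝ × ℝ) => φ q.1 q.2) →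
    HasCompactSupport (fun q : ℝ × (ℝ × ℝ) => φ q.1 q.2) →
    ∀ t : ℝ, 0 ≤ t →
      ∫ z, φ t z ∂(μ t) = (∫ z, φ 0 z ∂(μ 0)) +
        ∫ s in (0:ℝ)..t, ∫ z, (deriv (fun u => φ u z) s +
          F (μ s) z * deriv (fun x => φ s (x, z.2)) z.1) ∂(μ s))

/-- `X` is the characteristic flow associated with a solution `μ`:
`dX/dt = F[μ_t](X(t,x,ω),ω)`, `X(0,x,ω) = x`. -/
def IsFlow (F : Measure (ℝ × ℝ) → ℝ × ℝ → ℝ) (μ : ℝ → Measure (ℝ × ℝ))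
    (X : ℝ → ℝ → ℝ → ℝ) : Prop :=
  (∀ x ω : ℝ, X 0 x ω = x) ∧
  ∀ x ω t : ℝ, 0 ≤ t → HasDerivAt (fun τ => X τ x ω) (F (μ t) (X t x ω, ω)) t

/-- `K` is a disintegration of `μ` with respect to the `ω`-marginal `ν`. -/
def IsDisint (ν : Measure ℝ) (μ : Measure (ℝ × ℝ)) (K : ℝ → Measure ℝ) : Prop :=
  (∀ ω, IsProbabilityMeasure (K ω)) ∧
  μ = ν.bind fun ω => (K ω).map fun x => (x, ω)

/-- The constant `C₁(κ,γ,D) = κ(M+I)D² + 2Iγ`. -/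
def C1 (I M κ γ D : ℝ) : ℝ := κ * (M + I) * D ^ 2 + 2 * I * γ

/-- The constant `C₂(κ,γ,D)`. -/
def C2 (A I M κ γ D : ℝ) : ℝ :=
  C1 I M κ γ D / A +
    (((κ + 1) * I + κ * M) * D + I * γ) * (κ * I * D + C1 I M κ γ D) /
      (A * (A - ((κ + 1) * I + κ * M) * D - I * γ))

/-- The constant `E₁(κ,γ,D) = κ (D (3I/2 + M) + Iγ)`. -/
def E1 (I M κ γ D : ℝ) : ℝ := κ * (D * (3 * I / 2 + M) + I * γ)

/-- The constant `E₂(κ,γ,D)`. -/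
def E2 (A I M κ γ D : ℝ) : ℝ :=
  κ / (A - ((κ + 1) * I + κ * M) * D - I * γ) *
    (D * (3 * I / 2 + M) + I * γ + I * (κ * (I + M) * D + I * γ) / A)

/-- Membership in `C_ν^{(1)}(Δ)`. -/
def MemC1 (ν : Measure ℝ) (Δ : ℝ → ℝ) (μ : Measure (ℝ × ℝ)) : Prop :=
  μ ∈ P2nu ν ∧ diamx μ ≤ Δ (xc μ)

/-- Membership in `C_ν(Δ,Δ̃)`. -/
def MemC (ν : Measure ℝ) (Δ Δ' : ℝ → ℝ) (μ : Measure (ℝ × ℝ)) : Prop :=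
  μ ∈ P2nu ν ∧ diamx μ ≤ Δ (xc μ) ∧
  ∃ K : ℝ → Measure ℝ, IsDisint ν μ K ∧
    ∀ ω ∈ msupp ν, ∀ ω' ∈ msupp ν, W2 (K ω) (K ω') ≤ Δ' (xc μ) * |ω - ω'|

/-- The metric `d₁` computed from disintegrations. -/
def d1k (ν : Measure ℝ) (K K' : ℝ → Measure ℝ) : ℝ := ∫ ω, W1 (K ω) (K' ω) ∂ν

/-- The metric `d₂` computed from disintegrations. -/
def d2k (ν : Measure ℝ) (K K' : ℝ → Measure ℝ) : ℝ :=
  Real.sqrt (∫ ω, W2 (K ω) (K' ω) ^ 2 ∂ν)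

section StabilityProof

open ProbabilityTheory Topology

/-- The quantile function of a measure on `ℝ`. -/
def quantile (m : Measure ℝ) (u : ℝ) : ℝ := sInf {x | u ≤ cdf m x}

lemma quantile_le_iff (m : Measure ℝ) {u : ℝ} (hu : u ∈ Ioo (0 : ℝ) 1) (x : ℝ) :
    quantile m u ≤ x ↔ u ≤ cdf m x := by
  have hbdd : BddBelow {x | u ≤ cdf m x} := by
    obtain ⟨b, hb⟩ := ((tendsto_cdf_atBot m).eventually (gt_mem_nhds hu.1)).exists
    refine ⟨b, fun y (hy : u ≤ cdf m y) => ?_⟩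
    by_contra! h
    exact absurd (hy.trans (monotone_cdf m h.le)) (not_le.2 hb)
  have hne : {x | u ≤ cdf m x}.Nonempty := by
    obtain ⟨b, hb⟩ := ((tendsto_cdf_atTop m).eventually (lt_mem_nhds hu.2)).exists
    exact ⟨b, hb.le⟩
  refine ⟨fun h => ?_, fun h => csInf_le hbdd h⟩
  have key : ∀ y, x < y → u ≤ cdf m y := fun y hy => by
    obtain ⟨z, hz, hzy⟩ := exists_lt_of_csInf_lt hne (lt_of_le_of_lt h hy)
    exact le_trans (show u ≤ cdf m z from hz) (monotone_cdf m hzy.le)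
  have hc : Tendsto (cdf m) (𝓝[>] x) (𝓝 (cdf m x)) :=
    ((cdf m).right_continuous x).mono_left (nhdsWithin_mono _ Ioi_subset_Ici_self)
  exact ge_of_tendsto hc (eventually_nhdsWithin_of_forall fun y hy => key y hy)

/-- The uniform probability measure on the unit interval. -/
def unif : Measure ℝ := volume.restrict (Ioo 0 1)

instance : IsProbabilityMeasure unif := ⟨by simp [unif]⟩

lemma ae_unif : ∀ᵐ u ∂unif, u ∈ Ioo (0 : ℝ) 1 := ae_restrict_mem measurableSet_Ioo

lemma cdf_mem (m : Measure ℝ) (x : ℝ) : cdf m x ∈ Icc (0 : ℝ) 1 :=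
  ⟨cdf_nonneg m x, cdf_le_one m x⟩

lemma unif_Ioc {a b : ℝ} (ha : a ∈ Icc (0 : ℝ) 1) (hb : b ∈ Icc (0 : ℝ) 1) :
    unif (Ioc a b) = ENNReal.ofReal (b - a) := by
  have : unif = volume.restrict (Icc 0 1) := by
    simp [unif, restrict_Ioo_eq_restrict_Icc]
  rw [this, Measure.restrict_apply measurableSet_Ioc, inter_eq_left.2, Real.volume_Ioc]
  exact fun x hx => ⟨ha.1.trans hx.1.le, hx.2.trans hb.2⟩

/-- Quantile functions of a Markov kernel are jointly measurable, up to the choice of values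
outside of the unit interval. -/
lemma aemeasurable_quantile {Ω : Type*} [MeasurableSpace Ω] (ν : Measure Ω)
    [SFinite ν] (K : Kernel Ω ℝ) [IsMarkovKernel K] :
    AEMeasurable (fun q : Ω × ℝ => quantile (K q.1) q.2) (ν.prod unif) := by
  refine ⟨fun q => if q.2 ∈ Ioo (0 : ℝ) 1 then quantile (K q.1) q.2 else 0, ?_, ?_⟩
  · refine measurable_of_Iic fun x => ?_
    have hm : Measurable fun q : Ω × ℝ => cdf (K q.1) x := by
      simp_rw [cdf_eq_real]
      exact ((K.measurable_coe measurableSet_Iic).comp measurable_fst).ennreal_toReal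
    have : (fun q : Ω × ℝ => if q.2 ∈ Ioo (0 : ℝ) 1 then quantile (K q.1) q.2 else 0) ⁻¹' Iic x
        = (Prod.snd ⁻¹' (Ioo (0 : ℝ) 1) ∩ {q : Ω × ℝ | q.2 ≤ cdf (K q.1) x}) ∪
          ((Prod.snd ⁻¹' (Ioo (0 : ℝ) 1))ᶜ ∩ {q : Ω × ℝ | (0 : ℝ) ≤ x}) := by
      ext q
      by_cases hq : q.2 ∈ Ioo (0 : ℝ) 1
      · simp only [mem_preimage, hq, if_true, mem_Iic, quantile_le_iff _ hq]
        simp [hq]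
      · simp only [mem_preimage, hq, if_false, mem_Iic]
        simp [hq]
    rw [this]
    have h1 : MeasurableSet (Prod.snd ⁻¹' (Ioo (0 : ℝ) 1) : Set (Ω × ℝ)) :=
      measurable_snd measurableSet_Ioo
    exact (h1.inter (measurableSet_le measurable_snd hm)).union
      (h1.compl.inter (measurableSet_le measurable_const measurable_const))
  · have : ∀ᵐ q ∂(ν.prod unif), q.2 ∈ Ioo (0 : ℝ) 1 :=
      Measure.quasiMeasurePreserving_snd.ae ae_unif
    filter_upwards [this] with q hq
    rw [if_pos hq]

lemma aemeasurable_quantile_const (m : Measure ℝ) [IsProbabilityMeasure m] :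
    AEMeasurable (quantile m) unif := by
  refine ⟨fun u => if u ∈ Ioo (0 : ℝ) 1 then quantile m u else 0, ?_, ?_⟩
  · refine measurable_of_Iic fun x => ?_
    have : (fun q : ℝ => if q ∈ Ioo (0 : ℝ) 1 then quantile m q else 0) ⁻¹' Iic x
        = ((Ioo (0 : ℝ) 1) ∩ Iic (cdf m x)) ∪
          ((Ioo (0 : ℝ) 1)ᶜ ∩ {q : ℝ | (0 : ℝ) ≤ x}) := by
      ext q
      by_cases hq : q ∈ Ioo (0 : ℝ) 1
      · simp only [mem_preimage, hq, if_true, mem_Iic, quantile_le_iff _ hq]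
        simp [hq]
      · simp only [mem_preimage, hq, if_false, mem_Iic]
        simp [hq]
    rw [this]
    exact (measurableSet_Ioo.inter measurableSet_Iic).union
      (measurableSet_Ioo.compl.inter (measurableSet_le measurable_const measurable_const))
  · filter_upwards [ae_unif] with q hq
    rw [if_pos hq]

lemma map_quantile (m : Measure ℝ) [IsProbabilityMeasure m] :
    unif.map (quantile m) = m := by
  have hq := aemeasurable_quantile_const m
  have : IsProbabilityMeasure (unif.map (quantile m)) := Measure.isProbabilityMeasure_map hq
  refine Measure.ext_of_Iic _ _ fun x => ?_
  rw [Measure.map_apply_of_aemeasurable hq measurableSet_Iic, ← ofReal_cdf m x]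
  have : (quantile m ⁻¹' Iic x : Set ℝ) =ᵐ[unif] Ioc 0 (cdf m x) := by
    filter_upwards [ae_unif] with u hu
    refine propext ?_
    change quantile m u ≤ x ↔ (0 < u ∧ u ≤ cdf m x)
    rw [quantile_le_iff m hu]
    simp [hu.1]
  rw [measure_congr this, unif_Ioc ⟨le_rfl, zero_le_one⟩ (cdf_mem m x), sub_zero]

/-- The coupling cost `(y - x - h)₊` integrated over a coupling, in terms of the joint law. -/
lemma lintegral_sub_pos_eq {α : Type*} [MeasurableSpace α] (P : Measure α) [SFinite P]
    {f g : α → ℝ} (hf : AEMeasurable f P) (hg : AEMeasurable g P) (h : ℝ) :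
    ∫⁻ a, ENNReal.ofReal (g a - f a - h) ∂P
      = ∫⁻ s, P {a | f a ≤ s ∧ s + h < g a} := by
  wlog H : Measurable f ∧ Measurable g with W
  · have h1 := W P hf.measurable_mk.aemeasurable hg.measurable_mk.aemeasurable h
      ⟨hf.measurable_mk, hg.measurable_mk⟩
    have e1 := hf.ae_eq_mk
    have e2 := hg.ae_eq_mk
    rw [lintegral_congr_ae (g := fun a => ENNReal.ofReal (hg.mk g a - hf.mk f a - h)), h1]
    · refine lintegral_congr fun s => measure_congr ?_
      filter_upwards [e1, e2] with a h1 h2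
      refine propext ?_
      change (_ ∧ _) ↔ (_ ∧ _)
      rw [h1, h2]
    · filter_upwards [e1, e2] with a h1 h2
      rw [h1, h2]
  obtain ⟨hf', hg'⟩ := H
  have hS : MeasurableSet {q : α × ℝ | f q.1 ≤ q.2 ∧ q.2 + h < g q.1} :=
    (measurableSet_le (hf'.comp measurable_fst) measurable_snd).inter
      (measurableSet_lt (measurable_snd.add_const h) (hg'.comp measurable_fst))
  calc ∫⁻ a, ENNReal.ofReal (g a - f a - h) ∂P
      = ∫⁻ a, volume (Prod.mk a ⁻¹' {q : α × ℝ | f q.1 ≤ q.2 ∧ q.2 + h < g q.1}) ∂P := by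
        refine lintegral_congr fun a => ?_
        have : Prod.mk a ⁻¹' {q : α × ℝ | f q.1 ≤ q.2 ∧ q.2 + h < g q.1}
            = Ico (f a) (g a - h) := by
          ext s; simp [lt_sub_iff_add_lt]
        rw [this, Real.volume_Ico]; congr 1; ring
    _ = ∫⁻ s, P {a | f a ≤ s ∧ s + h < g a} := by
        rw [← Measure.prod_apply hS, Measure.prod_apply_symm hS]; rfl

/-- The monotone coupling minimises the cost `(y - x - h)₊`. -/
lemma lintegral_quantile_le {m m' : Measure ℝ} [IsProbabilityMeasure m] [IsProbabilityMeasure m']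
    {α : Type*} [MeasurableSpace α] (P : Measure α) [SFinite P] {f g : α → ℝ}
    (hf : AEMeasurable f P) (hg : AEMeasurable g P)
    (hfm : P.map f = m) (hgm : P.map g = m') {h : ℝ} :
    ∫⁻ u, ENNReal.ofReal (quantile m' u - quantile m u - h) ∂unif
      ≤ ∫⁻ a, ENNReal.ofReal (g a - f a - h) ∂P := by
  rw [lintegral_sub_pos_eq _ (aemeasurable_quantile_const m) (aemeasurable_quantile_const m'),
    lintegral_sub_pos_eq _ hf hg]
  refine lintegral_mono fun s => ?_
  have e : ({u | quantile m u ≤ s ∧ s + h < quantile m' u} : Set ℝ)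
      =ᵐ[unif] Ioc (cdf m' (s + h)) (cdf m s) := by
    filter_upwards [ae_unif] with u hu
    refine propext ?_
    change (quantile m u ≤ s ∧ s + h < quantile m' u) ↔ (cdf m' (s + h) < u ∧ u ≤ cdf m s)
    rw [← not_le, quantile_le_iff m hu, quantile_le_iff m' hu, not_le]
    tauto
  rw [measure_congr e, unif_Ioc (cdf_mem _ _) (cdf_mem _ _),
    ENNReal.ofReal_sub _ (cdf_nonneg _ _), ofReal_cdf, ofReal_cdf, ← hfm, ← hgm,
    Measure.map_apply_of_aemeasurable hf measurableSet_Iic,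
    Measure.map_apply_of_aemeasurable hg measurableSet_Iic]
  refine tsub_le_iff_right.2 ((measure_mono ?_).trans (measure_union_le _ _))
  intro a ha
  by_cases hga : s + h < g a
  · exact Or.inl ⟨ha, hga⟩
  · exact Or.inr (not_lt.1 hga)

lemma ofReal_abs_eq_add (x : ℝ) :
    ENNReal.ofReal |x| = ENNReal.ofReal (x - 0) + ENNReal.ofReal (-x - 0) := by
  rcases le_total 0 x with h | h
  · rw [abs_of_nonneg h, ENNReal.ofReal_of_nonpos (p := -x - 0) (by linarith)]; simp
  · rw [abs_of_nonpos h, ENNReal.ofReal_of_nonpos (p := x - 0) (by linarith)]; simp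

lemma lintegral_ofReal_sub (x : ℝ) :
    ∫⁻ h in Ioi (0 : ℝ), ENNReal.ofReal (x - h) = ENNReal.ofReal (max x 0 ^ 2 / 2) := by
  rcases le_total x 0 with hx | hx
  · rw [max_eq_right hx]
    simp only [ne_eq, OfNat.ofNat_ne_zero, not_false_eq_true, zero_pow, zero_div,
      ENNReal.ofReal_zero]
    rw [setLIntegral_congr_fun (g := fun _ => 0) measurableSet_Ioi]
    · simp
    · intro h (hh : 0 < h)
      exact ENNReal.ofReal_of_nonpos (by linarith)
  · rw [max_eq_left hx, ← Ioc_union_Ioi_eq_Ioi hx, lintegral_union measurableSet_Ioi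
      (Ioc_disjoint_Ioi le_rfl),
      setLIntegral_congr_fun (s := Ioi x) (g := fun _ => 0) measurableSet_Ioi]
    · rw [← ofReal_integral_eq_lintegral_ofReal]
      · rw [← intervalIntegral.integral_of_le hx]
        rw [intervalIntegral.integral_sub (by simp) (by simp)]
        simp
        ring_nf
      · exact (by fun_prop : Continuous fun h : ℝ => x - h).integrableOn_Ioc
      · exact (ae_restrict_mem measurableSet_Ioc).mono fun h hh => sub_nonneg.2 hh.2
    · intro h (hh : x < h)
      exact ENNReal.ofReal_of_nonpos (by linarith)

lemma ofReal_sq_eq (x : ℝ) :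
    ENNReal.ofReal (x ^ 2) = 2 * ∫⁻ h in Ioi (0 : ℝ),
      (ENNReal.ofReal (x - h) + ENNReal.ofReal (-x - h)) := by
  rw [lintegral_add_left (by fun_prop), lintegral_ofReal_sub, lintegral_ofReal_sub,
    ← ENNReal.ofReal_add (by positivity) (by positivity),
    ← ENNReal.ofReal_ofNat 2, ← ENNReal.ofReal_mul (by norm_num)]
  congr 1
  rcases le_total 0 x with h | h
  · rw [max_eq_left h, max_eq_right (by linarith)]; ring
  · rw [max_eq_right h, max_eq_left (by linarith)]; ring

lemma lintegral_swap_shift {β : Type*} [MeasurableSpace β] (Q : Measure β) [SFinite Q]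
    {φ ψ : β → ℝ} (hφ : AEMeasurable φ Q) (hψ : AEMeasurable ψ Q) :
    ∫⁻ a, (∫⁻ h in Ioi (0 : ℝ), (ENNReal.ofReal (φ a - ψ a - h) +
        ENNReal.ofReal (ψ a - φ a - h))) ∂Q
      = ∫⁻ h in Ioi (0 : ℝ), ((∫⁻ a, ENNReal.ofReal (φ a - ψ a - h) ∂Q) +
        ∫⁻ a, ENNReal.ofReal (ψ a - φ a - h) ∂Q) := by
  rw [lintegral_lintegral_swap]
  · refine lintegral_congr fun h => ?_
    rw [lintegral_add_left' (by fun_prop)]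
  · have e1 : AEMeasurable (fun q : β × ℝ => φ q.1) (Q.prod (volume.restrict (Ioi 0))) :=
      hφ.comp_fst
    have e2 : AEMeasurable (fun q : β × ℝ => ψ q.1) (Q.prod (volume.restrict (Ioi 0))) :=
      hψ.comp_fst
    exact (((e1.sub e2).sub measurable_snd.aemeasurable).ennreal_ofReal).add
      (((e2.sub e1).sub measurable_snd.aemeasurable).ennreal_ofReal)

section Optimality

variable {m m' : Measure ℝ} [IsProbabilityMeasure m] [IsProbabilityMeasure m']
  {α : Type*} [MeasurableSpace α] (P : Measure α) [SFinite P] {f g : α → ℝ}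

lemma lintegral_abs_quantile_le (hf : AEMeasurable f P) (hg : AEMeasurable g P)
    (hfm : P.map f = m) (hgm : P.map g = m') :
    ∫⁻ u, ENNReal.ofReal |quantile m u - quantile m' u| ∂unif
      ≤ ∫⁻ a, ENNReal.ofReal |f a - g a| ∂P := by
  have h1 := aemeasurable_quantile_const m
  have h2 := aemeasurable_quantile_const m'
  simp_rw [ofReal_abs_eq_add, neg_sub]
  rw [lintegral_add_left' (by fun_prop), lintegral_add_left' (by fun_prop)]
  exact add_le_add (lintegral_quantile_le P hg hf hgm hfm) (lintegral_quantile_le P hf hg hfm hgm)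

lemma lintegral_sq_quantile_le (hf : AEMeasurable f P) (hg : AEMeasurable g P)
    (hfm : P.map f = m) (hgm : P.map g = m') :
    ∫⁻ u, ENNReal.ofReal ((quantile m u - quantile m' u) ^ 2) ∂unif
      ≤ ∫⁻ a, ENNReal.ofReal ((f a - g a) ^ 2) ∂P := by
  have h1 := aemeasurable_quantile_const m
  have h2 := aemeasurable_quantile_const m'
  simp_rw [ofReal_sq_eq, neg_sub]
  rw [lintegral_const_mul' _ _ (by simp), lintegral_const_mul' _ _ (by simp)]
  gcongr 2 * ?_
  rw [lintegral_swap_shift unif h1 h2, lintegral_swap_shift P hf hg]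
  refine lintegral_mono fun h => ?_
  exact add_le_add (lintegral_quantile_le P hg hf hgm hfm) (lintegral_quantile_le P hf hg hfm hgm)

end Optimality

lemma isCoupling_map {E α : Type*} [MeasurableSpace E]
    [MeasurableSpace α] {P : Measure α} {f g : α → E}
    (hf : AEMeasurable f P) (hg : AEMeasurable g P) :
    IsCoupling (P.map fun a => (f a, g a)) (P.map f) (P.map g) := by
  constructor
  · rw [AEMeasurable.map_map_of_aemeasurable (by fun_prop) (hf.prodMk hg)]; rfl
  · rw [AEMeasurable.map_map_of_aemeasurable (by fun_prop) (hf.prodMk hg)]; rfl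

section WassersteinBounds

variable {E : Type*} [MeasurableSpace E] [PseudoMetricSpace E]

lemma W1_le_coupling {pl : Measure (E × E)} {μ ν : Measure E} (h : IsCoupling pl μ ν) :
    W1 μ ν ≤ ∫ q, dist q.1 q.2 ∂pl :=
  ciInf_le (f := fun pl : {pl : Measure (E × E) // IsCoupling pl μ ν} =>
    ∫ q, dist q.1 q.2 ∂(pl.1)) ⟨0, by rintro _ ⟨p, rfl⟩; positivity⟩ ⟨pl, h⟩

lemma W2_le_coupling {pl : Measure (E × E)} {μ ν : Measure E} (h : IsCoupling pl μ ν) :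
    W2 μ ν ≤ Real.sqrt (∫ q, dist q.1 q.2 ^ 2 ∂pl) :=
  ciInf_le (f := fun pl : {pl : Measure (E × E) // IsCoupling pl μ ν} =>
    Real.sqrt (∫ q, dist q.1 q.2 ^ 2 ∂(pl.1))) ⟨0, by rintro _ ⟨p, rfl⟩; positivity⟩ ⟨pl, h⟩

lemma W1_nonneg (μ ν : Measure E) : 0 ≤ W1 μ ν :=
  Real.iInf_nonneg fun _ => integral_nonneg fun _ => dist_nonneg

lemma W2_nonneg (μ ν : Measure E) : 0 ≤ W2 μ ν :=
  Real.iInf_nonneg fun _ => Real.sqrt_nonneg _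

variable [OpensMeasurableSpace E] [SecondCountableTopology E]
  {α : Type*} [MeasurableSpace α] {P : Measure α} {f g : α → E}

lemma W1_map_le (hf : AEMeasurable f P) (hg : AEMeasurable g P) :
    W1 (P.map f) (P.map g) ≤ ∫ a, dist (f a) (g a) ∂P := by
  refine (W1_le_coupling (isCoupling_map hf hg)).trans_eq ?_
  rw [integral_map (hf.prodMk hg) (by fun_prop)]

lemma W2_map_le (hf : AEMeasurable f P) (hg : AEMeasurable g P) :
    W2 (P.map f) (P.map g) ≤ Real.sqrt (∫ a, dist (f a) (g a) ^ 2 ∂P) := by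
  refine (W2_le_coupling (isCoupling_map hf hg)).trans_eq ?_
  rw [integral_map (hf.prodMk hg) (by fun_prop)]

end WassersteinBounds

lemma IsCoupling.integrable_fst {E F : Type*} [MeasurableSpace E] [MeasurableSpace F]
    {pl : Measure (E × F)} {μ : Measure E} {ν : Measure F} (h : IsCoupling pl μ ν) {f : E → ℝ}
    (hf : Integrable f μ) : Integrable (fun q => f q.1) pl := by
  rw [← h.1] at hf
  exact hf.comp_measurable measurable_fst

lemma IsCoupling.integrable_snd {E F : Type*} [MeasurableSpace E] [MeasurableSpace F]
    {pl : Measure (E × F)} {μ : Measure E} {ν : Measure F} (h : IsCoupling pl μ ν) {f : F → ℝ}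
    (hf : Integrable f ν) : Integrable (fun q => f q.2) pl := by
  rw [← h.2] at hf
  exact hf.comp_measurable measurable_snd

lemma IsCoupling.isProbabilityMeasure {E F : Type*} [MeasurableSpace E] [MeasurableSpace F]
    {pl : Measure (E × F)} {μ : Measure E} {ν : Measure F} (h : IsCoupling pl μ ν)
    [IsProbabilityMeasure μ] : IsProbabilityMeasure pl := by
  constructor
  rw [← preimage_univ (f := Prod.fst), ← Measure.map_apply measurable_fst MeasurableSet.univ,
    h.1, measure_univ]

instance {E F : Type*} [MeasurableSpace E] [MeasurableSpace F] (μ : Measure E) (ν : Measure F)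
    [IsProbabilityMeasure μ] [IsProbabilityMeasure ν] :
    Nonempty {pl : Measure (E × F) // IsCoupling pl μ ν} :=
  ⟨μ.prod ν, by constructor <;> simp⟩

lemma integrable_sub_sq {α : Type*} [MeasurableSpace α] {P : Measure α} {f g : α → ℝ}
    (hf : AEStronglyMeasurable f P) (hg : AEStronglyMeasurable g P)
    (hf2 : Integrable (fun a => f a ^ 2) P) (hg2 : Integrable (fun a => g a ^ 2) P) :
    Integrable (fun a => (f a - g a) ^ 2) P := by
  refine ((hf2.const_mul 2).add (hg2.const_mul 2)).mono' (by fun_prop) (ae_of_all _ fun a => ?_)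
  rw [Real.norm_of_nonneg (by positivity)]
  simp only [Pi.add_apply]
  nlinarith [sq_nonneg (f a + g a)]

section Quantile

variable {m m' : Measure ℝ} [IsProbabilityMeasure m] [IsProbabilityMeasure m']

lemma integrable_comp_quantile {f : ℝ → ℝ} (hf : Integrable f m) :
    Integrable (fun u => f (quantile m u)) unif := by
  rw [← map_quantile m] at hf
  exact hf.comp_aemeasurable (aemeasurable_quantile_const m)

/-- On the line, the monotone coupling is optimal for the `1`-Wasserstein distance. -/
lemma W1_eq_quantile (hm : Integrable (fun x => x) m) (hm' : Integrable (fun x => x) m') :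
    W1 m m' = ∫ u, |quantile m u - quantile m' u| ∂unif := by
  have h1 := aemeasurable_quantile_const m
  have h2 := aemeasurable_quantile_const m'
  refine le_antisymm ?_ (le_ciInf fun ⟨pl, hpl⟩ => ?_)
  · have := W1_map_le h1 h2
    rw [map_quantile, map_quantile] at this
    simpa only [Real.dist_eq] using this
  · have := hpl.isProbabilityMeasure
    have i1 : Integrable (fun u => |quantile m u - quantile m' u|) unif :=
      ((integrable_comp_quantile hm).sub (integrable_comp_quantile hm')).abs
    have i2 : Integrable (fun q : ℝ × ℝ => |q.1 - q.2|) pl :=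
      ((hpl.integrable_fst hm).sub (hpl.integrable_snd hm')).abs
    have key := lintegral_abs_quantile_le pl measurable_fst.aemeasurable measurable_snd.aemeasurable
      hpl.1 hpl.2
    rw [← ofReal_integral_eq_lintegral_ofReal i1 (ae_of_all _ fun _ => abs_nonneg _),
      ← ofReal_integral_eq_lintegral_ofReal i2 (ae_of_all _ fun _ => abs_nonneg _)] at key
    simpa only [Real.dist_eq] using
      (ENNReal.ofReal_le_ofReal_iff (integral_nonneg fun _ => abs_nonneg _)).1 key

/-- On the line, the monotone coupling is optimal for the `2`-Wasserstein distance. -/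
lemma W2_sq_eq_quantile (hm : Integrable (fun x => x ^ 2) m)
    (hm' : Integrable (fun x => x ^ 2) m') :
    W2 m m' ^ 2 = ∫ u, (quantile m u - quantile m' u) ^ 2 ∂unif := by
  have h1 := aemeasurable_quantile_const m
  have h2 := aemeasurable_quantile_const m'
  have h0 : 0 ≤ ∫ u, (quantile m u - quantile m' u) ^ 2 ∂unif :=
    integral_nonneg fun _ => sq_nonneg _
  suffices W2 m m' = Real.sqrt (∫ u, (quantile m u - quantile m' u) ^ 2 ∂unif) by
    rw [this, Real.sq_sqrt h0]
  refine le_antisymm ?_ (le_ciInf fun ⟨pl, hpl⟩ => ?_)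
  · have := W2_map_le h1 h2
    rw [map_quantile, map_quantile] at this
    simpa only [Real.dist_eq, sq_abs] using this
  · have := hpl.isProbabilityMeasure
    have i1 : Integrable (fun u => (quantile m u - quantile m' u) ^ 2) unif :=
      integrable_sub_sq h1.aestronglyMeasurable h2.aestronglyMeasurable
        (integrable_comp_quantile hm) (integrable_comp_quantile hm')
    have i2 : Integrable (fun q : ℝ × ℝ => (q.1 - q.2) ^ 2) pl :=
      integrable_sub_sq (by fun_prop) (by fun_prop) (hpl.integrable_fst hm)
        (hpl.integrable_snd hm')
    have key := lintegral_sq_quantile_le pl measurable_fst.aemeasurable measurable_snd.aemeasurable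
      hpl.1 hpl.2
    rw [← ofReal_integral_eq_lintegral_ofReal i1 (ae_of_all _ fun _ => sq_nonneg _),
      ← ofReal_integral_eq_lintegral_ofReal i2 (ae_of_all _ fun _ => sq_nonneg _)] at key
    refine Real.sqrt_le_sqrt ?_
    simpa only [Real.dist_eq, sq_abs] using
      (ENNReal.ofReal_le_ofReal_iff (integral_nonneg fun _ => sq_nonneg _)).1 key

end Quantile

section Disintegration

variable {ν : Measure ℝ} {μ : Measure (ℝ × ℝ)} {K : ℝ → Measure ℝ}

lemma IsDisint.aemeasurable (h : IsDisint ν μ K) [IsProbabilityMeasure μ] :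
    AEMeasurable (fun ω => (K ω).map fun x => (x, ω)) ν := by
  by_contra hn
  have h2 := h.2
  rw [Measure.bind, Measure.map_of_not_aemeasurable hn, Measure.join_zero] at h2
  exact (IsProbabilityMeasure.ne_zero μ) h2

lemma IsDisint.exists_kernel (h : IsDisint ν μ K) [IsProbabilityMeasure μ] :
    ∃ k : Kernel ℝ ℝ, IsMarkovKernel k ∧ ∀ᵐ ω ∂ν, K ω = k ω := by
  classical
  have hK : AEMeasurable K ν := by
    have := (Measure.measurable_map (Prod.fst : ℝ × ℝ → ℝ) measurable_fst).comp_aemeasurable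
      h.aemeasurable
    refine this.congr (ae_of_all _ fun ω => ?_)
    simp only [Function.comp]
    rw [Measure.map_map measurable_fst (by fun_prop)]
    exact Measure.map_id
  have hS : MeasurableSet {ω | hK.mk K ω univ = 1} :=
    (Measure.measurable_coe MeasurableSet.univ).comp hK.measurable_mk (measurableSet_singleton 1)
  refine ⟨⟨fun ω => if hK.mk K ω univ = 1 then hK.mk K ω else Measure.dirac 0,
    Measurable.ite hS hK.measurable_mk measurable_const⟩, ⟨fun ω => ?_⟩, ?_⟩
  · change IsProbabilityMeasure (if hK.mk K ω univ = 1 then hK.mk K ω else Measure.dirac 0)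
    split_ifs with h1
    · exact ⟨h1⟩
    · infer_instance
  · filter_upwards [hK.ae_eq_mk] with ω hω
    change K ω = if hK.mk K ω univ = 1 then hK.mk K ω else Measure.dirac 0
    have := h.1 ω
    rw [← hω, if_pos measure_univ]

lemma IsDisint.lintegral_eq (h : IsDisint ν μ K) [IsProbabilityMeasure μ] {f : ℝ × ℝ → ENNReal}
    (hf : Measurable f) : ∫⁻ z, f z ∂μ = ∫⁻ ω, ∫⁻ x, f (x, ω) ∂(K ω) ∂ν := by
  conv_lhs => rw [h.2]
  rw [Measure.lintegral_bind h.aemeasurable hf.aemeasurable]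
  refine lintegral_congr fun ω => ?_
  rw [lintegral_map hf (by fun_prop)]

/-- The fibres of a push-forward along a map acting on fibres. -/
lemma IsDisint.ae_eq_map [IsProbabilityMeasure ν] (h : IsDisint ν μ K) [IsProbabilityMeasure μ]
    {Y : ℝ × ℝ → ℝ} (hY : Measurable Y) {K' : ℝ → Measure ℝ}
    (h' : IsDisint ν (μ.map fun z => (Y z, z.2)) K') :
    ∀ᵐ ω ∂ν, K' ω = (K ω).map fun x => Y (x, ω) := by
  have hYm : Measurable fun z : ℝ × ℝ => (Y z, z.2) := hY.prodMk measurable_snd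
  have : IsProbabilityMeasure (μ.map fun z => (Y z, z.2)) :=
    Measure.isProbabilityMeasure_map hYm.aemeasurable
  obtain ⟨k, hk, hkK⟩ := h.exists_kernel
  obtain ⟨k', hk', hkK'⟩ := h'.exists_kernel
  let k'' : Kernel ℝ ℝ := (Kernel.id ×ₖ k).map (fun q : ℝ × ℝ => Y (q.2, q.1))
  have hYs : Measurable fun q : ℝ × ℝ => Y (q.2, q.1) := hY.comp measurable_swap
  have hk''m : IsMarkovKernel k'' := Kernel.IsMarkovKernel.map _ hYs
  have hk'' : ∀ ω, k'' ω = (k ω).map fun x => Y (x, ω) := fun ω => by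
    simp only [k'']
    rw [Kernel.map_apply _ hYs, Kernel.prod_apply, Kernel.id_apply, Measure.dirac_prod,
      Measure.map_map hYs (by fun_prop)]
    rfl
  have key : ν ⊗ₘ k' = ν ⊗ₘ k'' := by
    refine Measure.ext_of_lintegral _ fun f hf => ?_
    have e1 := h'.lintegral_eq (hf.comp measurable_swap)
    have e2 := h.lintegral_eq ((hf.comp measurable_swap).comp hYm)
    rw [lintegral_map (hf.comp measurable_swap) hYm] at e1
    rw [Measure.lintegral_compProd hf, Measure.lintegral_compProd hf]
    calc _ = ∫⁻ ω, ∫⁻ x, (f ∘ Prod.swap) (x, ω) ∂(K' ω) ∂ν := by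
          refine lintegral_congr_ae ?_
          filter_upwards [hkK'] with ω hω
          rw [hω]; rfl
      _ = ∫⁻ ω, ∫⁻ x, ((f ∘ Prod.swap) ∘ fun z : ℝ × ℝ => (Y z, z.2)) (x, ω) ∂(K ω) ∂ν := by
          rw [← e1, ← e2]; rfl
      _ = _ := by
          refine lintegral_congr_ae ?_
          filter_upwards [hkK] with ω hω
          rw [hω, hk'' ω, lintegral_map (by fun_prop) (by fun_prop)]; rfl
  filter_upwards [Kernel.ae_eq_of_compProd_eq key, hkK, hkK'] with ω h1 h2 h3
  rw [h3, h1, hk'' ω, h2]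

variable [IsProbabilityMeasure ν]

lemma IsDisint.aemeasurable_quantile (h : IsDisint ν μ K) [IsProbabilityMeasure μ] :
    AEMeasurable (fun q : ℝ × ℝ => quantile (K q.1) q.2) (ν.prod unif) := by
  obtain ⟨k, hk, hkK⟩ := h.exists_kernel
  refine (_root_.aemeasurable_quantile ν k).congr ?_
  filter_upwards [Measure.quasiMeasurePreserving_fst.ae hkK] with q hq
  rw [hq]

/-- A measure is the law of the quantile functions of its fibres. -/
lemma IsDisint.map_quantile (h : IsDisint ν μ K) [IsProbabilityMeasure μ] :
    (ν.prod unif).map (fun q : ℝ × ℝ => (quantile (K q.1) q.2, q.1)) = μ := by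
  have hm : AEMeasurable (fun q : ℝ × ℝ => (quantile (K q.1) q.2, q.1)) (ν.prod unif) :=
    h.aemeasurable_quantile.prodMk measurable_fst.aemeasurable
  refine Measure.ext_of_lintegral _ fun f hf => ?_
  rw [lintegral_map' hf.aemeasurable hm,
    lintegral_prod (fun q : ℝ × ℝ => f (quantile (K q.1) q.2, q.1)) (hf.comp_aemeasurable hm),
    h.lintegral_eq hf]
  refine lintegral_congr fun ω => ?_
  have := h.1 ω
  conv_rhs => rw [← _root_.map_quantile (K ω)]
  rw [lintegral_map' (by fun_prop) (aemeasurable_quantile_const (K ω))]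

lemma IsDisint.ae_integrable (h : IsDisint ν μ K) [IsProbabilityMeasure μ] {f : ℝ → ℝ}
    (hf : Measurable f) (hi : Integrable (fun z : ℝ × ℝ => f z.1) μ) :
    ∀ᵐ ω ∂ν, Integrable f (K ω) := by
  have hm : AEMeasurable (fun q : ℝ × ℝ => (quantile (K q.1) q.2, q.1)) (ν.prod unif) :=
    h.aemeasurable_quantile.prodMk measurable_fst.aemeasurable
  rw [← h.map_quantile] at hi
  filter_upwards [(hi.comp_aemeasurable hm).prod_right_ae] with ω hω
  have := h.1 ω
  rw [← _root_.map_quantile (K ω)]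
  exact (integrable_map_measure hf.aestronglyMeasurable (aemeasurable_quantile_const _)).2 hω

end Disintegration

section PartialDerivative

/-- Partial derivative with respect to the first variable. -/
def dx (f : ℝ × ℝ → ℝ) (z : ℝ × ℝ) : ℝ := deriv (fun x => f (x, z.2)) z.1

variable {f g : ℝ × ℝ → ℝ}

lemma hasDerivAt_fst {z : ℝ × ℝ} (hf : DifferentiableAt ℝ f z) :
    HasDerivAt (fun x => f (x, z.2)) (fderiv ℝ f z (1, 0)) z.1 := by
  have h1 : HasDerivAt (fun x : ℝ => (x, z.2)) ((1 : ℝ), (0 : ℝ)) z.1 :=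
    (hasDerivAt_id z.1).prodMk (hasDerivAt_const z.1 z.2)
  exact HasFDerivAt.comp_hasDerivAt z.1 (f := fun x : ℝ => (x, z.2)) hf.hasFDerivAt h1

lemma dx_eq_fderiv (hf : Differentiable ℝ f) : dx f = fun z => fderiv ℝ f z (1, 0) :=
  funext fun z => (hasDerivAt_fst (hf z)).deriv

lemma hasDerivAt_dx (hf : Differentiable ℝ f) (x ω : ℝ) :
    HasDerivAt (fun x => f (x, ω)) (dx f (x, ω)) x := by
  rw [dx_eq_fderiv hf]
  exact hasDerivAt_fst (z := (x, ω)) (hf _)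

lemma ContDiff.dx {m n : WithTop ℕ∞} (hf : ContDiff ℝ n f) (hmn : m + 1 ≤ n) :
    ContDiff ℝ m (dx f) := by
  rw [dx_eq_fderiv (hf.differentiable (by rintro rfl; simp at hmn))]
  exact (hf.fderiv_right hmn).clm_apply contDiff_const

lemma HasCompactSupport.dx (hf : Differentiable ℝ f) (hc : HasCompactSupport f) :
    HasCompactSupport (dx f) := by
  rw [dx_eq_fderiv hf]
  exact (hc.fderiv ℝ).comp_left (g := fun L : ℝ × ℝ →L[ℝ] ℝ => L (1, 0)) (by simp)

lemma dx_add (hf : Differentiable ℝ f) (hg : Differentiable ℝ g) (z : ℝ × ℝ) :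
    dx (fun z => f z + g z) z = dx f z + dx g z :=
  ((hasDerivAt_dx hf z.1 z.2).add (hasDerivAt_dx hg z.1 z.2)).deriv

lemma dx_mul (hf : Differentiable ℝ f) (hg : Differentiable ℝ g) (z : ℝ × ℝ) :
    dx (fun z => f z * g z) z = dx f z * g z + f z * dx g z :=
  ((hasDerivAt_dx hf z.1 z.2).mul (hasDerivAt_dx hg z.1 z.2)).deriv

end PartialDerivative

/-- A smooth compactly supported function of one variable equal to `1` on `[-r, r]`. -/
def cutoff (r : ℝ) (hr : 0 < r) : ContDiffBump (0 : ℝ) := ⟨r, r + 1, hr, by linarith⟩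

lemma cutoff_eq_one {r : ℝ} (hr : 0 < r) {x : ℝ} (hx : |x| ≤ r) : cutoff r hr x = 1 :=
  (cutoff r hr).one_of_mem_closedBall (by simpa [cutoff] using hx)

lemma cutoff_eventuallyEq_one {r : ℝ} (hr : 0 < r) {x : ℝ} (hx : |x| < r) :
    ∀ᶠ y in 𝓝 x, cutoff r hr y = 1 :=
  (cutoff r hr).eventuallyEq_one_of_mem_ball (by simpa [cutoff] using hx)

lemma cutoff_eq_zero {r : ℝ} (hr : 0 < r) {x : ℝ} (hx : r + 1 ≤ |x|) : cutoff r hr x = 0 :=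
  (cutoff r hr).zero_of_le_dist (by simpa [cutoff] using hx)

lemma hasCompactSupport_mul {E F : Type*} [TopologicalSpace E] [TopologicalSpace F]
    [R1Space E] [R1Space F] {f : E → ℝ} {g : F → ℝ} (hf : HasCompactSupport f)
    (hg : HasCompactSupport g) :
    HasCompactSupport fun z : E × F => f z.1 * g z.2 := by
  refine HasCompactSupport.of_support_subset_isCompact (hf.prod hg) fun z hz => ?_
  rw [Function.mem_support] at hz
  exact ⟨subset_tsupport _ (left_ne_zero_of_mul hz), subset_tsupport _ (right_ne_zero_of_mul hz)⟩

/-- A smooth compactly supported function of two variables equal to `1` on a square. -/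
def cutoff₂ (r : ℝ) (hr : 0 < r) (z : ℝ × ℝ) : ℝ := cutoff r hr z.1 * cutoff r hr z.2

lemma contDiff_cutoff₂ {r : ℝ} (hr : 0 < r) {n : ℕ∞} : ContDiff ℝ n (cutoff₂ r hr) :=
  ((cutoff r hr).contDiff.comp contDiff_fst).mul ((cutoff r hr).contDiff.comp contDiff_snd)

lemma hasCompactSupport_cutoff₂ {r : ℝ} (hr : 0 < r) : HasCompactSupport (cutoff₂ r hr) :=
  hasCompactSupport_mul (cutoff r hr).hasCompactSupport (cutoff r hr).hasCompactSupport

section WeakFormulation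

variable {F : Measure (ℝ × ℝ) → ℝ × ℝ → ℝ} {μ : ℝ → Measure (ℝ × ℝ)}

/-- The flux of a test function along a solution. -/
def flux (F : Measure (ℝ × ℝ) → ℝ × ℝ → ℝ) (μ : ℝ → Measure (ℝ × ℝ)) (ψ : ℝ × ℝ → ℝ) (s : ℝ) : ℝ :=
  ∫ z, F (μ s) z * dx ψ z ∂(μ s)

lemma integrable_flux
    (hc : ∀ t, 0 ≤ t → Continuous (F (μ t)))
    (hp : ∀ t, 0 ≤ t → IsProbabilityMeasure (μ t))
    {ψ : ℝ × ℝ → ℝ} (hψ : ContDiff ℝ 1 ψ) (hψc : HasCompactSupport ψ) {s : ℝ}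
    (hs : 0 ≤ s) : Integrable (fun z => F (μ s) z * dx ψ z) (μ s) := by
  have := hp s hs
  have h1 := (ContDiff.dx (m := 0) hψ (by simp)).continuous
  have h2 := HasCompactSupport.dx (hψ.differentiable (by simp)) hψc
  exact ((hc s hs).mul h1).integrable_of_hasCompactSupport h2.mul_left

lemma IsSol.affine_in_time (hsol : IsSol F μ)
    (hc : ∀ t, 0 ≤ t → Continuous (F (μ t)))
    (hp : ∀ t, 0 ≤ t → IsProbabilityMeasure (μ t))
    {ψ : ℝ × ℝ → ℝ} (hψ : ContDiff ℝ 1 ψ) (hψc : HasCompactSupport ψ)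
    (l : ℝ) {t : ℝ} (ht : 0 ≤ t) :
    (1 + l * t) * ∫ z, ψ z ∂(μ t) = (∫ z, ψ z ∂(μ 0)) +
      ∫ s in (0 : ℝ)..t, (l * (∫ z, ψ z ∂(μ s)) + (1 + l * s) * flux F μ ψ s) := by
  have ht1 : 0 < t + 1 := by linarith
  obtain ⟨b, hbd, hbc, hb⟩ : ∃ b : ℝ → ℝ, ContDiff ℝ 1 b ∧ HasCompactSupport b ∧
      ∀ x, |x| < t + 1 → ∀ᶠ y in 𝓝 x, b y = 1 :=
    ⟨cutoff (t + 1) ht1, (cutoff (t + 1) ht1).contDiff, (cutoff (t + 1) ht1).hasCompactSupport,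
      fun x hx => cutoff_eventuallyEq_one ht1 hx⟩
  have hone : ∀ s ∈ Icc 0 t, b s = 1 := fun s hs =>
    (hb s (by rw [abs_of_nonneg hs.1]; linarith [hs.2])).self_of_nhds
  have hcd : ContDiff ℝ 1 fun u : ℝ => b u * (1 + l * u) := hbd.mul (by fun_prop)
  have hcs : HasCompactSupport fun u : ℝ => b u * (1 + l * u) := hbc.mul_right
  have := hsol.2 (fun u z => b u * (1 + l * u) * ψ z)
    ((hcd.comp contDiff_fst).mul (hψ.comp contDiff_snd)) (hasCompactSupport_mul hcs hψc) t ht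
  simp only [integral_const_mul] at this
  rw [hone t ⟨ht, le_rfl⟩, hone 0 ⟨le_rfl, ht⟩, one_mul, one_mul, mul_zero, add_zero,
    one_mul] at this
  rw [this]
  congr 1
  refine intervalIntegral.integral_congr fun s hs => ?_
  rw [uIcc_of_le ht] at hs
  have := hp s hs.1
  have hd : ∀ z, deriv (fun u => b u * (1 + l * u) * ψ z) s = l * ψ z := by
    intro z
    have : (fun u => b u * (1 + l * u) * ψ z) =ᶠ[𝓝 s]
        fun u => (1 + l * u) * ψ z := by
      filter_upwards [hb s (by rw [abs_of_nonneg hs.1]; linarith [hs.2])] with u hu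
      rw [hu, one_mul]
    rw [this.deriv_eq]
    simp
  have hdx : ∀ z : ℝ × ℝ, deriv (fun x => b s * (1 + l * s) * ψ (x, z.2)) z.1
      = (1 + l * s) * dx ψ z := by
    intro z
    rw [hone s hs, one_mul]
    exact ((hasDerivAt_dx (hψ.differentiable (by simp)) z.1 z.2).const_mul _).deriv
  have hψi : Integrable ψ (μ s) := hψ.continuous.integrable_of_hasCompactSupport hψc
  simp only [hd, hdx]
  rw [flux, ← integral_const_mul, ← integral_const_mul, ← integral_add]
  · refine integral_congr_ae (ae_of_all _ fun z => ?_)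
    ring
  · exact hψi.const_mul _
  · exact (integrable_flux hc hp hψ hψc hs.1).const_mul _

lemma IsSol.continuousOn (hsol : IsSol F μ)
    {ψ : ℝ × ℝ → ℝ} (hψ : Continuous ψ) (hψc : HasCompactSupport ψ)
    (t : ℝ) : ContinuousOn (fun s => ∫ z, ψ z ∂(μ s)) (Icc 0 t) :=
  (hsol.1 ψ hψ hψc).mono Icc_subset_Ici_self

lemma IsSol.integral_eq_zero_of_not_intervalIntegrable (hsol : IsSol F μ)
    (hc : ∀ t, 0 ≤ t → Continuous (F (μ t)))
    (hp : ∀ t, 0 ≤ t → IsProbabilityMeasure (μ t))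
    {ψ : ℝ × ℝ → ℝ} (hψ : ContDiff ℝ 1 ψ)
    (hψc : HasCompactSupport ψ) {t : ℝ} (ht : 0 ≤ t)
    (hn : ¬ IntervalIntegrable (flux F μ ψ) volume 0 t) : ∫ z, ψ z ∂(μ 0) = 0 := by
  have key : ∀ l : ℝ, 0 ≤ l → (1 + l * t) * ∫ z, ψ z ∂(μ t) = ∫ z, ψ z ∂(μ 0) := by
    intro l hl
    rw [hsol.affine_in_time hc hp hψ hψc l ht, intervalIntegral.integral_undef, add_zero]
    intro hi
    refine hn ?_
    have hA : IntervalIntegrable (fun s => l * ∫ z, ψ z ∂(μ s)) volume 0 t := by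
      refine ContinuousOn.intervalIntegrable ?_
      rw [uIcc_of_le ht]
      exact (hsol.continuousOn hψ.continuous hψc t).const_smul l
    have hB := (hi.sub hA).mul_continuousOn (g := fun s => (1 + l * s)⁻¹) (by
      rw [uIcc_of_le ht]
      refine ContinuousOn.inv₀ (by fun_prop) fun s hs => ?_
      have := mul_nonneg hl hs.1
      positivity)
    refine hB.congr fun s hs => ?_
    rw [uIoc_of_le ht] at hs
    have : 1 + l * s ≠ 0 := by have := mul_nonneg hl hs.1.le; positivity
    field_simp
    ring
  have h0 := key 0 le_rfl
  have h1 := key 1 zero_le_one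
  rcases ht.eq_or_lt with rfl | ht'
  · exact absurd IntervalIntegrable.refl hn
  · have : t * ∫ z, ψ z ∂(μ t) = 0 := by linarith
    have := (mul_eq_zero.1 this).resolve_left ht'.ne'
    rw [← h0, this, mul_zero]

lemma exists_integral_cutoff₂_ne_zero (m : Measure (ℝ × ℝ)) [IsProbabilityMeasure m] :
    ∃ (r : ℝ) (hr : 0 < r), ∫ z, cutoff₂ r hr z ∂m ≠ 0 := by
  have hU : (⋃ n : ℕ, Metric.closedBall (0 : ℝ × ℝ) n) = univ := Metric.iUnion_closedBall_nat _
  obtain ⟨n, hn⟩ : ∃ n : ℕ, m (Metric.closedBall (0 : ℝ × ℝ) n) ≠ 0 := by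
    by_contra! h
    have := measure_iUnion_null h
    rw [hU, measure_univ] at this
    exact one_ne_zero this
  have hr : (0 : ℝ) < n + 1 := by positivity
  refine ⟨n + 1, hr, fun h => hn ?_⟩
  have hi : Integrable (cutoff₂ (n + 1) hr) m :=
    (contDiff_cutoff₂ hr (n := 0)).continuous.integrable_of_hasCompactSupport
      (hasCompactSupport_cutoff₂ hr)
  rw [integral_eq_zero_iff_of_nonneg (f := cutoff₂ (n + 1) hr)
    (fun z => mul_nonneg (cutoff _ hr).nonneg (cutoff _ hr).nonneg) hi] at h
  refine measure_mono_null (fun z hz => ?_) (ae_iff.1 h)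
  rw [mem_closedBall_zero_iff, Prod.norm_def, max_le_iff, Real.norm_eq_abs, Real.norm_eq_abs] at hz
  simp [cutoff₂, cutoff_eq_one hr (hz.1.trans (by linarith)),
    cutoff_eq_one hr (hz.2.trans (by linarith))]

/-- For a solution, the flux of any test function is integrable in time. -/
lemma IsSol.intervalIntegrable_flux (hsol : IsSol F μ)
    (hc : ∀ t, 0 ≤ t → Continuous (F (μ t)))
    (hp : ∀ t, 0 ≤ t → IsProbabilityMeasure (μ t))
    {ψ : ℝ × ℝ → ℝ} (hψ : ContDiff ℝ 1 ψ)
    (hψc : HasCompactSupport ψ) {t : ℝ} (ht : 0 ≤ t) :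
    IntervalIntegrable (flux F μ ψ) volume 0 t := by
  by_contra hn
  have := hp 0 le_rfl
  obtain ⟨r, hr, h0⟩ := exists_integral_cutoff₂_ne_zero (μ 0)
  set χ := cutoff₂ r hr
  have hχ : ContDiff ℝ 1 χ := contDiff_cutoff₂ hr
  have hχc : HasCompactSupport χ := hasCompactSupport_cutoff₂ hr
  have hi : IntervalIntegrable (flux F μ χ) volume 0 t := by
    by_contra h
    exact h0 (hsol.integral_eq_zero_of_not_intervalIntegrable hc hp hχ hχc ht h)
  have hz := hsol.integral_eq_zero_of_not_intervalIntegrable hc hp hψ hψc ht hn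
  have hn' : ¬ IntervalIntegrable (flux F μ fun z => ψ z + χ z) volume 0 t := by
    intro h
    refine hn ((h.sub hi).congr fun s hs => ?_)
    rw [uIoc_of_le ht] at hs
    simp only [flux]
    rw [← integral_sub (integrable_flux hc hp (hψ.add hχ) (hψc.add hχc) hs.1.le)
      (integrable_flux hc hp hχ hχc hs.1.le)]
    refine integral_congr_ae (ae_of_all _ fun z => ?_)
    simp only []
    rw [dx_add (hψ.differentiable (by simp)) (hχ.differentiable (by simp))]
    ring
  have hz' := hsol.integral_eq_zero_of_not_intervalIntegrable hc hp (hψ.add hχ)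
    (hψc.add hχc) ht hn'
  rw [integral_add (hψ.continuous.integrable_of_hasCompactSupport hψc)
    (hχ.continuous.integrable_of_hasCompactSupport hχc), hz, zero_add] at hz'
  exact h0 hz'

lemma IsSol.integral_sub_eq (hsol : IsSol F μ)
    (hc : ∀ t, 0 ≤ t → Continuous (F (μ t)))
    (hp : ∀ t, 0 ≤ t → IsProbabilityMeasure (μ t))
    {ψ : ℝ × ℝ → ℝ} (hψ : ContDiff ℝ 1 ψ) (hψc : HasCompactSupport ψ)
    {s t : ℝ} (hs : 0 ≤ s) (hst : s ≤ t) :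
    (∫ z, ψ z ∂(μ t)) - ∫ z, ψ z ∂(μ s) = ∫ r in s..t, flux F μ ψ r := by
  have h1 := hsol.affine_in_time hc hp hψ hψc 0 hs
  have h2 := hsol.affine_in_time hc hp hψ hψc 0 (hs.trans hst)
  simp only [zero_mul, add_zero, one_mul, zero_add] at h1 h2
  rw [h1, h2, add_sub_add_left_eq_sub, intervalIntegral.integral_interval_sub_left
    (hsol.intervalIntegrable_flux hc hp hψ hψc (hs.trans hst))
    (hsol.intervalIntegrable_flux hc hp hψ hψc hs)]

end WeakFormulation

section Field

lemma measure_compl_msupp (ν : Measure ℝ) : ν (msupp ν)ᶜ = 0 := by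
  refine measure_null_of_locally_null _ fun z hz => ?_
  have : ∃ U : Set ℝ, IsOpen U ∧ z ∈ U ∧ ν U = 0 := by
    simpa [msupp] using hz
  obtain ⟨U, hU, hzU, h0⟩ := this
  exact ⟨U, mem_nhdsWithin_of_mem_nhds (hU.mem_nhds hzU), h0⟩

variable {ν : Measure ℝ} {F : Measure (ℝ × ℝ) → ℝ × ℝ → ℝ} {A B I M κ γ : ℝ}

lemma ae_snd_mem_msupp {m : Measure (ℝ × ℝ)} (hm : m.map Prod.snd = ν) :
    ∀ᵐ z ∂m, z.2 ∈ msupp ν := by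
  refine ae_of_ae_map (f := Prod.snd) measurable_snd.aemeasurable (p := fun ω => ω ∈ msupp ν) ?_
  rw [hm]
  exact measure_compl_msupp ν

lemma Framework.abs_sub_le (hF : Framework ν F A B I M κ γ) {m : Measure (ℝ × ℝ)}
    (hm : m ∈ P2nu ν) (z z' : ℝ × ℝ) :
    |F m z - F m z'| ≤ κ * I * |z.1 - z'.1| + I * |z.2 - z'.2| := by
  obtain ⟨hd, h1, -, h2⟩ := hF.hA2 m hm
  have hd' := hd.differentiable (by simp)
  have e1 : ‖F m (z.1, z.2) - F m (z'.1, z.2)‖ ≤ κ * I * ‖z.1 - z'.1‖ :=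
    Convex.norm_image_sub_le_of_norm_deriv_le (s := univ) (f := fun x => F m (x, z.2))
      (fun x _ => (hasDerivAt_dx hd' x z.2).differentiableAt)
      (fun x _ => h1 (x, z.2)) convex_univ (mem_univ _) (mem_univ _)
  have e2 : ‖F m (z'.1, z.2) - F m (z'.1, z'.2)‖ ≤ I * ‖z.2 - z'.2‖ :=
    Convex.norm_image_sub_le_of_norm_deriv_le (s := univ) (f := fun w => F m (z'.1, w))
      (fun w _ => by fun_prop)
      (fun w _ => h2 (z'.1, w)) convex_univ (mem_univ _) (mem_univ _)
  rw [Real.norm_eq_abs, Real.norm_eq_abs] at e1 e2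
  calc |F m z - F m z'| ≤ _ := _root_.abs_sub_le _ (F m (z'.1, z.2)) _
    _ ≤ _ := add_le_add e1 e2

lemma P2nu.continuous (hF : Framework ν F A B I M κ γ) {m : Measure (ℝ × ℝ)}
    (hm : m ∈ P2nu ν) : Continuous (F m) := (hF.hA2 m hm).1.continuous

/-- A smooth compactly supported function of `x` equal to `x` near `[-R, R]`. -/
def truncId (R x : ℝ) : ℝ := x * cutoff 1 one_pos (x / R)

lemma contDiff_truncId (R : ℝ) {n : ℕ∞} : ContDiff ℝ n (truncId R) :=
  contDiff_id.mul ((cutoff 1 one_pos).contDiff.comp (contDiff_id.div_const R))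

lemma truncId_eq_zero {R : ℝ} (hR : 0 < R) {x : ℝ} (hx : 2 * R ≤ |x|) : truncId R x = 0 := by
  rw [truncId, cutoff_eq_zero, mul_zero]
  rw [abs_div, abs_of_pos hR, le_div_iff₀ hR]
  linarith

lemma hasCompactSupport_truncId {R : ℝ} (hR : 0 < R) : HasCompactSupport (truncId R) :=
  HasCompactSupport.of_support_subset_isCompact (isCompact_Icc (a := -(2 * R)) (b := 2 * R))
    fun x hx => by
      rw [mem_Icc, ← abs_le]
      by_contra! h
      exact hx (truncId_eq_zero hR h.le)

lemma truncId_eq {R : ℝ} (hR : 0 < R) (x : ℝ) : truncId R x = R * truncId 1 (x / R) := by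
  simp only [truncId, div_one]
  field_simp

lemma deriv_truncId {R : ℝ} (hR : 0 < R) (x : ℝ) :
    deriv (truncId R) x = deriv (truncId 1) (x / R) := by
  have h : HasDerivAt (truncId 1) (deriv (truncId 1) (x / R)) (x / R) :=
    ((contDiff_truncId 1 (n := 1)).differentiable (by simp) _).hasDerivAt
  have h2 := (h.comp x ((hasDerivAt_id x).div_const R)).const_mul R
  have : truncId R = fun x => R * truncId 1 (x / R) := funext fun x => truncId_eq hR x
  rw [this]
  have h3 := h2.deriv
  rw [mul_one_div, mul_div_cancel₀ _ hR.ne'] at h3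
  exact h3

lemma exists_abs_deriv_truncId_le : ∃ C : ℝ, ∀ R > 0, ∀ x, |deriv (truncId R) x| ≤ C := by
  obtain ⟨C, hC⟩ := ((hasCompactSupport_truncId one_pos).deriv).exists_bound_of_continuous
    ((contDiff_truncId 1 (n := 1)).continuous_deriv (by simp))
  exact ⟨C, fun R hR x => by rw [deriv_truncId hR]; exact hC _⟩

lemma deriv_truncId_eq_one {R : ℝ} (hR : 0 < R) {x : ℝ} (hx : |x| < R) :
    deriv (truncId R) x = 1 := by
  have h : ∀ᶠ y in 𝓝 (x / R), cutoff 1 one_pos y = 1 := by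
    refine cutoff_eventuallyEq_one one_pos ?_
    rw [abs_div, abs_of_pos hR, div_lt_one hR]
    exact hx
  have h2 : ∀ᶠ y in 𝓝 x, cutoff 1 one_pos (y / R) = 1 :=
    (continuous_id.div_const R).continuousAt.eventually h
  have : truncId R =ᶠ[𝓝 x] id := by
    filter_upwards [h2] with y hy
    rw [truncId, hy, mul_one, id]
  rw [this.deriv_eq, deriv_id]

end Field

section VelocityBound

variable {ν : Measure ℝ} {F : Measure (ℝ × ℝ) → ℝ × ℝ → ℝ} {A B I M κ γ : ℝ}
  {μ : ℝ → Measure (ℝ × ℝ)}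

lemma dx_mul_comp {p θ : ℝ → ℝ} (z : ℝ × ℝ) :
    dx (fun z => p z.1 * θ z.2) z = deriv p z.1 * θ z.2 := by
  simp [dx]

lemma exists_pos_bound (hΩ : Bornology.IsBounded (msupp ν)) :
    ∃ W : ℝ, 0 < W ∧ ∀ ω ∈ msupp ν, |ω| ≤ W := by
  obtain ⟨W, hW, h⟩ := hΩ.exists_pos_norm_le
  exact ⟨W, hW, h⟩

/-- For a compactly supported test function, the velocity at the origin is controlled by the
flux as soon as the mean slope of the test function is bounded below. -/
lemma exists_velocity_le_flux (hF : Framework ν F A B I M κ γ) (hI : 0 ≤ I) (hκ : 0 ≤ κ)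
    (hP : ∀ t : ℝ, 0 ≤ t → μ t ∈ P2nu ν) {ψ : ℝ × ℝ → ℝ}
    (hψ : ContDiff ℝ 1 ψ) (hψc : HasCompactSupport ψ) :
    ∃ C : ℝ, 0 ≤ C ∧ ∀ s, 0 ≤ s → 1 / 2 ≤ ∫ z, dx ψ z ∂(μ s) →
      |F (μ s) 0| ≤ 2 * |flux F μ ψ s| + C := by
  have hd := hψ.differentiable (by simp)
  have hcont : Continuous (dx ψ) := (ContDiff.dx (m := 0) hψ (by simp)).continuous
  have hcs := HasCompactSupport.dx hd hψc
  obtain ⟨C, hC⟩ := (hcs.mul_left (f := fun z : ℝ × ℝ => κ * I * |z.1| + I * |z.2|)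
    ).exists_bound_of_continuous ((by fun_prop : Continuous fun z : ℝ × ℝ =>
      κ * I * |z.1| + I * |z.2|).mul hcont)
  refine ⟨2 * |C|, by positivity, fun s hs h2 => ?_⟩
  have := (hP s hs).1
  have hc : ∀ t, 0 ≤ t → Continuous (F (μ t)) := fun t ht => P2nu.continuous hF (hP t ht)
  have hp : ∀ t, 0 ≤ t → IsProbabilityMeasure (μ t) := fun t ht => (hP t ht).1
  have hi0 : Integrable (fun z => F (μ s) 0 * dx ψ z) (μ s) :=
    (hcont.integrable_of_hasCompactSupport hcs).const_mul _
  have hi := integrable_flux hc hp hψ hψc hs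
  have key : |flux F μ ψ s - F (μ s) 0 * ∫ z, dx ψ z ∂(μ s)| ≤ |C| := by
    rw [flux, ← integral_const_mul, ← integral_sub hi hi0]
    suffices h : ∀ z, ‖F (μ s) z * dx ψ z - F (μ s) 0 * dx ψ z‖ ≤ |C| by
      simpa using norm_integral_le_of_norm_le_const (μ := μ s) (ae_of_all _ h)
    intro z
    have h1 := hC z
    have h3 := hF.abs_sub_le (hP s hs) z 0
    simp only [Pi.mul_apply, Prod.fst_zero, Prod.snd_zero, sub_zero] at h1 h3
    rw [Real.norm_eq_abs, abs_mul, abs_of_nonneg (by positivity)] at h1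
    rw [← sub_mul, Real.norm_eq_abs, abs_mul]
    exact (mul_le_mul_of_nonneg_right h3 (abs_nonneg _)).trans (h1.trans (le_abs_self _))
  have h4 : |F (μ s) 0| * (1 / 2) ≤ |F (μ s) 0 * ∫ z, dx ψ z ∂(μ s)| := by
    rw [abs_mul, abs_of_nonneg (a := ∫ z, dx ψ z ∂(μ s)) (by linarith)]
    exact mul_le_mul_of_nonneg_left h2 (abs_nonneg _)
  have h5 := abs_sub_abs_le_abs_sub (F (μ s) 0 * ∫ z, dx ψ z ∂(μ s)) (flux F μ ψ s)
  rw [abs_sub_comm] at h5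
  linarith

lemma tendsto_integral_dx_truncId (m : Measure (ℝ × ℝ)) [IsProbabilityMeasure m] {W : ℝ}
    (hW : 0 < W) (hm : ∀ᵐ z ∂m, |z.2| ≤ W) :
    Tendsto (fun n : ℕ => ∫ z, dx (fun z => truncId (n + 1) z.1 * cutoff W hW z.2) z ∂m)
      atTop (𝓝 1) := by
  obtain ⟨C, hC⟩ := exists_abs_deriv_truncId_le
  have h1 : ∫ _ : ℝ × ℝ, (1 : ℝ) ∂m = 1 := by simp
  nth_rw 2 [← h1]
  refine tendsto_integral_of_dominated_convergence (fun _ => C) (fun n => ?_) (by simp)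
    (fun n => ?_) ?_
  · refine Continuous.aestronglyMeasurable ?_
    rw [show dx (fun z => truncId (n + 1) z.1 * cutoff W hW z.2) = _ from funext dx_mul_comp]
    exact (((contDiff_truncId _ (n := 1)).continuous_deriv (by simp)).comp continuous_fst).mul
      ((cutoff W hW).continuous.comp continuous_snd)
  · filter_upwards [hm] with z hz
    rw [dx_mul_comp, cutoff_eq_one hW hz, mul_one]
    exact hC _ (by positivity) _
  · filter_upwards [hm] with z hz
    refine tendsto_const_nhds.congr' ?_
    filter_upwards [tendsto_natCast_atTop_atTop.eventually_gt_atTop |z.1|] with n hn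
    rw [dx_mul_comp, cutoff_eq_one hW hz, mul_one,
      deriv_truncId_eq_one (by positivity) (by linarith)]

/-- Along a solution, the velocity at the origin is bounded by an integrable function of time. -/
lemma IsSol.exists_intervalIntegrable_bound (hΩ : Bornology.IsBounded (msupp ν))
    (hF : Framework ν F A B I M κ γ) (hI : 0 ≤ I) (hκ : 0 ≤ κ)
    (hsol : IsSol F μ) (hP : ∀ t : ℝ, 0 ≤ t → μ t ∈ P2nu ν) {T : ℝ} (hT : 0 ≤ T) :
    ∃ g : ℝ → ℝ, IntervalIntegrable g volume 0 T ∧ (∀ s, 0 ≤ g s) ∧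
      ∀ s ∈ Icc 0 T, |F (μ s) 0| ≤ g s := by
  have hc : ∀ t, 0 ≤ t → Continuous (F (μ t)) := fun t ht => P2nu.continuous hF (hP t ht)
  have hp : ∀ t, 0 ≤ t → IsProbabilityMeasure (μ t) := fun t ht => (hP t ht).1
  obtain ⟨W, hW, hWΩ⟩ := exists_pos_bound hΩ
  refine (isCompact_Icc (a := (0 : ℝ)) (b := T)).induction_on (p := fun S => ∃ g : ℝ → ℝ,
    IntervalIntegrable g volume 0 T ∧ (∀ s, 0 ≤ g s) ∧ ∀ s ∈ S, |F (μ s) 0| ≤ g s) ?_ ?_ ?_ ?_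
  · exact ⟨0, intervalIntegrable_const, fun _ => le_rfl, by simp⟩
  · rintro S S' h ⟨g, h1, h2, h3⟩
    exact ⟨g, h1, h2, fun s hs => h3 s (h hs)⟩
  · rintro S S' ⟨g, h1, h2, h3⟩ ⟨g', h1', h2', h3'⟩
    refine ⟨fun s => g s + g' s, h1.add h1', fun s => add_nonneg (h2 s) (h2' s), ?_⟩
    rintro s (hs | hs)
    · exact (h3 s hs).trans (le_add_of_nonneg_right (h2' s))
    · exact (h3' s hs).trans (le_add_of_nonneg_left (h2 s))
  · intro s hs
    have := hp s hs.1
    obtain ⟨n, hn⟩ := ((tendsto_integral_dx_truncId (μ s) hW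
      ((ae_snd_mem_msupp (hP s hs.1).2.2).mono fun z hz => hWΩ _ hz)).eventually_const_lt
        (show (1 / 2 : ℝ) < 1 by norm_num)).exists
    have hn0 : (0 : ℝ) < n + 1 := by positivity
    set ψ : ℝ × ℝ → ℝ := fun z => truncId (n + 1) z.1 * cutoff W hW z.2
    have hψ : ContDiff ℝ 1 ψ := ((contDiff_truncId _).comp contDiff_fst).mul
      ((cutoff W hW).contDiff.comp contDiff_snd)
    have hψc : HasCompactSupport ψ :=
      hasCompactSupport_mul (hasCompactSupport_truncId hn0) (cutoff W hW).hasCompactSupport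
    have hcont : Continuous (dx ψ) := (ContDiff.dx (m := 0) hψ (by simp)).continuous
    have hcs := HasCompactSupport.dx (hψ.differentiable (by simp)) hψc
    obtain ⟨C, hC0, hC⟩ := exists_velocity_le_flux hF hI hκ hP hψ hψc
    refine ⟨{r | r ∈ Icc 0 T ∧ 1 / 2 < ∫ z, dx ψ z ∂(μ r)}, ?_,
      fun r => 2 * |flux F μ ψ r| + C, ?_, fun r => by positivity, ?_⟩
    · exact inter_mem self_mem_nhdsWithin
        ((hsol.continuousOn hcont hcs T s hs).eventually_const_lt hn)
    · exact ((hsol.intervalIntegrable_flux hc hp hψ hψc hT).abs.const_mul 2).add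
        intervalIntegrable_const
    · exact fun r hr => hC r hr.1.1 hr.2.le

end VelocityBound

/-- A Gronwall inequality with a merely integrable coefficient. -/
lemma exists_gronwall_const {k : ℝ → ℝ} {T : ℝ} (hT : 0 ≤ T) (hk : IntervalIntegrable k volume 0 T)
    (hk0 : ∀ s, 0 ≤ k s) : ∃ C : ℝ, ∀ u : ℝ → ℝ, ContinuousOn u (Icc 0 T) →
      (∀ s ∈ Icc 0 T, 0 ≤ u s) →
      (∀ s t, 0 ≤ s → s ≤ t → t ≤ T → u t ≤ u s + ∫ r in s..t, k r * u r) →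
      ∀ t ∈ Icc 0 T, u t ≤ C * u 0 := by
  have hsub : ∀ {s t}, 0 ≤ s → s ≤ t → t ≤ T → IntervalIntegrable k volume s t := by
    intro s t h1 h2 h3
    refine hk.mono_set ?_
    rw [uIcc_of_le h2, uIcc_of_le hT]
    exact Icc_subset_Icc h1 h3
  have hcont : ContinuousOn (fun t => ∫ r in (0 : ℝ)..t, k r) (Icc 0 T) := by
    have := intervalIntegral.continuousOn_primitive_interval' (a := 0) hk left_mem_uIcc
    rwa [uIcc_of_le hT] at this
  have hunif := isCompact_Icc.uniformContinuousOn_of_continuous hcont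
  obtain ⟨δ, hδ, hd⟩ := Metric.uniformContinuousOn_iff.1 hunif (1 / 2) (by norm_num)
  obtain ⟨N, hN⟩ := exists_nat_gt (T / (δ / 2))
  rw [div_lt_iff₀ (by positivity)] at hN
  refine ⟨2 ^ N, fun u hu hu0 h => ?_⟩
  suffices H : ∀ i : ℕ, ∀ t ∈ Icc 0 T, t ≤ i * (δ / 2) → u t ≤ 2 ^ i * u 0 from
    fun t ht => H N t ht (ht.2.trans hN.le)
  have h00 : 0 ≤ u 0 := hu0 0 ⟨le_rfl, hT⟩
  intro i
  induction i with
  | zero =>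
    intro t ht h0
    have : t = 0 := le_antisymm (by simpa using h0) ht.1
    simp [this]
  | succ i ih =>
    intro t ht hti
    rcases le_total t (i * (δ / 2)) with hle | hle
    · refine (ih t ht hle).trans (mul_le_mul_of_nonneg_right ?_ h00)
      exact pow_le_pow_right₀ one_le_two (Nat.le_succ i)
    set s := i * (δ / 2)
    have hs : 0 ≤ s := by positivity
    have hss : Icc s t ⊆ Icc 0 T := Icc_subset_Icc hs ht.2
    obtain ⟨τ, hτ, hmax⟩ := isCompact_Icc.exists_isMaxOn ⟨t, hle, le_rfl⟩ (hu.mono hss)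
    have hsT : s ∈ Icc 0 T := ⟨hs, hle.trans ht.2⟩
    have h1 := h s τ hs hτ.1 (hτ.2.trans ht.2)
    have hkτ := hsub hs hτ.1 (hτ.2.trans ht.2)
    have h2 : ∫ r in s..τ, k r * u r ≤ ∫ r in s..τ, k r * u τ := by
      refine intervalIntegral.integral_mono_on hτ.1 ?_ (hkτ.mul_const _) fun r hr =>
        mul_le_mul_of_nonneg_left (hmax ⟨hr.1, hr.2.trans hτ.2⟩) (hk0 r)
      refine hkτ.mul_continuousOn (hu.mono ?_)
      rw [uIcc_of_le hτ.1]
      exact Icc_subset_Icc hs (hτ.2.trans ht.2)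
    have h3 : ∫ r in s..τ, k r ≤ 1 / 2 := by
      have h4 := hd τ (hss hτ) s hsT (by
        rw [Real.dist_eq, abs_of_nonneg (by linarith [hτ.1])]
        have : t ≤ s + δ / 2 := by
          have : (((i + 1 : ℕ) : ℝ)) * (δ / 2) = s + δ / 2 := by push_cast; ring
          linarith
        linarith [hτ.2])
      rw [Real.dist_eq, intervalIntegral.integral_interval_sub_left
        (hsub le_rfl (hs.trans hτ.1) (hτ.2.trans ht.2)) (hsub le_rfl hs hsT.2)] at h4
      exact (le_abs_self _).trans h4.le
    rw [intervalIntegral.integral_mul_const] at h2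
    have h5 := mul_le_mul_of_nonneg_right h3 (hu0 τ (hss hτ))
    have h6 : u t ≤ u τ := hmax ⟨hle, le_rfl⟩
    have h7 := ih s hsT le_rfl
    rw [pow_succ]
    linarith

section MomentTest

/-- The square of the positive part is continuously differentiable. -/
lemma hasDerivAt_sq_posPart (y : ℝ) : HasDerivAt (fun y : ℝ => max y 0 ^ 2) (2 * max y 0) y := by
  rcases lt_trichotomy y 0 with hy | rfl | hy
  · have : (fun y : ℝ => max y 0 ^ 2) =ᶠ[𝓝 y] fun _ => 0 := by
      filter_upwards [Iio_mem_nhds hy] with z hz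
      simp [max_eq_right (mem_Iio.1 hz).le]
    rw [max_eq_right hy.le, mul_zero]
    exact (hasDerivAt_const y (0 : ℝ)).congr_of_eventuallyEq this
  · rw [hasDerivAt_iff_isLittleO_nhds_zero]
    simp only [max_self, zero_add, mul_zero, smul_zero, sub_zero, ne_eq, OfNat.ofNat_ne_zero,
      not_false_eq_true, zero_pow]
    have h1 : (fun h : ℝ => max h 0 ^ 2) =O[𝓝 0] fun h : ℝ => h ^ 2 := by
      refine Asymptotics.IsBigO.of_bound 1 (Eventually.of_forall fun h => ?_)
      rw [one_mul, norm_pow, norm_pow]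
      refine pow_le_pow_left₀ (norm_nonneg _) ?_ 2
      rw [Real.norm_eq_abs, Real.norm_eq_abs, abs_of_nonneg (le_max_right _ _)]
      exact max_le (le_abs_self h) (abs_nonneg h)
    refine h1.trans_isLittleO ?_
    simpa using Asymptotics.isLittleO_pow_pow (𝕜 := ℝ) (m := 1) (n := 2) (by norm_num)
  · have : (fun y : ℝ => max y 0 ^ 2) =ᶠ[𝓝 y] fun y => y ^ 2 := by
      filter_upwards [Ioi_mem_nhds hy] with z hz
      rw [max_eq_left (mem_Ioi.1 hz).le]
    rw [max_eq_left hy.le]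
    simpa using (hasDerivAt_pow 2 y).congr_of_eventuallyEq this

/-- The Japanese bracket `√(1 + x²)`. -/
def bracket (x : ℝ) : ℝ := √(1 + x ^ 2)

lemma one_le_bracket (x : ℝ) : 1 ≤ bracket x :=
  Real.one_le_sqrt.2 (by nlinarith [sq_nonneg x])

lemma bracket_sq (x : ℝ) : bracket x ^ 2 = 1 + x ^ 2 := Real.sq_sqrt (by positivity)

lemma abs_le_bracket (x : ℝ) : |x| ≤ bracket x :=
  Real.abs_le_sqrt (by linarith)

lemma hasDerivAt_bracket (x : ℝ) : HasDerivAt bracket (x / bracket x) x := by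
  have h := ((hasDerivAt_pow 2 x).const_add 1).sqrt (by positivity : (1 : ℝ) + x ^ 2 ≠ 0)
  have hb : x / bracket x = ↑2 * x ^ (2 - 1) / (2 * √(1 + x ^ 2)) := by
    unfold bracket
    push_cast
    rw [pow_one, mul_div_mul_left _ _ two_ne_zero]
  rw [hb]
  exact h

lemma continuous_bracket : Continuous bracket := by unfold bracket; fun_prop

/-- The inner profile of `momentTest`. -/
def bracketTrunc (ε x : ℝ) : ℝ := bracket x / (1 + ε * bracket x) ^ 2

lemma bracketTrunc_le {ε : ℝ} (hε : 0 < ε) (x : ℝ) : bracketTrunc ε x ≤ bracket x := by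
  have := one_le_bracket x
  refine div_le_self (by positivity) (one_le_pow₀ ?_)
  have : 0 ≤ ε * bracket x := by positivity
  linarith

lemma hasDerivAt_bracketTrunc {ε : ℝ} (hε : 0 < ε) (x : ℝ) :
    HasDerivAt (bracketTrunc ε)
      (x / bracket x * (1 - ε * bracket x) / (1 + ε * bracket x) ^ 3) x := by
  have h1 := one_le_bracket x
  have h0 : (1 + ε * bracket x) ≠ 0 := by positivity
  have hb := hasDerivAt_bracket x
  have h := hb.div (((hb.const_mul ε).const_add 1).pow 2) (pow_ne_zero 2 h0)
  refine h.congr_deriv ?_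
  have h2 : bracket x ≠ 0 := by positivity
  simp only [Pi.pow_apply]
  field_simp
  push_cast
  ring

lemma one_add_abs_mul_deriv_bracketTrunc_le {ε : ℝ} (hε : 0 < ε) (x : ℝ) :
    (1 + |x|) * |x / bracket x * (1 - ε * bracket x) / (1 + ε * bracket x) ^ 3| ≤
      2 * bracketTrunc ε x := by
  have h1 := one_le_bracket x
  have h2 := abs_le_bracket x
  have h0 : 0 < 1 + ε * bracket x := by positivity
  have hx : |x / bracket x| ≤ 1 := by
    rw [abs_div, abs_of_pos (a := bracket x) (by positivity)]
    exact div_le_one_of_le₀ h2 (by positivity)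
  have hy : |1 - ε * bracket x| ≤ 1 + ε * bracket x := by
    have : 0 ≤ ε * bracket x := by positivity
    rw [abs_le]; constructor <;> linarith
  rw [abs_div, abs_mul, abs_of_pos (a := (1 + ε * bracket x) ^ 3) (by positivity), bracketTrunc,
    ← mul_div_assoc, ← mul_div_assoc, div_le_div_iff₀ (by positivity) (by positivity)]
  calc (1 + |x|) * (|x / bracket x| * |1 - ε * bracket x|) * (1 + ε * bracket x) ^ 2
      ≤ (2 * bracket x) * (1 * (1 + ε * bracket x)) * (1 + ε * bracket x) ^ 2 := by
        gcongr
        linarith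
    _ = 2 * bracket x * (1 + ε * bracket x) ^ 3 := by ring

/-- A compactly supported `C¹` truncation of the second moment weight. -/
def momentTest (ε x : ℝ) : ℝ := max (bracketTrunc ε x - 1) 0 ^ 2

lemma momentTest_nonneg (ε x : ℝ) : 0 ≤ momentTest ε x := sq_nonneg _

lemma hasDerivAt_momentTest {ε : ℝ} (hε : 0 < ε) (x : ℝ) :
    HasDerivAt (momentTest ε) (2 * max (bracketTrunc ε x - 1) 0 *
      (x / bracket x * (1 - ε * bracket x) / (1 + ε * bracket x) ^ 3)) x :=
  (hasDerivAt_sq_posPart _).comp x ((hasDerivAt_bracketTrunc hε x).sub_const 1)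

lemma continuous_bracketTrunc {ε : ℝ} (hε : 0 < ε) : Continuous (bracketTrunc ε) :=
  continuous_iff_continuousAt.2 fun x => (hasDerivAt_bracketTrunc hε x).continuousAt

lemma contDiff_momentTest {ε : ℝ} (hε : 0 < ε) : ContDiff ℝ 1 (momentTest ε) := by
  rw [contDiff_one_iff_deriv]
  refine ⟨fun x => (hasDerivAt_momentTest hε x).differentiableAt, ?_⟩
  rw [funext fun x => (hasDerivAt_momentTest hε x).deriv]
  have h1 := one_le_bracket
  have h0 : ∀ x, (1 + ε * bracket x) ^ 3 ≠ 0 := fun x => by have := h1 x; positivity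
  have h2 : ∀ x, bracket x ≠ 0 := fun x => by have := h1 x; positivity
  have := continuous_bracketTrunc hε
  have := continuous_bracket
  refine Continuous.mul (by fun_prop) ((Continuous.mul ?_ (by fun_prop)).div (by fun_prop) h0)
  exact continuous_id.div this h2

lemma hasCompactSupport_momentTest {ε : ℝ} (hε : 0 < ε) : HasCompactSupport (momentTest ε) := by
  refine HasCompactSupport.of_support_subset_isCompact
    (isCompact_Icc (a := -(1 / ε ^ 2)) (b := 1 / ε ^ 2)) fun x hx => ?_
  rw [mem_Icc, ← abs_le]
  by_contra! h
  refine hx ?_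
  have h1 := one_le_bracket x
  have h2 : 1 / ε ^ 2 ≤ bracket x := h.le.trans (abs_le_bracket x)
  rw [div_le_iff₀ (by positivity)] at h2
  have : bracketTrunc ε x ≤ 1 := by
    refine div_le_one_of_le₀ ?_ (by positivity)
    nlinarith [mul_nonneg hε.le (zero_le_one.trans h1)]
  rw [momentTest, max_eq_right (by linarith)]
  norm_num

lemma one_add_abs_mul_deriv_momentTest_le {ε : ℝ} (hε : 0 < ε) (x : ℝ) :
    (1 + |x|) * |deriv (momentTest ε) x| ≤ 6 * (momentTest ε x + 1) := by
  rw [(hasDerivAt_momentTest hε x).deriv, abs_mul,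
    abs_of_nonneg (mul_nonneg zero_le_two (le_max_right (bracketTrunc ε x - 1) 0))]
  have h := one_add_abs_mul_deriv_bracketTrunc_le hε x
  set d := |x / bracket x * (1 - ε * bracket x) / (1 + ε * bracket x) ^ 3|
  have h3 := mul_le_mul_of_nonneg_left h
    (by positivity : 0 ≤ 2 * max (bracketTrunc ε x - 1) 0)
  rw [momentTest]
  rcases le_total (bracketTrunc ε x - 1) 0 with h4 | h4
  · rw [max_eq_right h4]; norm_num
  · rw [max_eq_left h4] at h3 ⊢
    nlinarith [sq_nonneg (bracketTrunc ε x - 2)]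

lemma momentTest_le {ε : ℝ} (hε : 0 < ε) (x : ℝ) : momentTest ε x ≤ 1 + x ^ 2 := by
  rw [← bracket_sq, momentTest]
  refine pow_le_pow_left₀ (le_max_right _ _) (max_le ?_ ?_) 2
  · linarith [bracketTrunc_le hε x]
  · linarith [one_le_bracket x]

lemma tendsto_momentTest (x : ℝ) :
    Tendsto (fun n : ℕ => momentTest (1 / (n + 1)) x) atTop (𝓝 ((bracket x - 1) ^ 2)) := by
  have h := (tendsto_one_div_add_atTop_nhds_zero_nat (𝕜 := ℝ))
  have hc : ContinuousAt (fun ε : ℝ => momentTest ε x) 0 := by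
    unfold momentTest bracketTrunc
    refine ContinuousAt.pow (ContinuousAt.sup (ContinuousAt.sub ?_ continuousAt_const)
      continuousAt_const) 2
    exact continuousAt_const.div (by fun_prop) (by simp)
  have h2 := hc.tendsto.comp h
  have : momentTest 0 x = (bracket x - 1) ^ 2 := by
    simp [momentTest, bracketTrunc, max_eq_left (sub_nonneg.2 (one_le_bracket x))]
  rwa [this] at h2

end MomentTest

section SecondMoment

variable {ν : Measure ℝ} {F : Measure (ℝ × ℝ) → ℝ × ℝ → ℝ} {A B I M κ γ : ℝ}
  {μ : ℝ → Measure (ℝ × ℝ)}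

lemma P2nu.integrable_sq {m : Measure (ℝ × ℝ)} (hm : m ∈ P2nu ν) :
    Integrable (fun z : ℝ × ℝ => z.1 ^ 2) m := by
  refine hm.2.1.mono (by fun_prop) (ae_of_all _ fun z => ?_)
  rw [Real.norm_eq_abs, Real.norm_eq_abs, abs_of_nonneg (by positivity),
    abs_of_nonneg (by positivity)]
  nlinarith [sq_nonneg z.2]

/-- Second moments are locally bounded in time along solutions. -/
lemma IsSol.exists_second_moment_le (hΩ : Bornology.IsBounded (msupp ν))
    (hF : Framework ν F A B I M κ γ) (hI : 0 ≤ I) (hκ : 0 ≤ κ)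
    (hsol : IsSol F μ) (hP : ∀ t : ℝ, 0 ≤ t → μ t ∈ P2nu ν) {T : ℝ} (hT : 0 ≤ T) :
    ∃ m : ℝ, ∀ s ∈ Icc 0 T, ∫ z, z.1 ^ 2 ∂(μ s) ≤ m := by
  have hc : ∀ t, 0 ≤ t → Continuous (F (μ t)) := fun t ht => P2nu.continuous hF (hP t ht)
  have hp : ∀ t, 0 ≤ t → IsProbabilityMeasure (μ t) := fun t ht => (hP t ht).1
  obtain ⟨W, hW, hWΩ⟩ := exists_pos_bound hΩ
  have hWae : ∀ t, 0 ≤ t → ∀ᵐ z ∂(μ t), |z.2| ≤ W := fun t ht =>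
    (ae_snd_mem_msupp (hP t ht).2.2).mono fun z hz => hWΩ _ hz
  obtain ⟨g, hg, hg0, hgF⟩ := hsol.exists_intervalIntegrable_bound hΩ hF hI hκ hP hT
  set c := κ * I + I * W
  have hc0 : 0 ≤ c := by positivity
  have hk : IntervalIntegrable (fun s => 6 * (g s + c)) volume 0 T :=
    (hg.add intervalIntegrable_const).const_mul 6
  have hk0 : ∀ s, 0 ≤ 6 * (g s + c) := fun s => by have := hg0 s; positivity
  obtain ⟨C, hC⟩ := exists_gronwall_const hT hk hk0
  have key : ∀ ε > 0, ∀ t ∈ Icc 0 T, ∫ z, momentTest ε z.1 ∂(μ t) + 1 ≤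
      |C| * (∫ z, z.1 ^ 2 ∂(μ 0) + 2) := by
    intro ε hε
    set ψ : ℝ × ℝ → ℝ := fun z => momentTest ε z.1 * cutoff W hW z.2
    have hψ : ContDiff ℝ 1 ψ := ((contDiff_momentTest hε).comp contDiff_fst).mul
      ((cutoff W hW).contDiff.comp contDiff_snd)
    have hψc : HasCompactSupport ψ :=
      hasCompactSupport_mul (hasCompactSupport_momentTest hε) (cutoff W hW).hasCompactSupport
    have hψe : ∀ t, 0 ≤ t → ∫ z, ψ z ∂(μ t) = ∫ z, momentTest ε z.1 ∂(μ t) := fun t ht =>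
      integral_congr_ae ((hWae t ht).mono fun z hz => by
        simp only [ψ, cutoff_eq_one hW hz, mul_one])
    have hψ0 : ∀ t, 0 ≤ ∫ z, ψ z ∂(μ t) := fun t =>
      integral_nonneg fun z => mul_nonneg (momentTest_nonneg _ _) (cutoff W hW).nonneg
    have hucont := hsol.continuousOn hψ.continuous hψc T
    have hψi : ∀ t, 0 ≤ t → Integrable ψ (μ t) := fun t ht => by
      have := hp t ht
      exact hψ.continuous.integrable_of_hasCompactSupport hψc
    have hflux : ∀ s ∈ Icc 0 T, flux F μ ψ s ≤ 6 * (g s + c) * (∫ z, ψ z ∂(μ s) + 1) := by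
      intro s hs
      have := hp s hs.1
      have h1 : ∫ z, ψ z ∂(μ s) + 1 = ∫ z, (ψ z + 1) ∂(μ s) := by
        rw [integral_add (hψi s hs.1) (integrable_const _)]
        simp
      rw [h1, flux, ← integral_const_mul]
      refine integral_mono_ae (integrable_flux hc hp hψ hψc hs.1)
        (((hψi s hs.1).add (integrable_const _)).const_mul _) ?_
      filter_upwards [hWae s hs.1] with z hz
      simp only [ψ, dx_mul_comp, cutoff_eq_one hW hz, mul_one]
      have h2 := hF.abs_sub_le (hP s hs.1) z 0
      have h3 := abs_sub_abs_le_abs_sub (F (μ s) z) (F (μ s) 0)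
      have h4 := hgF s hs
      simp only [Prod.fst_zero, Prod.snd_zero, sub_zero] at h2
      have h5 : |F (μ s) z| ≤ (g s + c) * (1 + |z.1|) := by
        have h6 : I * |z.2| ≤ I * W := mul_le_mul_of_nonneg_left hz hI
        have h7 := mul_nonneg (hg0 s) (abs_nonneg z.1)
        have h8 : 0 ≤ I * W * |z.1| := by positivity
        have h9 : 0 ≤ κ * I := by positivity
        simp only [c]
        nlinarith
      have h10 := one_add_abs_mul_deriv_momentTest_le hε z.1
      have h11 := hg0 s
      calc F (μ s) z * deriv (momentTest ε) z.1 ≤ |F (μ s) z| * |deriv (momentTest ε) z.1| := by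
            rw [← abs_mul]; exact le_abs_self _
        _ ≤ (g s + c) * (1 + |z.1|) * |deriv (momentTest ε) z.1| := by gcongr
        _ = (g s + c) * ((1 + |z.1|) * |deriv (momentTest ε) z.1|) := by ring
        _ ≤ (g s + c) * (6 * (momentTest ε z.1 + 1)) := by gcongr
        _ = _ := by ring
    have hu := hC (fun t => ∫ z, ψ z ∂(μ t) + 1) (hucont.add continuousOn_const)
      (fun s _ => add_nonneg (hψ0 s) zero_le_one) (fun s t hs hst htT => by
        have h1 := hsol.integral_sub_eq hc hp hψ hψc hs hst
        have hmono : uIcc s t ⊆ uIcc 0 T := by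
          rw [uIcc_of_le hst, uIcc_of_le hT]
          exact Icc_subset_Icc hs htT
        have h2 : ∫ r in s..t, flux F μ ψ r ≤
            ∫ r in s..t, 6 * (g r + c) * (∫ z, ψ z ∂(μ r) + 1) := by
          refine intervalIntegral.integral_mono_on hst
            ((hsol.intervalIntegrable_flux hc hp hψ hψc hT).mono_set hmono)
            ((hk.mono_set hmono).mul_continuousOn ?_)
            fun r hr => hflux r ⟨hs.trans hr.1, hr.2.trans htT⟩
          refine (hucont.add continuousOn_const).mono ?_
          rwa [uIcc_of_le hT] at hmono
        linarith)
    intro t ht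
    have h0 := hp 0 le_rfl
    have h1 := hu t ht
    rw [hψe t ht.1, hψe 0 le_rfl] at h1
    refine h1.trans ((mul_le_mul_of_nonneg_right (le_abs_self C) ?_).trans
      (mul_le_mul_of_nonneg_left ?_ (abs_nonneg C)))
    · rw [← hψe 0 le_rfl]; exact add_nonneg (hψ0 0) zero_le_one
    · have h2 : ∫ z, momentTest ε z.1 ∂(μ 0) ≤ ∫ z, (1 + z.1 ^ 2) ∂(μ 0) := by
        refine integral_mono_of_nonneg (ae_of_all _ fun z => momentTest_nonneg _ _)
          ((integrable_const _).add (P2nu.integrable_sq (hP 0 le_rfl)))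
          (ae_of_all _ fun z => momentTest_le hε z.1)
      rw [integral_add (integrable_const _) (P2nu.integrable_sq (hP 0 le_rfl))] at h2
      simp only [integral_const, probReal_univ, smul_eq_mul, one_mul] at h2
      linarith
  refine ⟨2 * (|C| * (∫ z, z.1 ^ 2 ∂(μ 0) + 2)) + 2, fun s hs => ?_⟩
  have := hp s hs.1
  have hsq := P2nu.integrable_sq (hP s hs.1)
  have hlim : Tendsto (fun n : ℕ => ∫ z, momentTest (1 / (n + 1)) z.1 ∂(μ s)) atTop
      (𝓝 (∫ z, (bracket z.1 - 1) ^ 2 ∂(μ s))) := by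
    refine tendsto_integral_of_dominated_convergence (fun z => 1 + z.1 ^ 2) (fun n => ?_)
      ((integrable_const _).add hsq) (fun n => ae_of_all _ fun z => ?_)
      (ae_of_all _ fun z => tendsto_momentTest z.1)
    · exact ((contDiff_momentTest (by positivity)).continuous.comp
        continuous_fst).aestronglyMeasurable
    · rw [Real.norm_eq_abs, abs_of_nonneg (momentTest_nonneg _ _)]
      exact momentTest_le (by positivity) _
  have hle : ∫ z, (bracket z.1 - 1) ^ 2 ∂(μ s) ≤ |C| * (∫ z, z.1 ^ 2 ∂(μ 0) + 2) :=
    le_of_tendsto' hlim fun n => by linarith [key (1 / (n + 1)) (by positivity) s hs]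
  have hbi : Integrable (fun z : ℝ × ℝ => (bracket z.1 - 1) ^ 2) (μ s) := by
    refine ((integrable_const (1 : ℝ)).add hsq).mono
      ((((continuous_bracket.comp continuous_fst).sub continuous_const).pow
        2).aestronglyMeasurable) (ae_of_all _ fun z => ?_)
    have h1 := one_le_bracket z.1
    have h2 := bracket_sq z.1
    rw [Real.norm_eq_abs, Real.norm_eq_abs, abs_of_nonneg (sq_nonneg _)]
    simp only [Pi.add_apply]
    rw [abs_of_nonneg (by positivity)]
    nlinarith
  calc ∫ z, z.1 ^ 2 ∂(μ s) ≤ ∫ z, (2 * (bracket z.1 - 1) ^ 2 + 2) ∂(μ s) := by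
        refine integral_mono hsq ((hbi.const_mul 2).add (integrable_const _)) fun z => ?_
        have h2 := bracket_sq z.1
        simp only []
        nlinarith [sq_nonneg (bracket z.1 - 2)]
    _ = 2 * ∫ z, (bracket z.1 - 1) ^ 2 ∂(μ s) + 2 := by
        rw [integral_add (hbi.const_mul 2) (integrable_const _), integral_const_mul]
        simp
    _ ≤ _ := by linarith

end SecondMoment

lemma isCoupling_withDensity {E : Type*} [MeasurableSpace E] {m m' : Measure E}
    [IsProbabilityMeasure m] [IsProbabilityMeasure m'] {k : E × E → ℝ} (hk : Measurable k)
    (hk0 : ∀ q, 0 ≤ k q) (h1 : ∀ᵐ x ∂m, Integrable (fun y => k (x, y)) m' ∧ ∫ y, k (x, y) ∂m' = 1)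
    (h2 : ∀ᵐ y ∂m', Integrable (fun x => k (x, y)) m ∧ ∫ x, k (x, y) ∂m = 1) :
    IsCoupling ((m.prod m').withDensity fun q => ENNReal.ofReal (k q)) m m' := by
  have hm : Measurable fun q => ENNReal.ofReal (k q) := hk.ennreal_ofReal
  constructor
  · ext s hs
    have e : ∀ q : E × E, (Prod.fst ⁻¹' s).indicator (fun q => ENNReal.ofReal (k q)) q =
        s.indicator (fun _ => ENNReal.ofReal (k q)) q.1 := fun q => rfl
    rw [Measure.map_apply measurable_fst hs, withDensity_apply _ (measurable_fst hs),
      ← lintegral_indicator (measurable_fst hs),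
      lintegral_prod _ (hm.indicator (measurable_fst hs)).aemeasurable]
    rw [← lintegral_indicator_one hs]
    refine lintegral_congr_ae ?_
    filter_upwards [h1] with x hx
    simp only [e]
    by_cases hxs : x ∈ s
    · simp only [indicator_of_mem hxs, Pi.one_apply]
      rw [← ofReal_integral_eq_lintegral_ofReal hx.1 (ae_of_all _ fun y => hk0 _), hx.2,
        ENNReal.ofReal_one]
    · simp [indicator_of_notMem hxs]
  · ext s hs
    have e : ∀ q : E × E, (Prod.snd ⁻¹' s).indicator (fun q => ENNReal.ofReal (k q)) q =
        s.indicator (fun _ => ENNReal.ofReal (k q)) q.2 := fun q => rfl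
    rw [Measure.map_apply measurable_snd hs, withDensity_apply _ (measurable_snd hs),
      ← lintegral_indicator (measurable_snd hs),
      lintegral_prod_symm _ (hm.indicator (measurable_snd hs)).aemeasurable]
    rw [← lintegral_indicator_one hs]
    refine lintegral_congr_ae ?_
    filter_upwards [h2] with x hx
    simp only [e]
    by_cases hxs : x ∈ s
    · simp only [indicator_of_mem hxs, Pi.one_apply]
      rw [← ofReal_integral_eq_lintegral_ofReal hx.1 (ae_of_all _ fun y => hk0 _), hx.2,
        ENNReal.ofReal_one]
    · simp [indicator_of_notMem hxs]

lemma W1_le_density {E : Type*} [MeasurableSpace E] [PseudoMetricSpace E] {m m' : Measure E}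
    [IsProbabilityMeasure m] [IsProbabilityMeasure m'] {k : E × E → ℝ} (hk : Measurable k)
    (hk0 : ∀ q, 0 ≤ k q) (h1 : ∀ᵐ x ∂m, Integrable (fun y => k (x, y)) m' ∧ ∫ y, k (x, y) ∂m' = 1)
    (h2 : ∀ᵐ y ∂m', Integrable (fun x => k (x, y)) m ∧ ∫ x, k (x, y) ∂m = 1) :
    W1 m m' ≤ ∫ q, k q * dist q.1 q.2 ∂(m.prod m') := by
  refine (W1_le_coupling (isCoupling_withDensity hk hk0 h1 h2)).trans_eq ?_
  rw [integral_withDensity_eq_integral_toReal_smul hk.ennreal_ofReal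
    (ae_of_all _ fun q => ENNReal.ofReal_lt_top)]
  simp only [ENNReal.toReal_ofReal (hk0 _), smul_eq_mul]

lemma ae_sum_add_mul_div_eq_one {E : Type*} [MeasurableSpace E] {ι : Type*} [Fintype ι]
    {m : Measure E} [IsProbabilityMeasure m] {α : ι → ℝ}
    {w : ι → E → ℝ} (hi : Integrable (fun x => 1 - ∑ j, α j * w j x) m)
    (h0 : ∀ x, 0 ≤ 1 - ∑ j, α j * w j x) {ρ : ℝ} (hρ : ∫ x, (1 - ∑ j, α j * w j x) ∂m = ρ) :
    ∀ᵐ x ∂m, ∑ j, α j * w j x + (1 - ∑ j, α j * w j x) * ρ / ρ = 1 := by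
  by_cases h : ρ = 0
  · rw [h, integral_eq_zero_iff_of_nonneg h0 hi] at hρ
    filter_upwards [hρ] with x hx
    simp only [Pi.zero_apply] at hx
    rw [hx, h]
    linarith
  · refine ae_of_all _ fun x => ?_
    rw [mul_div_assoc, div_self h]
    ring

lemma integral_norm_mul_le {E : Type*} [MeasurableSpace E] [NormedAddCommGroup E] {m : Measure E}
    (hm : Integrable (fun z => ‖z‖ ^ 2) m)
    {r : E → ℝ} (hr0 : ∀ z, 0 ≤ r z) (hr1 : ∀ z, r z ≤ 1) (hr : Integrable r m) {R : ℝ}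
    (hR : 0 < R) : ∫ z, ‖z‖ * r z ∂m ≤ R * ∫ z, r z ∂m + (∫ z, ‖z‖ ^ 2 ∂m) / R := by
  rw [← integral_const_mul, ← integral_div, ← integral_add (hr.const_mul R) (hm.div_const R)]
  refine integral_mono_of_nonneg (ae_of_all _ fun z => mul_nonneg (norm_nonneg _) (hr0 z))
    ((hr.const_mul R).add (hm.div_const R)) (ae_of_all _ fun z => ?_)
  rcases le_total ‖z‖ R with h | h
  · have : 0 ≤ ‖z‖ ^ 2 / R := by positivity
    have := mul_le_mul_of_nonneg_right h (hr0 z)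
    simp only []
    linarith
  · have h1 : ‖z‖ ≤ ‖z‖ ^ 2 / R := by
      rw [le_div_iff₀ hR, sq]
      exact mul_le_mul_of_nonneg_left h (norm_nonneg _)
    have h2 := mul_le_mul_of_nonneg_left (hr1 z) (norm_nonneg z)
    have h3 := mul_nonneg hR.le (hr0 z)
    simp only []
    linarith

/-- Coupling two measures with almost equal masses on small cells. -/
lemma W1_le_of_partition {E : Type*} [MeasurableSpace E] [NormedAddCommGroup E] [BorelSpace E]
    [SecondCountableTopology E] {ι : Type*} [Fintype ι] {m m' : Measure E}
    [IsProbabilityMeasure m] [IsProbabilityMeasure m']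
    (hm : Integrable (fun z => ‖z‖ ^ 2) m) (hm' : Integrable (fun z => ‖z‖ ^ 2) m')
    {w : ι → E → ℝ} (hw : ∀ j, Continuous (w j)) (hw0 : ∀ j z, 0 ≤ w j z)
    (hw1 : ∀ z, ∑ j, w j z ≤ 1) {R d : ℝ} (hR : 0 < R) (hwR : ∀ z, ‖z‖ ≤ R → ∑ j, w j z = 1)
    (hd : ∀ j z z', w j z ≠ 0 → w j z' ≠ 0 → dist z z' ≤ d) (hd0 : 0 ≤ d) :
    W1 m m' ≤ d + 2 * R * ∑ j, |∫ z, w j z ∂m - ∫ z, w j z ∂m'| +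
      (3 * ∫ z, ‖z‖ ^ 2 ∂m + ∫ z, ‖z‖ ^ 2 ∂m') / R := by
  have hwj : ∀ j z, w j z ≤ 1 := fun j z =>
    (Finset.single_le_sum (fun j _ => hw0 j z) (Finset.mem_univ j)).trans (hw1 z)
  have hwb : ∀ j z, ‖w j z‖ ≤ 1 := fun j z => by
    rw [Real.norm_eq_abs, abs_of_nonneg (hw0 j z)]; exact hwj j z
  have hwi : ∀ j, Integrable (w j) m := fun j =>
    Integrable.of_bound (hw j).aestronglyMeasurable 1 (ae_of_all _ (hwb j))
  have hwi' : ∀ j, Integrable (w j) m' := fun j =>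
    Integrable.of_bound (hw j).aestronglyMeasurable 1 (ae_of_all _ (hwb j))
  obtain ⟨a, ha⟩ : ∃ a : ι → ℝ, ∀ j, ∫ z, w j z ∂m = a j := ⟨_, fun j => rfl⟩
  obtain ⟨b, hb⟩ : ∃ b : ι → ℝ, ∀ j, ∫ z, w j z ∂m' = b j := ⟨_, fun j => rfl⟩
  have ha0 : ∀ j, 0 ≤ a j := fun j => by rw [← ha]; exact integral_nonneg (hw0 j)
  have hb0 : ∀ j, 0 ≤ b j := fun j => by rw [← hb]; exact integral_nonneg (hw0 j)
  obtain ⟨c, hc⟩ : ∃ c : ι → ℝ, ∀ j, c j = min (a j) (b j) / (a j * b j) := ⟨_, fun j => rfl⟩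
  have hc0 : ∀ j, 0 ≤ c j := fun j => by
    rw [hc]; exact div_nonneg (le_min (ha0 j) (hb0 j)) (mul_nonneg (ha0 j) (hb0 j))
  have hcab : ∀ j, c j * b j * a j = min (a j) (b j) := fun j => by
    rw [hc, mul_assoc, mul_comm (b j)]
    rcases (ha0 j).eq_or_lt with h | h
    · rw [← h, zero_mul, mul_zero, min_eq_left (hb0 j)]
    rcases (hb0 j).eq_or_lt with h' | h'
    · rw [← h', mul_zero, mul_zero, min_eq_right (ha0 j)]
    · exact div_mul_cancel₀ _ (by positivity)
  have hcb0 : ∀ j, 0 ≤ c j * b j := fun j => mul_nonneg (hc0 j) (hb0 j)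
  have hca0 : ∀ j, 0 ≤ c j * a j := fun j => mul_nonneg (hc0 j) (ha0 j)
  have hcb : ∀ j, c j * b j ≤ 1 := fun j => by
    rcases (ha0 j).eq_or_lt with h | h
    · rw [hc, ← h, zero_mul, div_zero, zero_mul]; exact zero_le_one
    · refine le_of_mul_le_mul_right ?_ h
      rw [hcab, one_mul]
      exact min_le_left _ _
  have hca : ∀ j, c j * a j ≤ 1 := fun j => by
    rcases (hb0 j).eq_or_lt with h | h
    · rw [hc, ← h, mul_zero, div_zero, zero_mul]; exact zero_le_one
    · refine le_of_mul_le_mul_right ?_ h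
      rw [mul_right_comm, hcab, one_mul]
      exact min_le_right _ _
  have hs0 : ∀ α : ι → ℝ, (∀ j, α j ≤ 1) → ∀ z, 0 ≤ 1 - ∑ j, α j * w j z := fun α hα z =>
    sub_nonneg.2 ((Finset.sum_le_sum fun j _ =>
      mul_le_of_le_one_left (hw0 j z) (hα j)).trans (hw1 z))
  have hs1 : ∀ α : ι → ℝ, (∀ j, 0 ≤ α j) → ∀ z, 1 - ∑ j, α j * w j z ≤ 1 := fun α hα z =>
    sub_le_self _ (Finset.sum_nonneg fun j _ => mul_nonneg (hα j) (hw0 j z))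
  obtain ⟨ρ, hρ⟩ : ∃ ρ : ℝ, ρ = 1 - ∑ j, min (a j) (b j) := ⟨_, rfl⟩
  obtain ⟨r, hr⟩ : ∃ r : E → ℝ, ∀ z, r z = 1 - ∑ j, c j * b j * w j z := ⟨_, fun j => rfl⟩
  obtain ⟨r', hr'⟩ : ∃ r' : E → ℝ, ∀ z, r' z = 1 - ∑ j, c j * a j * w j z := ⟨_, fun j => rfl⟩
  have hrf : r = fun z => 1 - ∑ j, c j * b j * w j z := funext hr
  have hrf' : r' = fun z => 1 - ∑ j, c j * a j * w j z := funext hr'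
  have hri : Integrable r m := by
    rw [hrf]
    exact (integrable_const _).sub (integrable_finsetSum _ fun j _ => (hwi j).const_mul _)
  have hri' : Integrable r' m' := by
    rw [hrf']
    exact (integrable_const _).sub (integrable_finsetSum _ fun j _ => (hwi' j).const_mul _)
  have hrc : Continuous r := by rw [hrf]; fun_prop
  have hrc' : Continuous r' := by rw [hrf']; fun_prop
  have hr0 : ∀ z, 0 ≤ r z := fun z => by rw [hr]; exact hs0 _ hcb z
  have hr0' : ∀ z, 0 ≤ r' z := fun z => by rw [hr']; exact hs0 _ hca z
  have hr1 : ∀ z, r z ≤ 1 := fun z => by rw [hr]; exact hs1 _ hcb0 z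
  have hr1' : ∀ z, r' z ≤ 1 := fun z => by rw [hr']; exact hs1 _ hca0 z
  have hrρ : ∫ z, r z ∂m = ρ := by
    rw [hrf, integral_sub (integrable_const _)
      (integrable_finsetSum _ fun j _ => (hwi j).const_mul _),
      integral_finsetSum _ fun j _ => (hwi j).const_mul _]
    simp [integral_const_mul, ha, hcab, hρ]
  have hrρ' : ∫ z, r' z ∂m' = ρ := by
    rw [hrf', integral_sub (integrable_const _)
      (integrable_finsetSum _ fun j _ => (hwi' j).const_mul _),
      integral_finsetSum _ fun j _ => (hwi' j).const_mul _]
    have hcab' : ∀ j, c j * a j * b j = min (a j) (b j) := fun j => by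
      rw [mul_right_comm, hcab]
    simp [integral_const_mul, hb, hcab', hρ]
  have hρ0 : 0 ≤ ρ := by rw [← hrρ]; exact integral_nonneg hr0
  have hk1 : ∀ᵐ x ∂m, Integrable (fun y => ∑ j, c j * w j x * w j y + r x * r' y / ρ) m' ∧
      ∫ y, (∑ j, c j * w j x * w j y + r x * r' y / ρ) ∂m' = 1 := by
    have := ae_sum_add_mul_div_eq_one (m := m) (α := fun j => c j * b j) (w := w) (ρ := ρ)
      (by rw [← hrf]; exact hri) (fun z => by rw [← hr]; exact hr0 z)
      (by rw [← hrρ, hrf])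
    filter_upwards [this] with x hx
    have i1 : Integrable (fun y => ∑ j, c j * w j x * w j y) m' :=
      integrable_finsetSum _ fun j _ => (hwi' j).const_mul _
    have i2 : Integrable (fun y => r x * r' y / ρ) m' := (hri'.const_mul _).div_const _
    refine ⟨i1.add i2, ?_⟩
    rw [integral_add i1 i2, integral_finsetSum _ fun j _ => (hwi' j).const_mul _, integral_div,
      integral_const_mul, hrρ', ← hx, hr]
    simp only [integral_const_mul, hb, mul_right_comm]
  have hk2 : ∀ᵐ y ∂m', Integrable (fun x => ∑ j, c j * w j x * w j y + r x * r' y / ρ) m ∧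
      ∫ x, (∑ j, c j * w j x * w j y + r x * r' y / ρ) ∂m = 1 := by
    have := ae_sum_add_mul_div_eq_one (m := m') (α := fun j => c j * a j) (w := w) (ρ := ρ)
      (by rw [← hrf']; exact hri') (fun z => by rw [← hr']; exact hr0' z)
      (by rw [← hrρ', hrf'])
    filter_upwards [this] with y hy
    have i0 : ∀ j, Integrable (fun x => c j * w j x * w j y) m := fun j =>
      ((hwi j).const_mul _).mul_const _
    have i1 : Integrable (fun x => ∑ j, c j * w j x * w j y) m :=
      integrable_finsetSum _ fun j _ => i0 j
    have i2 : Integrable (fun x => r x * r' y / ρ) m := (hri.mul_const _).div_const _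
    refine ⟨i1.add i2, ?_⟩
    rw [integral_add i1 i2, integral_finsetSum _ fun j _ => i0 j, integral_div,
      integral_mul_const, hrρ, ← hy, hr', mul_comm ρ]
    simp only [integral_mul_const, integral_const_mul, ha]
  have hmeas : Measurable fun q : E × E => ∑ j, c j * w j q.1 * w j q.2 + r q.1 * r' q.2 / ρ := by
    refine Continuous.measurable ?_
    fun_prop
  have hbase := W1_le_density hmeas (fun q => add_nonneg
    (Finset.sum_nonneg fun j _ => mul_nonneg (mul_nonneg (hc0 j) (hw0 j _)) (hw0 j _))
    (div_nonneg (mul_nonneg (hr0 _) (hr0' _)) hρ0)) hk1 hk2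
  refine hbase.trans ?_
  have hni : ∀ {n : Measure E} [IsProbabilityMeasure n] {f : E → ℝ},
      Integrable (fun z => ‖z‖ ^ 2) n → Continuous f → (∀ z, 0 ≤ f z) → (∀ z, f z ≤ 1) →
      Integrable (fun z => ‖z‖ * f z) n := by
    intro n _ f hn hf hf0 hf1
    refine ((integrable_const 1).add hn).mono (by fun_prop) (ae_of_all _ fun z => ?_)
    simp only [Pi.add_apply]
    rw [Real.norm_eq_abs, Real.norm_eq_abs, abs_of_nonneg (mul_nonneg (norm_nonneg _) (hf0 z)),
      abs_of_nonneg (by positivity)]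
    have := mul_le_mul_of_nonneg_left (hf1 z) (norm_nonneg z)
    nlinarith [sq_nonneg (‖z‖ - 1)]
  have hA := hni hm hrc hr0 hr1
  have hA' := hni hm' hrc' hr0' hr1'
  have j1 : ∀ j, Integrable (fun q : E × E => c j * w j q.1 * w j q.2) (m.prod m') := fun j =>
    ((hwi j).const_mul (c j)).mul_prod (hwi' j)
  have j2 : Integrable (fun q : E × E => d * ∑ j, c j * w j q.1 * w j q.2) (m.prod m') :=
    (integrable_finsetSum _ fun j _ => j1 j).const_mul d
  have j3 : Integrable (fun q : E × E => ‖q.1‖ * r q.1 * r' q.2 / ρ) (m.prod m') :=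
    (hA.mul_prod hri').div_const ρ
  have j4 : Integrable (fun q : E × E => r q.1 * (‖q.2‖ * r' q.2) / ρ) (m.prod m') :=
    (hri.mul_prod hA').div_const ρ
  have hbound : ∫ q : E × E, (∑ j, c j * w j q.1 * w j q.2 + r q.1 * r' q.2 / ρ) *
      dist q.1 q.2 ∂(m.prod m') ≤ ∫ q : E × E, (d * ∑ j, c j * w j q.1 * w j q.2 +
        ‖q.1‖ * r q.1 * r' q.2 / ρ + r q.1 * (‖q.2‖ * r' q.2) / ρ) ∂(m.prod m') := by
    refine integral_mono_of_nonneg (ae_of_all _ fun q => mul_nonneg (add_nonneg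
      (Finset.sum_nonneg fun j _ => mul_nonneg (mul_nonneg (hc0 j) (hw0 j _)) (hw0 j _))
      (div_nonneg (mul_nonneg (hr0 _) (hr0' _)) hρ0)) dist_nonneg) ((j2.add j3).add j4)
      (ae_of_all _ fun q => ?_)
    have e1 : (∑ j, c j * w j q.1 * w j q.2) * dist q.1 q.2 ≤
        d * ∑ j, c j * w j q.1 * w j q.2 := by
      rw [Finset.sum_mul, Finset.mul_sum]
      refine Finset.sum_le_sum fun j _ => ?_
      rw [mul_comm d]
      by_cases h1 : w j q.1 = 0
      · simp [h1]
      by_cases h2 : w j q.2 = 0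
      · simp [h2]
      exact mul_le_mul_of_nonneg_left (hd j _ _ h1 h2)
        (mul_nonneg (mul_nonneg (hc0 j) (hw0 j _)) (hw0 j _))
    have e2 := mul_le_mul_of_nonneg_left (dist_le_norm_add_norm q.1 q.2)
      (div_nonneg (mul_nonneg (hr0 q.1) (hr0' q.2)) hρ0)
    have e3 : r q.1 * r' q.2 / ρ * (‖q.1‖ + ‖q.2‖) =
      ‖q.1‖ * r q.1 * r' q.2 / ρ + r q.1 * (‖q.2‖ * r' q.2) / ρ := by ring
    simp only []
    rw [add_mul]
    linarith
  refine hbound.trans ?_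
  have hsum : ∫ q : E × E, ∑ j, c j * w j q.1 * w j q.2 ∂(m.prod m') =
      ∑ j, min (a j) (b j) := by
    rw [integral_finsetSum _ fun j _ => j1 j]
    refine Finset.sum_congr rfl fun j _ => ?_
    rw [integral_prod_mul (fun x => c j * w j x) (w j), integral_const_mul, ha, hb,
      mul_right_comm, hcab]
  have j5 : Integrable (fun q : E × E => d * ∑ j, c j * w j q.1 * w j q.2 +
      ‖q.1‖ * r q.1 * r' q.2 / ρ) (m.prod m') := j2.add j3
  rw [integral_add j5 j4, integral_add j2 j3, integral_const_mul, hsum, integral_div,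
    integral_div, integral_prod_mul (fun x => ‖x‖ * r x) r',
    integral_prod_mul r (fun x => ‖x‖ * r' x), hrρ, hrρ']
  have k1 := integral_norm_mul_le hm hr0 hr1 hri hR
  have k2 := integral_norm_mul_le hm' hr0' hr1' hri' hR
  rw [hrρ] at k1
  rw [hrρ'] at k2
  have n1 : 0 ≤ ∫ z, ‖z‖ * r z ∂m := integral_nonneg fun z => mul_nonneg (norm_nonneg _) (hr0 z)
  have n2 : 0 ≤ ∫ z, ‖z‖ * r' z ∂m' :=
    integral_nonneg fun z => mul_nonneg (norm_nonneg _) (hr0' z)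
  have k3 : (∫ z, ‖z‖ * r z ∂m) * ρ / ρ ≤ ∫ z, ‖z‖ * r z ∂m := by
    rw [mul_div_assoc]
    exact mul_le_of_le_one_right n1 (div_self_le_one ρ)
  have k4 : ρ * (∫ z, ‖z‖ * r' z ∂m') / ρ ≤ ∫ z, ‖z‖ * r' z ∂m' := by
    rw [mul_comm, mul_div_assoc]
    exact mul_le_of_le_one_right n2 (div_self_le_one ρ)
  have k5 : d * ∑ j, min (a j) (b j) ≤ d := mul_le_of_le_one_right hd0 (by linarith)
  have k6 : 1 - ∑ j, a j ≤ (∫ z, ‖z‖ ^ 2 ∂m) / R ^ 2 := by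
    have : 1 - ∑ j, a j = ∫ z, (1 - ∑ j, w j z) ∂m := by
      rw [integral_sub (integrable_const _) (integrable_finsetSum _ fun j _ => hwi j),
        integral_finsetSum _ fun j _ => hwi j]
      simp [ha]
    rw [this, ← integral_div]
    refine integral_mono_of_nonneg (ae_of_all _ fun z => sub_nonneg.2 (hw1 z))
      (hm.div_const _) (ae_of_all _ fun z => ?_)
    simp only []
    rcases le_total ‖z‖ R with h | h
    · rw [hwR z h, sub_self]
      positivity
    · have h1 : 1 ≤ ‖z‖ ^ 2 / R ^ 2 := by
        rw [le_div_iff₀ (by positivity), one_mul]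
        exact pow_le_pow_left₀ hR.le h 2
      have h2 := Finset.sum_nonneg fun j (_ : j ∈ Finset.univ) => hw0 j z
      linarith
  have k7 : ∑ j, a j - ∑ j, min (a j) (b j) ≤ ∑ j, |a j - b j| := by
    rw [← Finset.sum_sub_distrib]
    refine Finset.sum_le_sum fun j _ => ?_
    rcases le_total (a j) (b j) with h | h
    · rw [min_eq_left h, sub_self]; exact abs_nonneg _
    · rw [min_eq_right h]; exact le_abs_self _
  have k8 := mul_le_mul_of_nonneg_left k6 hR.le
  have k9 : R * ((∫ z, ‖z‖ ^ 2 ∂m) / R ^ 2) = (∫ z, ‖z‖ ^ 2 ∂m) / R := by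
    field_simp
  have k10 := mul_le_mul_of_nonneg_left k7 hR.le
  have k11 := add_le_add (add_le_add k5 (k3.trans k1)) (k4.trans k2)
  refine k11.trans ?_
  simp only [ha, hb]
  rw [add_div, mul_div_assoc]
  rw [mul_sub] at k8 k10
  rw [hρ, mul_sub]
  linarith

lemma exists_fine_partition {E : Type*} [PseudoMetricSpace E] [T2Space E] [LocallyCompactSpace E]
    {s : Set E} (hs : IsCompact s) {ε : ℝ} (hε : 0 < ε) :
    ∃ (n : ℕ) (w : Fin n → E → ℝ), (∀ j, Continuous (w j)) ∧ (∀ j, HasCompactSupport (w j)) ∧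
      (∀ j z, 0 ≤ w j z) ∧ (∀ z, ∑ j, w j z ≤ 1) ∧ (∀ z ∈ s, ∑ j, w j z = 1) ∧
      ∀ j z z', w j z ≠ 0 → w j z' ≠ 0 → dist z z' ≤ ε := by
  obtain ⟨t, -, ht, hst⟩ := hs.finite_cover_balls (half_pos hε)
  obtain ⟨n, c, hc⟩ : ∃ (n : ℕ) (c : Fin n → E), t = range c := by
    obtain ⟨n, c, hc⟩ := ht.fin_embedding
    exact ⟨n, c, hc.symm⟩
  obtain ⟨f, hf, hfc⟩ := PartitionOfUnity.exists_isSubordinate_of_locallyFinite_t2space hs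
    (fun j => Metric.ball (c j) (ε / 2)) (fun j => Metric.isOpen_ball)
    (locallyFinite_of_finite _) (by rw [hc, biUnion_range] at hst; exact hst)
  refine ⟨n, fun j => f j, fun j => (f j).continuous, hfc, fun j z => f.nonneg j z, fun z => ?_,
    fun z hz => ?_, fun j z z' hz hz' => ?_⟩
  · rw [← finsum_eq_sum_of_fintype]
    exact f.sum_le_one z
  · rw [← finsum_eq_sum_of_fintype]
    exact f.sum_eq_one hz
  · have h1 := hf j (subset_tsupport _ hz)
    have h2 := hf j (subset_tsupport _ hz')
    rw [Metric.mem_ball] at h1 h2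
    linarith [dist_triangle_right z z' (c j)]

section TimeRegularity

variable {ν : Measure ℝ} {F : Measure (ℝ × ℝ) → ℝ × ℝ → ℝ} {A B I M κ γ : ℝ}
  {μ : ℝ → Measure (ℝ × ℝ)}

lemma norm_sq_le (z : ℝ × ℝ) : ‖z‖ ^ 2 ≤ z.1 ^ 2 + z.2 ^ 2 := by
  rw [Prod.norm_def, Real.norm_eq_abs, Real.norm_eq_abs]
  rcases max_choice |z.1| |z.2| with h | h <;> rw [h, sq_abs] <;>
    nlinarith [sq_nonneg z.1, sq_nonneg z.2]

lemma P2nu.integrable_norm_sq {m : Measure (ℝ × ℝ)} (hm : m ∈ P2nu ν) :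
    Integrable (fun z : ℝ × ℝ => ‖z‖ ^ 2) m := by
  refine hm.2.1.mono (by fun_prop) (ae_of_all _ fun z => ?_)
  rw [Real.norm_eq_abs, Real.norm_eq_abs, abs_of_nonneg (by positivity),
    abs_of_nonneg (by positivity)]
  exact norm_sq_le z

lemma IsSol.exists_norm_sq_le (hΩ : Bornology.IsBounded (msupp ν))
    (hF : Framework ν F A B I M κ γ) (hI : 0 ≤ I) (hκ : 0 ≤ κ)
    (hsol : IsSol F μ) (hP : ∀ t : ℝ, 0 ≤ t → μ t ∈ P2nu ν) {T : ℝ} (hT : 0 ≤ T) :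
    ∃ m : ℝ, ∀ s ∈ Icc 0 T, ∫ z, ‖z‖ ^ 2 ∂(μ s) ≤ m := by
  obtain ⟨m, hm⟩ := hsol.exists_second_moment_le hΩ hF hI hκ hP hT
  obtain ⟨W, hW, hWΩ⟩ := exists_pos_bound hΩ
  refine ⟨m + W ^ 2, fun s hs => ?_⟩
  have hPs := hP s hs.1
  have := hPs.1
  have hi := P2nu.integrable_sq hPs
  calc ∫ z, ‖z‖ ^ 2 ∂(μ s) ≤ ∫ z, (z.1 ^ 2 + W ^ 2) ∂(μ s) := by
        refine integral_mono_ae (P2nu.integrable_norm_sq hPs) (hi.add (integrable_const _)) ?_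
        filter_upwards [ae_snd_mem_msupp hPs.2.2] with z hz
        refine (norm_sq_le z).trans (add_le_add le_rfl ?_)
        rw [← sq_abs]
        exact pow_le_pow_left₀ (abs_nonneg _) (hWΩ _ hz) 2
    _ = ∫ z, z.1 ^ 2 ∂(μ s) + W ^ 2 := by
        rw [integral_add hi (integrable_const _)]; simp
    _ ≤ m + W ^ 2 := add_le_add (hm s hs) le_rfl

/-- Solutions are uniformly continuous in time for the Wasserstein distance. -/
lemma IsSol.exists_W1_lt (hΩ : Bornology.IsBounded (msupp ν))
    (hF : Framework ν F A B I M κ γ) (hI : 0 ≤ I) (hκ : 0 ≤ κ)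
    (hsol : IsSol F μ) (hP : ∀ t : ℝ, 0 ≤ t → μ t ∈ P2nu ν) {T : ℝ} (hT : 0 ≤ T)
    {ε : ℝ} (hε : 0 < ε) :
    ∃ δ > 0, ∀ s ∈ Icc 0 T, ∀ r ∈ Icc 0 T, |s - r| < δ → W1 (μ s) (μ r) < ε := by
  obtain ⟨m, hm⟩ := hsol.exists_norm_sq_le hΩ hF hI hκ hP hT
  obtain ⟨R, hR, hRε⟩ : ∃ R : ℝ, 0 < R ∧ 4 * m / R < ε / 3 := by
    have : Tendsto (fun R : ℝ => 4 * m / R) atTop (𝓝 0) := tendsto_const_nhds.div_atTop tendsto_id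
    exact ((eventually_gt_atTop 0).and (this.eventually_lt_const (by positivity))).exists
  obtain ⟨n, w, hw, hwc, hw0, hw1, hwR, hd⟩ :=
    exists_fine_partition (isCompact_closedBall (0 : ℝ × ℝ) R) (show 0 < ε / 3 by positivity)
  have hu : ∀ j, UniformContinuousOn (fun s => ∫ z, w j z ∂(μ s)) (Icc 0 T) := fun j =>
    isCompact_Icc.uniformContinuousOn_of_continuous (hsol.continuousOn (hw j) (hwc j) T)
  simp only [Metric.uniformContinuousOn_iff, Real.dist_eq] at hu
  have hη : 0 < ε / 3 / (2 * R * (n + 1)) := by positivity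
  choose δ hδ hδu using fun j => hu j _ hη
  obtain ⟨δ₀, hδ₀, hδ₀j⟩ : ∃ δ₀ > 0, ∀ j, δ₀ ≤ δ j := by
    rcases isEmpty_or_nonempty (Fin n) with h | h
    · exact ⟨1, one_pos, fun j => h.elim j⟩
    · obtain ⟨j, hj⟩ := Finite.exists_min δ
      exact ⟨δ j, hδ j, hj⟩
  refine ⟨δ₀, hδ₀, fun s hs r hr hsr => ?_⟩
  have := (hP s hs.1).1
  have := (hP r hr.1).1
  have key := W1_le_of_partition (P2nu.integrable_norm_sq (hP s hs.1))
    (P2nu.integrable_norm_sq (hP r hr.1)) hw hw0 hw1 hR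
    (fun z hz => hwR z (mem_closedBall_zero_iff.2 hz)) hd (by positivity)
  have hsum : ∑ j, |∫ z, w j z ∂(μ s) - ∫ z, w j z ∂(μ r)| ≤
      n * (ε / 3 / (2 * R * (n + 1))) := by
    refine (Finset.sum_le_sum fun j _ =>
      (hδu j s hs r hr (hsr.trans_le (hδ₀j j))).le).trans_eq ?_
    simp
  have h1 : 2 * R * (n * (ε / 3 / (2 * R * (n + 1)))) ≤ ε / 3 := by
    have : 2 * R * (n * (ε / 3 / (2 * R * (n + 1)))) = ε / 3 * (n / (n + 1)) := by
      field_simp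
    rw [this]
    refine mul_le_of_le_one_right (by positivity) ?_
    rw [div_le_one (by positivity)]
    linarith
  have h2 : (3 * ∫ z, ‖z‖ ^ 2 ∂(μ s) + ∫ z, ‖z‖ ^ 2 ∂(μ r)) / R ≤ 4 * m / R := by
    gcongr
    linarith [hm s hs, hm r hr]
  have h3 := mul_le_mul_of_nonneg_left hsum (show 0 ≤ 2 * R by positivity)
  linarith

lemma IsSol.exists_W1_le (hΩ : Bornology.IsBounded (msupp ν))
    (hF : Framework ν F A B I M κ γ) (hI : 0 ≤ I) (hκ : 0 ≤ κ)
    (hsol : IsSol F μ) (hP : ∀ t : ℝ, 0 ≤ t → μ t ∈ P2nu ν) {T : ℝ} (hT : 0 ≤ T) :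
    ∃ C : ℝ, ∀ s ∈ Icc 0 T, W1 (μ s) (μ 0) ≤ C := by
  obtain ⟨m, hm⟩ := hsol.exists_norm_sq_le hΩ hF hI hκ hP hT
  refine ⟨2 * m + 2, fun s hs => ?_⟩
  have := (hP s hs.1).1
  have := (hP 0 le_rfl).1
  have i1 := (P2nu.integrable_norm_sq (hP s hs.1)).comp_fst (μ 0)
  have i2 := (P2nu.integrable_norm_sq (hP 0 le_rfl)).comp_snd (μ s)
  have hcp : IsCoupling ((μ s).prod (μ 0)) (μ s) (μ 0) :=
    ⟨Measure.fst_prod, Measure.snd_prod⟩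
  refine (W1_le_coupling hcp).trans ?_
  have hi : Integrable (fun q : (ℝ × ℝ) × ℝ × ℝ => ‖q.1‖ ^ 2 + ‖q.2‖ ^ 2 + 2)
    ((μ s).prod (μ 0)) := (i1.add i2).add (integrable_const _)
  have := integral_mono_of_nonneg (ae_of_all _ fun q => dist_nonneg) hi
    (ae_of_all _ fun q => show dist q.1 q.2 ≤ ‖q.1‖ ^ 2 + ‖q.2‖ ^ 2 + 2 by
      refine (dist_le_norm_add_norm _ _).trans ?_
      nlinarith [sq_nonneg (‖q.1‖ - 1), sq_nonneg (‖q.2‖ - 1)])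
  refine this.trans ?_
  have i3 : Integrable (fun q : (ℝ × ℝ) × ℝ × ℝ => ‖q.1‖ ^ 2 + ‖q.2‖ ^ 2)
    ((μ s).prod (μ 0)) := i1.add i2
  rw [integral_add i3 (integrable_const _), integral_add i1 i2,
    integral_fun_fst (fun z : ℝ × ℝ => ‖z‖ ^ 2), integral_fun_snd (fun z : ℝ × ℝ => ‖z‖ ^ 2)]
  simp
  linarith [hm s hs, hm 0 ⟨le_rfl, hT⟩]

end TimeRegularity

/-- A curve of probability measures on `[0, T]` transported by a regular velocity field `b`, which
is controlled over the set `S` of values of the second variable. -/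
structure RegularTransport (S : Set ℝ) (T a V m : ℝ) (b : ℝ → ℝ × ℝ → ℝ)
    (μ : ℝ → Measure (ℝ × ℝ)) : Prop where
  contDiff : ∀ s ∈ Icc 0 T, ContDiff ℝ 2 (b s)
  dx_le : ∀ s ∈ Icc 0 T, ∀ z, |dx (b s) z| ≤ a
  dx_dx_le : ∀ s ∈ Icc 0 T, ∀ z, |dx (dx (b s)) z| ≤ a
  growth : ∀ s ∈ Icc 0 T, ∀ ω ∈ S, ∀ x, |b s (x, ω)| ≤ V * (1 + |x|)
  modulus : ∀ ε > 0, ∃ δ > 0, ∀ s ∈ Icc 0 T, ∀ r ∈ Icc 0 T, |s - r| < δ →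
    ∀ ω ∈ S, ∀ x, |b s (x, ω) - b r (x, ω)| ≤ ε
  prob : ∀ s ∈ Icc 0 T, IsProbabilityMeasure (μ s)
  ae_mem : ∀ s ∈ Icc 0 T, ∀ᵐ z ∂(μ s), z.2 ∈ S
  integrable_sq : ∀ s ∈ Icc 0 T, Integrable (fun z => z.1 ^ 2) (μ s)
  integral_sq_le : ∀ s ∈ Icc 0 T, ∫ z, z.1 ^ 2 ∂(μ s) ≤ m
  intervalIntegrable : ∀ ψ : ℝ × ℝ → ℝ, ContDiff ℝ 1 ψ → HasCompactSupport ψ →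
    ∀ s ∈ Icc 0 T, ∀ t ∈ Icc 0 T,
      IntervalIntegrable (fun r => ∫ z, b r z * dx ψ z ∂(μ r)) volume s t
  weak : ∀ ψ : ℝ × ℝ → ℝ, ContDiff ℝ 1 ψ → HasCompactSupport ψ →
    ∀ s ∈ Icc 0 T, ∀ t ∈ Icc 0 T, s ≤ t →
      (∫ z, ψ z ∂(μ t)) - ∫ z, ψ z ∂(μ s) = ∫ r in s..t, ∫ z, b r z * dx ψ z ∂(μ r)

lemma IsSol.exists_regularTransport {ν : Measure ℝ} {F : Measure (ℝ × ℝ) → ℝ × ℝ → ℝ}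
    {A B I M κ γ : ℝ} {μ : ℝ → Measure (ℝ × ℝ)} (hΩ : Bornology.IsBounded (msupp ν))
    (hF : Framework ν F A B I M κ γ) (hI : 0 ≤ I) (hκ : 0 ≤ κ) (hM : 0 ≤ M)
    (hsol : IsSol F μ) (hP : ∀ t : ℝ, 0 ≤ t → μ t ∈ P2nu ν) {T : ℝ} (hT : 0 ≤ T) :
    ∃ V m : ℝ, 0 ≤ V ∧ 0 ≤ m ∧
      RegularTransport (msupp ν) T (κ * I) V m (fun s => F (μ s)) μ := by
  obtain ⟨m, hm⟩ := hsol.exists_second_moment_le hΩ hF hI hκ hP hT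
  obtain ⟨W, hW, hWΩ⟩ := exists_pos_bound hΩ
  obtain ⟨C, hC⟩ := hsol.exists_W1_le hΩ hF hI hκ hP hT
  have hc : ∀ t, 0 ≤ t → Continuous (F (μ t)) := fun t ht => P2nu.continuous hF (hP t ht)
  have hp : ∀ t, 0 ≤ t → IsProbabilityMeasure (μ t) := fun t ht => (hP t ht).1
  have hκI := mul_nonneg hκ hI
  have hκM := mul_nonneg hκ hM
  have hC0 : 0 ≤ C := (W1_nonneg _ _).trans (hC 0 ⟨le_rfl, hT⟩)
  have hii : ∀ ψ : ℝ × ℝ → ℝ, ContDiff ℝ 1 ψ → HasCompactSupport ψ → ∀ s ∈ Icc 0 T,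
      IntervalIntegrable (flux F μ ψ) volume 0 s := fun ψ hψ hψc s hs =>
    hsol.intervalIntegrable_flux hc hp hψ hψc hs.1
  refine ⟨|F (μ 0) 0| + κ * I + I * W + κ * M * C, m, by positivity,
    (integral_nonneg fun z => sq_nonneg _).trans (hm 0 ⟨le_rfl, hT⟩), ?_⟩
  exact
    { contDiff := fun s hs => (hF.hA2 _ (hP s hs.1)).1
      dx_le := fun s hs => (hF.hA2 _ (hP s hs.1)).2.1
      dx_dx_le := fun s hs => (hF.hA2 _ (hP s hs.1)).2.2.1
      growth := fun s hs ω hω x => by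
        have h1 := (hF.hA1 _ (hP s hs.1) _ (hP 0 le_rfl) x ω hω).1
        have h2 := Framework.abs_sub_le hF (hP 0 le_rfl) (x, ω) 0
        have h3 := mul_le_mul_of_nonneg_left (hC s hs) hκM
        have h4 := mul_le_mul_of_nonneg_left (hWΩ ω hω) hI
        simp only [Prod.fst_zero, Prod.snd_zero, sub_zero] at h2
        have e : F (μ s) (x, ω) = (F (μ s) (x, ω) - F (μ 0) (x, ω)) +
          (F (μ 0) (x, ω) - F (μ 0) 0) + F (μ 0) 0 := by ring
        have h5 := abs_add_three (F (μ s) (x, ω) - F (μ 0) (x, ω))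
          (F (μ 0) (x, ω) - F (μ 0) 0) (F (μ 0) 0)
        rw [← e] at h5
        have h6 : 0 ≤ (|F (μ 0) 0| + I * W + κ * M * C) * |x| := by positivity
        linarith
      modulus := fun ε hε => by
        obtain ⟨δ, hδ, h⟩ := hsol.exists_W1_lt hΩ hF hI hκ hP hT
          (show 0 < ε / (κ * M + 1) by positivity)
        refine ⟨δ, hδ, fun s hs r hr hsr ω hω x => ?_⟩
        refine (hF.hA1 _ (hP s hs.1) _ (hP r hr.1) x ω hω).1.trans ?_
        refine (mul_le_mul_of_nonneg_left (h s hs r hr hsr).le hκM).trans ?_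
        rw [mul_div_assoc', div_le_iff₀ (by positivity)]
        linarith
      prob := fun s hs => hp s hs.1
      ae_mem := fun s hs => ae_snd_mem_msupp (hP s hs.1).2.2
      integrable_sq := fun s hs => P2nu.integrable_sq (hP s hs.1)
      integral_sq_le := hm
      intervalIntegrable := fun ψ hψ hψc s hs t ht =>
        (hii ψ hψ hψc s hs).symm.trans (hii ψ hψ hψc t ht)
      weak := fun ψ hψ hψc s hs t ht hst => hsol.integral_sub_eq hc hp hψ hψc hs.1 hst }

section EulerStep

/-- One step of the explicit Euler scheme for the field `v`. -/
def eulerStep (v : ℝ × ℝ → ℝ) (h : ℝ) (z : ℝ × ℝ) : ℝ × ℝ := (z.1 + h * v z, z.2)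

lemma abs_taylor_le {f f' f'' : ℝ → ℝ} (hf : ∀ x, HasDerivAt f (f' x) x)
    (hf' : ∀ x, HasDerivAt f' (f'' x) x) {C : ℝ} (hC : ∀ x, |f'' x| ≤ C) (x y : ℝ) :
    |f (x + y) - f x - y * f' x| ≤ C * y ^ 2 := by
  have hC0 : 0 ≤ C := (abs_nonneg _).trans (hC 0)
  have h1 : ∀ u ∈ uIcc x (x + y), ‖f' u - f' x‖ ≤ C * |y| := by
    intro u hu
    have := Convex.norm_image_sub_le_of_norm_hasDerivWithin_le (f := f') (s := univ)
      (fun u _ => (hf' u).hasDerivWithinAt) (fun u _ => hC u) convex_univ (mem_univ x) (mem_univ u)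
    refine this.trans (mul_le_mul_of_nonneg_left ?_ hC0)
    have := abs_sub_left_of_mem_uIcc hu
    simpa using this
  have h2 := Convex.norm_image_sub_le_of_norm_hasDerivWithin_le
    (f := fun u => f u - u * f' x) (f' := fun u => f' u - f' x) (s := uIcc x (x + y))
    (fun u _ => by
      have := ((hf u).sub ((hasDerivAt_id u).mul_const (f' x))).hasDerivWithinAt
        (s := uIcc x (x + y))
      simpa using! this)
    h1 (convex_uIcc _ _) left_mem_uIcc right_mem_uIcc
  rw [Real.norm_eq_abs, Real.norm_eq_abs, add_sub_cancel_left, mul_assoc, abs_mul_abs_self] at h2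
  calc _ = |f (x + y) - (x + y) * f' x - (f x - x * f' x)| := by congr 1; ring
    _ ≤ _ := by rw [sq]; exact h2

variable {S : Set ℝ} {T a V m : ℝ} {b : ℝ → ℝ × ℝ → ℝ} {μ : ℝ → Measure (ℝ × ℝ)}

lemma RegularTransport.integral_growth_le (hb : RegularTransport S T a V m b μ) {s : ℝ}
    (hs : s ∈ Icc 0 T) : Integrable (fun z => (1 + |z.1|) ^ 2) (μ s) ∧
      ∫ z, (1 + |z.1|) ^ 2 ∂(μ s) ≤ 2 + 2 * m := by
  have := hb.prob s hs
  have hi : Integrable (fun z : ℝ × ℝ => 2 + 2 * z.1 ^ 2) (μ s) :=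
    (integrable_const _).add ((hb.integrable_sq s hs).const_mul 2)
  have hle : ∀ z : ℝ × ℝ, (1 + |z.1|) ^ 2 ≤ 2 + 2 * z.1 ^ 2 := fun z => by
    rw [← sq_abs z.1]; nlinarith [sq_nonneg (1 - |z.1|)]
  refine ⟨hi.mono' (by fun_prop) (ae_of_all _ fun z => ?_), ?_⟩
  · rw [norm_pow, Real.norm_of_nonneg (show 0 ≤ 1 + |z.1| by positivity)]
    exact hle z
  · refine (integral_mono_of_nonneg (ae_of_all _ fun z => sq_nonneg _) hi
      (ae_of_all _ hle)).trans ?_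
    rw [integral_add (integrable_const _) ((hb.integrable_sq s hs).const_mul 2),
      integral_const_mul]
    simp
    exact hb.integral_sq_le s hs

/-- Weak error of the Euler scheme over one time step. -/
lemma RegularTransport.abs_integral_sub_eulerStep_le (hb : RegularTransport S T a V m b μ)
    (ha : 0 ≤ a) (hV : 0 ≤ V) (hm : 0 ≤ m) {ψ : ℝ × ℝ → ℝ}
    (hψ : ContDiff ℝ 2 ψ) (hψc : HasCompactSupport ψ) {C₁ C₂ : ℝ} (h1 : ∀ z, |dx ψ z| ≤ C₁)
    (h2 : ∀ z, |dx (dx ψ) z| ≤ C₂) {s h ε : ℝ} (hs : s ∈ Icc 0 T) (hh : 0 ≤ h)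
    (hsh : s + h ∈ Icc 0 T) (hε : ∀ r ∈ Icc s (s + h), ∀ ω ∈ S, ∀ x,
      |b r (x, ω) - b s (x, ω)| ≤ ε)
    (hEc : HasCompactSupport fun z => ψ (eulerStep (b s) h z)) :
    |(∫ z, ψ z ∂(μ (s + h))) - ∫ z, ψ (eulerStep (b s) h z) ∂(μ s)| ≤
      h * (ε + h * ((a * V + 2 * V ^ 2) * (2 + 2 * m))) * (C₁ + C₂) := by
  have hC1 : 0 ≤ C₁ := (abs_nonneg _).trans (h1 0)
  have hC2 : 0 ≤ C₂ := (abs_nonneg _).trans (h2 0)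
  have hbs := hb.contDiff s hs
  have hbd := hbs.differentiable (by simp)
  have hd1 : ContDiff ℝ 1 (dx ψ) := ContDiff.dx hψ (by norm_num)
  have hd1c : HasCompactSupport (dx ψ) := HasCompactSupport.dx (hψ.differentiable (by simp)) hψc
  have hψ1 : ContDiff ℝ 1 ψ := hψ.of_le (by norm_num)
  obtain ⟨g, hg⟩ : ∃ g : ℝ × ℝ → ℝ, g = fun z => b s z * dx ψ z := ⟨_, rfl⟩
  have hgd : ContDiff ℝ 1 g := by rw [hg]; exact (hbs.of_le (by norm_num)).mul hd1
  have hgc : HasCompactSupport g := by rw [hg]; exact hd1c.mul_left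
  have hdg : ∀ z, dx g z = dx (b s) z * dx ψ z + b s z * dx (dx ψ) z := fun z => by
    rw [hg]; exact dx_mul hbd (hd1.differentiable (by simp)) z
  obtain ⟨Q, hQ⟩ : ∃ Q, Q = (a * V * C₁ + V ^ 2 * C₂) * (2 + 2 * m) := ⟨_, rfl⟩
  have hQ0 : 0 ≤ Q := by rw [hQ]; positivity
  have hsub : ∀ r ∈ Icc s (s + h), r ∈ Icc 0 T := fun r hr => ⟨hs.1.trans hr.1, hr.2.trans hsh.2⟩
  have hgr : ∀ r ∈ Icc s (s + h), |∫ z, b r z * dx g z ∂(μ r)| ≤ Q := by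
    intro r hr
    obtain ⟨hi, hle⟩ := hb.integral_growth_le (hsub r hr)
    have hbound : ∀ᵐ z ∂(μ r), ‖b r z * dx g z‖ ≤ (a * V * C₁ + V ^ 2 * C₂) * (1 + |z.1|) ^ 2 := by
      filter_upwards [hb.ae_mem r (hsub r hr)] with z hz
      have e1 := hb.growth r (hsub r hr) z.2 hz z.1
      have e2 := hb.growth s hs z.2 hz z.1
      have e3 : |dx g z| ≤ a * C₁ + V * (1 + |z.1|) * C₂ := by
        rw [hdg]
        refine (abs_add_le _ _).trans (add_le_add ?_ ?_)
        · rw [abs_mul]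
          exact mul_le_mul (hb.dx_le s hs z) (h1 z) (abs_nonneg _) ha
        · rw [abs_mul]
          exact mul_le_mul e2 (h2 z) (abs_nonneg _) (by positivity)
      rw [Real.norm_eq_abs, abs_mul]
      refine (mul_le_mul e1 e3 (abs_nonneg _) (by positivity)).trans ?_
      have e4 : 1 + |z.1| ≤ (1 + |z.1|) ^ 2 := by nlinarith [abs_nonneg z.1]
      have e5 := mul_le_mul_of_nonneg_left e4 (show 0 ≤ a * V * C₁ by positivity)
      linarith
    have := norm_integral_le_of_norm_le (hi.const_mul _) hbound
    rw [integral_const_mul] at this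
    refine this.trans ?_
    rw [hQ]
    exact mul_le_mul_of_nonneg_left hle (by positivity)
  have hgdiff : ∀ r ∈ Icc s (s + h), |(∫ z, g z ∂(μ r)) - ∫ z, g z ∂(μ s)| ≤ Q * h := by
    intro r hr
    rw [hb.weak g hgd hgc s hs r (hsub r hr) hr.1]
    have := intervalIntegral.norm_integral_le_of_norm_le_const (a := s) (b := r)
      (f := fun u => ∫ z, b u z * dx g z ∂(μ u)) (C := Q) (fun u hu => by
        rw [uIoc_of_le hr.1] at hu
        exact hgr u ⟨hu.1.le, hu.2.trans hr.2⟩)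
    refine this.trans (mul_le_mul_of_nonneg_left ?_ hQ0)
    rw [abs_of_nonneg (by linarith [hr.1])]
    linarith [hr.2]
  have hflux : ∀ r ∈ Icc s (s + h),
      |(∫ z, b r z * dx ψ z ∂(μ r)) - ∫ z, g z ∂(μ s)| ≤ ε * C₁ + Q * h := by
    intro r hr
    have := hb.prob r (hsub r hr)
    have i1 : Integrable (fun z => b r z * dx ψ z) (μ r) :=
      ((hb.contDiff r (hsub r hr)).continuous.mul hd1.continuous).integrable_of_hasCompactSupport
        hd1c.mul_left
    have i2 : Integrable g (μ r) := hgd.continuous.integrable_of_hasCompactSupport hgc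
    have e1 : |(∫ z, b r z * dx ψ z ∂(μ r)) - ∫ z, g z ∂(μ r)| ≤ ε * C₁ := by
      rw [← integral_sub i1 i2]
      have := norm_integral_le_of_norm_le (μ := μ r) (f := fun z => b r z * dx ψ z - g z)
        (integrable_const (ε * C₁)) (by
          filter_upwards [hb.ae_mem r (hsub r hr)] with z hz
          have e := hε r hr z.2 hz z.1
          rw [hg, ← sub_mul, norm_mul]
          exact mul_le_mul e (h1 z) (abs_nonneg _) ((abs_nonneg _).trans e))
      simpa using this
    calc _ = |((∫ z, b r z * dx ψ z ∂(μ r)) - ∫ z, g z ∂(μ r)) +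
          ((∫ z, g z ∂(μ r)) - ∫ z, g z ∂(μ s))| := by congr 1; ring
      _ ≤ _ := (abs_add_le _ _).trans (add_le_add e1 (hgdiff r hr))
  have hweak : |(∫ z, ψ z ∂(μ (s + h))) - (∫ z, ψ z ∂(μ s)) - h * ∫ z, g z ∂(μ s)| ≤
      (ε * C₁ + Q * h) * h := by
    rw [hb.weak ψ hψ1 hψc s hs _ hsh (by linarith)]
    have hi := hb.intervalIntegrable ψ hψ1 hψc s hs _ hsh
    have e : h * ∫ z, g z ∂(μ s) = ∫ _ in s..(s + h), ∫ z, g z ∂(μ s) := by simp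
    rw [e, ← intervalIntegral.integral_sub hi intervalIntegrable_const]
    have := intervalIntegral.norm_integral_le_of_norm_le_const (a := s) (b := s + h)
      (f := fun r => (∫ z, b r z * dx ψ z ∂(μ r)) - ∫ z, g z ∂(μ s)) (C := ε * C₁ + Q * h)
      (fun u hu => by
        rw [uIoc_of_le (by linarith)] at hu
        exact hflux u ⟨hu.1.le, hu.2⟩)
    rwa [add_sub_cancel_left, abs_of_nonneg hh] at this
  have := hb.prob s hs
  obtain ⟨hi, hle⟩ := hb.integral_growth_le hs
  have iψ : Integrable ψ (μ s) := hψ.continuous.integrable_of_hasCompactSupport hψc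
  have ig : Integrable g (μ s) := hgd.continuous.integrable_of_hasCompactSupport hgc
  have iE : Integrable (fun z => ψ (eulerStep (b s) h z)) (μ s) := by
    refine Continuous.integrable_of_hasCompactSupport ?_ hEc
    have := hψ.continuous
    have := hbs.continuous
    unfold eulerStep
    fun_prop
  have htaylor : |(∫ z, ψ (eulerStep (b s) h z) ∂(μ s)) - (∫ z, ψ z ∂(μ s)) -
      h * ∫ z, g z ∂(μ s)| ≤ C₂ * h ^ 2 * V ^ 2 * (2 + 2 * m) := by
    have iEψ : Integrable (fun z => ψ (eulerStep (b s) h z) - ψ z) (μ s) := iE.sub iψ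
    rw [← integral_sub iE iψ, ← integral_const_mul, ← integral_sub iEψ (ig.const_mul h)]
    have := norm_integral_le_of_norm_le (μ := μ s)
      (f := fun z => ψ (eulerStep (b s) h z) - ψ z - h * g z)
      (hi.const_mul (C₂ * h ^ 2 * V ^ 2)) (by
        filter_upwards [hb.ae_mem s hs] with z hz
        have e1 := hb.growth s hs z.2 hz z.1
        have e2 := abs_taylor_le (fun x => hasDerivAt_dx (hψ.differentiable (by simp)) x z.2)
          (fun x => hasDerivAt_dx (hd1.differentiable (by simp)) x z.2)
          (fun x => h2 (x, z.2)) z.1 (h * b s z)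
        have e3 : b s z ^ 2 ≤ V ^ 2 * (1 + |z.1|) ^ 2 := by
          rw [← mul_pow, ← sq_abs]
          exact pow_le_pow_left₀ (abs_nonneg _) e1 2
        rw [hg, Real.norm_eq_abs, ← mul_assoc]
        refine e2.trans ?_
        have := mul_le_mul_of_nonneg_left e3 (show 0 ≤ C₂ * h ^ 2 by positivity)
        rw [mul_pow]
        linarith)
    rw [integral_const_mul] at this
    exact this.trans (mul_le_mul_of_nonneg_left hle (by positivity))
  have hε0 : 0 ≤ ε ∨ IsEmpty S := by
    rcases S.eq_empty_or_nonempty with h | ⟨ω, hω⟩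
    · right; simp [h]
    · left; exact (abs_nonneg _).trans (hε s ⟨le_rfl, by linarith⟩ ω hω 0)
  have hε0 : 0 ≤ ε := by
    rcases hε0 with h | h
    · exact h
    · obtain ⟨z, hz⟩ := (hb.ae_mem s hs).exists
      exact (h.false ⟨z.2, hz⟩).elim
  have hfin := abs_sub_le (∫ z, ψ z ∂(μ (s + h))) ((∫ z, ψ z ∂(μ s)) + h * ∫ z, g z ∂(μ s))
    (∫ z, ψ (eulerStep (b s) h z) ∂(μ s))
  rw [abs_sub_comm ((∫ z, ψ z ∂(μ s)) + h * ∫ z, g z ∂(μ s)), ← sub_sub, ← sub_sub] at hfin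
  refine hfin.trans ((add_le_add hweak htaylor).trans ?_)
  rw [hQ]
  have p1 : 0 ≤ h * ε * C₂ := by positivity
  have p2 : 0 ≤ h ^ 2 * (2 * V ^ 2 * C₁ + a * V * C₂) * (2 + 2 * m) := by positivity
  linarith

end EulerStep

section EulerScheme

variable {v ψ : ℝ × ℝ → ℝ} {a h : ℝ}

lemma contDiff_eulerStep {n : WithTop ℕ∞} (hv : ContDiff ℝ n v) : ContDiff ℝ n (eulerStep v h) :=
  (contDiff_fst.add (contDiff_const.mul hv)).prodMk contDiff_snd

lemma abs_sub_le_of_abs_dx_le (hv : Differentiable ℝ v) (ha : ∀ z, |dx v z| ≤ a) (x y ω : ℝ) :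
    |v (x, ω) - v (y, ω)| ≤ a * |x - y| :=
  Convex.norm_image_sub_le_of_norm_hasDerivWithin_le (f := fun x => v (x, ω)) (s := univ)
    (fun x _ => (hasDerivAt_dx hv x ω).hasDerivWithinAt) (fun x _ => ha (x, ω)) convex_univ
    (mem_univ y) (mem_univ x)

lemma hasCompactSupport_comp_eulerStep (hv : Differentiable ℝ v) (ha : ∀ z, |dx v z| ≤ a)
    (hh : 0 ≤ h) (hha : h * a < 1) (hψ : HasCompactSupport ψ) :
    HasCompactSupport fun z => ψ (eulerStep v h z) := by
  obtain ⟨R, hR⟩ := hψ.isCompact.isBounded.subset_closedBall 0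
  obtain ⟨C, hC⟩ := (isCompact_Icc (a := -R) (b := R)).exists_bound_of_continuousOn
    (f := fun ω : ℝ => v (0, ω)) (hv.continuous.comp (by fun_prop)).continuousOn
  refine HasCompactSupport.intro
    (isCompact_closedBall (0 : ℝ × ℝ) (max R ((R + h * C) / (1 - h * a)))) fun z hz => ?_
  by_contra hne
  refine hz ?_
  have hmem := hR (subset_tsupport _ (Function.mem_support.2 hne))
  rw [mem_closedBall_zero_iff, Prod.norm_def, max_le_iff] at hmem
  simp only [eulerStep, Real.norm_eq_abs] at hmem
  rw [mem_closedBall_zero_iff, Prod.norm_def, Real.norm_eq_abs, Real.norm_eq_abs]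
  refine max_le ?_ (hmem.2.trans (le_max_left _ _))
  refine le_max_of_le_right ?_
  rw [le_div_iff₀ (by linarith)]
  have h1 := hC z.2 (abs_le.1 hmem.2)
  have h2 := abs_sub_le_of_abs_dx_le hv ha z.1 0 z.2
  rw [Real.norm_eq_abs] at h1
  rw [sub_zero] at h2
  have h3 : |v z| ≤ C + a * |z.1| := by
    have := abs_sub_abs_le_abs_sub (v (z.1, z.2)) (v (0, z.2))
    simp only [Prod.mk.eta] at this h2
    linarith
  have h4 : |z.1| ≤ R + h * |v z| := by
    have e : z.1 = (z.1 + h * v z) - h * v z := by ring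
    have := abs_sub (z.1 + h * v z) (h * v z)
    rw [← e, abs_mul, abs_of_nonneg hh] at this
    linarith [hmem.1]
  have h5 := mul_le_mul_of_nonneg_left h3 hh
  linarith

lemma dx_comp_eulerStep (hv : Differentiable ℝ v) (hψ : Differentiable ℝ ψ) :
    dx (fun z => ψ (eulerStep v h z)) = fun z => dx ψ (eulerStep v h z) * (1 + h * dx v z) := by
  funext z
  have h1 : HasDerivAt (fun x => x + h * v (x, z.2)) (1 + h * dx v z) z.1 :=
    (hasDerivAt_id z.1).add ((hasDerivAt_dx hv z.1 z.2).const_mul h)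
  exact ((hasDerivAt_dx hψ (z.1 + h * v z) z.2).comp (h₂ := fun x => ψ (x, z.2)) z.1 h1).deriv

lemma abs_dx_comp_eulerStep_le (hv : ContDiff ℝ 2 v) (ha : ∀ z, |dx v z| ≤ a)
    (ha' : ∀ z, |dx (dx v) z| ≤ a) (hh : 0 ≤ h) (hψ : ContDiff ℝ 2 ψ) {C₁ C₂ : ℝ}
    (h1 : ∀ z, |dx ψ z| ≤ C₁) (h2 : ∀ z, |dx (dx ψ) z| ≤ C₂) (z : ℝ × ℝ) :
    |dx (fun z => ψ (eulerStep v h z)) z| ≤ C₁ * (1 + h * a) ∧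
      |dx (dx fun z => ψ (eulerStep v h z)) z| ≤ C₂ * (1 + h * a) ^ 2 + C₁ * (h * a) := by
  have ha0 : 0 ≤ a := (abs_nonneg _).trans (ha 0)
  have hC1 : 0 ≤ C₁ := (abs_nonneg _).trans (h1 0)
  have hC2 : 0 ≤ C₂ := (abs_nonneg _).trans (h2 0)
  have hvd := hv.differentiable (by simp)
  have hdv : ContDiff ℝ 1 (dx v) := ContDiff.dx hv (by norm_num)
  have hdψ : ContDiff ℝ 1 (dx ψ) := ContDiff.dx hψ (by norm_num)
  have hdvd := hdv.differentiable (by simp)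
  have hdψd := hdψ.differentiable (by simp)
  have h3 : ∀ z, |1 + h * dx v z| ≤ 1 + h * a := fun z => by
    refine (abs_add_le _ _).trans ?_
    rw [abs_one, abs_mul, abs_of_nonneg hh]
    linarith [mul_le_mul_of_nonneg_left (ha z) hh]
  rw [dx_comp_eulerStep hvd (hψ.differentiable (by simp))]
  constructor
  · rw [abs_mul]
    exact mul_le_mul (h1 _) (h3 z) (abs_nonneg _) hC1
  · have e1 : Differentiable ℝ fun z => dx ψ (eulerStep v h z) :=
      hdψd.comp ((contDiff_eulerStep (h := h) hv).differentiable (by simp))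
    have e2 : Differentiable ℝ fun z => 1 + h * dx v z := by fun_prop
    have e3 : dx (fun z => 1 + h * dx v z) z = h * dx (dx v) z :=
      (((hasDerivAt_dx hdvd z.1 z.2).const_mul h).const_add 1).deriv
    rw [dx_mul e1 e2, dx_comp_eulerStep hvd hdψd, e3]
    refine (abs_add_le _ _).trans (add_le_add ?_ ?_)
    · rw [abs_mul, abs_mul, mul_assoc, sq]
      exact mul_le_mul (h2 _) (mul_le_mul (h3 z) (h3 z) (abs_nonneg _) (by positivity))
        (by positivity) hC2
    · rw [abs_mul, abs_mul, abs_of_nonneg hh]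
      exact mul_le_mul (h1 _) (mul_le_mul_of_nonneg_left (ha' z) hh) (by positivity) hC1

/-- The explicit Euler scheme with time step `h` for the time-dependent field `b`. -/
def eulerPath (b : ℝ → ℝ × ℝ → ℝ) (h : ℝ) : ℕ → ℝ × ℝ → ℝ × ℝ
  | 0, z => z
  | k + 1, z => eulerStep (b (k * h)) h (eulerPath b h k z)

variable {S : Set ℝ} {T V m : ℝ} {b : ℝ → ℝ × ℝ → ℝ} {μ : ℝ → Measure (ℝ × ℝ)}

/-- Weak error of the Euler scheme. -/
lemma RegularTransport.abs_integral_sub_eulerPath_le (hb : RegularTransport S T a V m b μ)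
    (ha : 0 ≤ a) (hV : 0 ≤ V) (hm : 0 ≤ m) {ε : ℝ} (hh : 0 ≤ h) (hha : h * a < 1)
    (hε : ∀ s ∈ Icc 0 T, ∀ r ∈ Icc 0 T, |r - s| ≤ h → ∀ ω ∈ S, ∀ x,
      |b r (x, ω) - b s (x, ω)| ≤ ε) (hε0 : 0 ≤ ε) (k : ℕ) (hk : k * h ≤ T) {ψ : ℝ × ℝ → ℝ}
    (hψ : ContDiff ℝ 2 ψ) (hψc : HasCompactSupport ψ) {C₁ C₂ : ℝ} (h1 : ∀ z, |dx ψ z| ≤ C₁)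
    (h2 : ∀ z, |dx (dx ψ) z| ≤ C₂) :
    |(∫ z, ψ z ∂(μ (k * h))) - ∫ z, ψ (eulerPath b h k z) ∂(μ 0)| ≤
      k * h * (ε + h * ((a * V + 2 * V ^ 2) * (2 + 2 * m))) * (C₁ + C₂) *
        ((1 + h * a) ^ 2) ^ k := by
  induction k generalizing ψ C₁ C₂ with
  | zero => simp [eulerPath]
  | succ k ih =>
    have hC1 : 0 ≤ C₁ := (abs_nonneg _).trans (h1 0)
    have hC2 : 0 ≤ C₂ := (abs_nonneg _).trans (h2 0)
    have e : ((k + 1 : ℕ) : ℝ) * h = k * h + h := by push_cast; ring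
    rw [e] at hk ⊢
    have hk0 : 0 ≤ k * h := by positivity
    have hs : (k * h : ℝ) ∈ Icc 0 T := ⟨hk0, by linarith⟩
    have hsh : k * h + h ∈ Icc 0 T := ⟨by linarith, hk⟩
    have hbs := hb.contDiff _ hs
    have hEc := hasCompactSupport_comp_eulerStep (hbs.differentiable (by simp)) (hb.dx_le _ hs)
      hh hha hψc
    have hstep := hb.abs_integral_sub_eulerStep_le ha hV hm hψ hψc h1 h2 hs hh hsh
      (ε := ε) (fun r hr => hε _ hs r ⟨hk0.trans hr.1, hr.2.trans hk⟩
        (by rw [abs_of_nonneg (by linarith [hr.1])]; linarith [hr.2])) hEc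
    have hbd := abs_dx_comp_eulerStep_le hbs (hb.dx_le _ hs) (hb.dx_dx_le _ hs) hh hψ h1 h2
    have hind := ih (by linarith) (hψ.comp (contDiff_eulerStep hbs)) hEc (fun z => (hbd z).1)
      (fun z => (hbd z).2)
    obtain ⟨L, hL⟩ : ∃ L, L = ε + h * ((a * V + 2 * V ^ 2) * (2 + 2 * m)) := ⟨_, rfl⟩
    have hL0 : 0 ≤ L := by rw [hL]; positivity
    rw [← hL] at hstep hind ⊢
    have hone : 1 ≤ (1 + h * a) ^ 2 := one_le_pow₀ (by linarith [mul_nonneg hh ha])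
    have hgrow : C₁ * (1 + h * a) + (C₂ * (1 + h * a) ^ 2 + C₁ * (h * a)) ≤
        (C₁ + C₂) * (1 + h * a) ^ 2 := by
      have : 0 ≤ C₁ * (h * a) ^ 2 := by positivity
      linarith
    have hA : 0 ≤ k * h * L := by positivity
    have q1 : k * h * L * (C₁ * (1 + h * a) + (C₂ * (1 + h * a) ^ 2 + C₁ * (h * a))) *
        ((1 + h * a) ^ 2) ^ k ≤ k * h * L * ((C₁ + C₂) * (1 + h * a) ^ 2) *
          ((1 + h * a) ^ 2) ^ k :=
      mul_le_mul_of_nonneg_right (mul_le_mul_of_nonneg_left hgrow hA) (by positivity)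
    have q2 : h * L * (C₁ + C₂) ≤ h * L * (C₁ + C₂) * ((1 + h * a) ^ 2) ^ (k + 1) :=
      le_mul_of_one_le_right (by positivity) (one_le_pow₀ hone)
    have q3 := abs_sub_le (∫ z, ψ z ∂(μ (k * h + h)))
      (∫ z, ψ (eulerStep (b (k * h)) h z) ∂(μ (k * h)))
      (∫ z, ψ (eulerPath b h (k + 1) z) ∂(μ 0))
    refine q3.trans ((add_le_add (hstep.trans q2) (hind.trans q1)).trans_eq ?_)
    rw [pow_succ]
    ring

end EulerScheme

section Characteristics

/-- Comparison principle for a linear differential inequality. -/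
lemma abs_le_of_abs_deriv_le {T a : ℝ} {Z Z' B B' : ℝ → ℝ}
    (hZ : ∀ t ∈ Icc 0 T, HasDerivWithinAt Z (Z' t) (Icc 0 T) t)
    (hB : ∀ t, HasDerivAt B (B' t) t) (h0 : |Z 0| ≤ B 0)
    (h : ∀ t ∈ Icc 0 T, |Z' t| ≤ a * |Z t| + (B' t - a * B t)) : ∀ t ∈ Icc 0 T, |Z t| ≤ B t := by
  intro t ht
  have key : ∀ δ > 0, |Z t| ≤ B t + δ * exp ((a + 1) * t) := by
    intro δ hδ
    have hE : ∀ s, HasDerivAt (fun s => B s + δ * exp ((a + 1) * s))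
        (B' s + δ * (exp ((a + 1) * s) * (a + 1))) s := fun s =>
      (hB s).add ((((hasDerivAt_id s).const_mul (a + 1)).exp.congr_deriv (by simp)).const_mul δ)
    refine image_norm_le_of_norm_deriv_right_lt_deriv_boundary'
      (fun s hs => (hZ s hs).continuousWithinAt)
      (fun s hs => (hZ s ⟨hs.1, hs.2.le⟩).mono_of_mem_nhdsWithin (Icc_mem_nhdsGE_of_mem hs))
      (h0.trans (by simp; positivity)) (fun s _ => (hE s).continuousAt.continuousWithinAt)
      (fun s _ => (hE s).hasDerivWithinAt) (fun s hs hs' => ?_) ht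
    have h1 := h s ⟨hs.1, hs.2.le⟩
    rw [Real.norm_eq_abs] at hs' ⊢
    rw [hs'] at h1
    have : 0 < δ * exp ((a + 1) * s) := by positivity
    linarith
  refine le_of_forall_pos_le_add fun ε hε => ?_
  have := key (ε / exp ((a + 1) * t)) (by positivity)
  rwa [div_mul_cancel₀ _ (exp_pos _).ne'] at this

/-- Global existence for scalar equations with a Lipschitz right-hand side of linear growth. -/
lemma exists_integralCurve {T a V : ℝ} (hT : 0 ≤ T) (ha : 0 ≤ a) (hV : 0 ≤ V) {g : ℝ → ℝ → ℝ}
    (hg : ∀ t ∈ Icc 0 T, ∀ x y, |g t x - g t y| ≤ a * |x - y|)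
    (hgc : ∀ x, ContinuousOn (fun t => g t x) (Icc 0 T))
    (hgV : ∀ t ∈ Icc 0 T, ∀ x, |g t x| ≤ V * (1 + |x|)) (x₀ : ℝ) :
    ∃ X : ℝ → ℝ, X 0 = x₀ ∧
      (∀ t ∈ Icc 0 T, HasDerivWithinAt X (g t (X t)) (Icc 0 T) t) ∧
      ∀ t ∈ Icc 0 T, |X t| ≤ (1 + |x₀|) * exp (V * T) := by
  obtain ⟨B, hB⟩ : ∃ B, B = (1 + |x₀|) * exp (V * T) := ⟨_, rfl⟩
  have hB0 : 0 ≤ B := by rw [hB]; positivity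
  obtain ⟨c, hc⟩ : ∃ c : ℝ → ℝ, c = fun x => max (-B) (min B x) := ⟨_, rfl⟩
  have hcB : ∀ x, |c x| ≤ B := fun x => by
    rw [hc, abs_le]
    exact ⟨le_max_left _ _, max_le (by linarith) (min_le_left _ _)⟩
  have hcx : ∀ x, |c x| ≤ |x| := fun x => by
    rw [hc]
    simp only
    rcases abs_cases x with h | h <;> rcases abs_cases (max (-B) (min B x)) with h' | h' <;>
      rcases max_cases (-B) (min B x) with h'' | h'' <;> rcases min_cases B x with h3 | h3 <;>
      linarith
  have hcl : ∀ x y, |c x - c y| ≤ |x - y| := fun x y => by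
    rw [hc]
    refine (abs_max_sub_max_le_max _ _ _ _).trans (max_le (by simp) ?_)
    exact (abs_min_sub_min_le_max _ _ _ _).trans (max_le (by simp) le_rfl)
  have hce : ∀ x, |x| ≤ B → c x = x := fun x hx => by
    rw [abs_le] at hx
    rw [hc]
    simp [hx.1, hx.2]
  have hpl : IsPicardLindelof (fun t x => g t (c x)) (tmin := 0) (tmax := T) ⟨0, le_rfl, hT⟩ x₀
      (Real.toNNReal (V * (1 + B) * T)) 0 (Real.toNNReal (V * (1 + B))) (Real.toNNReal a) := by
    refine ⟨fun t ht => LipschitzWith.lipschitzOnWith (LipschitzWith.of_dist_le_mul fun x y => ?_),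
      fun x _ => hgc _, fun t ht x _ => ?_, ?_⟩
    · rw [Real.coe_toNNReal _ ha, Real.dist_eq, Real.dist_eq]
      exact (hg t ht _ _).trans (mul_le_mul_of_nonneg_left (hcl x y) ha)
    · rw [Real.coe_toNNReal _ (by positivity)]
      exact (hgV t ht _).trans
        (mul_le_mul_of_nonneg_left (by linarith [hcB x]) hV)
    · rw [Real.coe_toNNReal _ (by positivity), Real.coe_toNNReal _ (by positivity)]
      simp [hT]
  obtain ⟨X, hX0, hX⟩ := hpl.exists_eq_forall_mem_Icc_hasDerivWithinAt₀
  change X 0 = x₀ at hX0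
  have hbd : ∀ t ∈ Icc 0 T, |X t| ≤ (1 + |x₀|) * exp (V * t) - 1 := by
    have hE : ∀ t, HasDerivAt (fun t => (1 + |x₀|) * exp (V * t) - 1)
        ((1 + |x₀|) * (exp (V * t) * V)) t := fun t =>
      (((((hasDerivAt_id t).const_mul V).exp).congr_deriv (by simp)).const_mul _).sub_const 1
    refine abs_le_of_abs_deriv_le (a := V) hX hE (by simp [hX0]) fun t ht => ?_
    refine (hgV t ht _).trans ?_
    have := mul_le_mul_of_nonneg_left (hcx (X t)) hV
    linarith
  have hbd' : ∀ t ∈ Icc 0 T, |X t| ≤ B := fun t ht => by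
    have h1 : exp (V * t) ≤ exp (V * T) := exp_le_exp.2 (mul_le_mul_of_nonneg_left ht.2 hV)
    have h2 := mul_le_mul_of_nonneg_left h1 (by positivity : 0 ≤ 1 + |x₀|)
    linarith [hbd t ht]
  refine ⟨X, hX0, fun t ht => ?_, fun t ht => hB ▸ hbd' t ht⟩
  simpa only [hce _ (hbd' t ht)] using hX t ht

/-- One step of the Euler scheme compared with an exact trajectory. -/
lemma abs_sub_sub_mul_le {T c η h : ℝ} {X v : ℝ → ℝ} {s : ℝ} (hs : 0 ≤ s) (hh : 0 ≤ h)
    (hsh : s + h ≤ T) (hX : ∀ t ∈ Icc 0 T, HasDerivWithinAt X (v t) (Icc 0 T) t)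
    (hv : ∀ r ∈ Icc s (s + h), |v r - c| ≤ η) : |X (s + h) - X s - h * c| ≤ η * h := by
  have hsub : Icc s (s + h) ⊆ Icc 0 T := Icc_subset_Icc hs hsh
  have := Convex.norm_image_sub_le_of_norm_hasDerivWithin_le
    (f := fun r => X r - r * c) (f' := fun r => v r - c) (s := Icc s (s + h)) (C := η)
    (fun r hr => (((hX r (hsub hr)).mono hsub).sub
      ((hasDerivWithinAt_id r _).mul_const c)).congr_deriv (by simp))
    hv (convex_Icc _ _) (left_mem_Icc.2 (by linarith)) (right_mem_Icc.2 (by linarith))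
  rw [Real.norm_eq_abs, Real.norm_eq_abs, add_sub_cancel_left, abs_of_nonneg hh] at this
  convert this using 2
  ring

end Characteristics

section EulerConvergence

variable {S : Set ℝ} {T a V m : ℝ} {b : ℝ → ℝ × ℝ → ℝ} {μ : ℝ → Measure (ℝ × ℝ)}

lemma eulerPath_snd (b : ℝ → ℝ × ℝ → ℝ) (h : ℝ) (k : ℕ) (z : ℝ × ℝ) :
    (eulerPath b h k z).2 = z.2 := by
  induction k with
  | zero => rfl
  | succ k ih => exact ih

lemma RegularTransport.continuous_eulerPath (hb : RegularTransport S T a V m b μ) {h : ℝ}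
    (hh : 0 ≤ h) (k : ℕ) (hk : k * h ≤ T) : Continuous (eulerPath b h k) := by
  induction k with
  | zero => exact continuous_id
  | succ k ih =>
    push_cast at hk
    have hk' : k * h ≤ T := by linarith
    exact (contDiff_eulerStep (hb.contDiff _ ⟨by positivity, hk'⟩)).continuous.comp (ih hk')

lemma RegularTransport.abs_sub_le (hb : RegularTransport S T a V m b μ) {s : ℝ}
    (hs : s ∈ Icc 0 T) (x y ω : ℝ) : |b s (x, ω) - b s (y, ω)| ≤ a * |x - y| :=
  abs_sub_le_of_abs_dx_le ((hb.contDiff s hs).differentiable (by simp)) (hb.dx_le s hs) x y ω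

/-- Pointwise error of the Euler scheme. -/
lemma RegularTransport.abs_eulerPath_sub_le (hb : RegularTransport S T a V m b μ)
    (ha : 0 ≤ a) (hV : 0 ≤ V) {ε h B ω : ℝ} (hω : ω ∈ S) (hh : 0 ≤ h)
    (hε : ∀ s ∈ Icc 0 T, ∀ r ∈ Icc 0 T, |r - s| ≤ h → ∀ ω ∈ S, ∀ x,
      |b r (x, ω) - b s (x, ω)| ≤ ε) {X : ℝ → ℝ}
    (hX : ∀ t ∈ Icc 0 T, HasDerivWithinAt X (b t (X t, ω)) (Icc 0 T) t)
    (hB : ∀ t ∈ Icc 0 T, |X t| ≤ B) (k : ℕ) (hk : k * h ≤ T) :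
    |X (k * h) - (eulerPath b h k (X 0, ω)).1| ≤
      k * h * (ε + a * (V * (1 + B) * h)) * (1 + h * a) ^ k := by
  induction k with
  | zero => simp [eulerPath]
  | succ k ih =>
    obtain ⟨s, hs⟩ : ∃ s : ℝ, s = k * h := ⟨_, rfl⟩
    have hs0 : 0 ≤ s := by rw [hs]; positivity
    have e : ((k + 1 : ℕ) : ℝ) * h = s + h := by push_cast; rw [hs]; ring
    rw [e] at hk ⊢
    have hsT : s ∈ Icc 0 T := ⟨hs0, by linarith⟩
    have hB0 : 0 ≤ B := (abs_nonneg _).trans (hB s hsT)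
    have hε0 : 0 ≤ ε := (abs_nonneg _).trans (hε s hsT s hsT (by simpa using hh) ω hω 0)
    have hsub : Icc s (s + h) ⊆ Icc 0 T := Icc_subset_Icc hs0 hk
    have hspeed : ∀ r ∈ Icc 0 T, |b r (X r, ω)| ≤ V * (1 + B) := fun r hr =>
      (hb.growth r hr ω hω _).trans (mul_le_mul_of_nonneg_left (by linarith [hB r hr]) hV)
    have hmove : ∀ r ∈ Icc s (s + h), |X r - X s| ≤ V * (1 + B) * h := fun r hr => by
      refine (Convex.norm_image_sub_le_of_norm_hasDerivWithin_le (f := X)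
        (fun q hq => (hX q (hsub hq)).mono hsub) (fun q hq => hspeed q (hsub hq))
        (convex_Icc _ _) (left_mem_Icc.2 (by linarith)) hr).trans ?_
      refine mul_le_mul_of_nonneg_left ?_ (by positivity)
      rw [Real.norm_eq_abs, abs_of_nonneg (by linarith [hr.1])]
      linarith [hr.2]
    obtain ⟨η, hη⟩ : ∃ η, η = ε + a * (V * (1 + B) * h) := ⟨_, rfl⟩
    have hη0 : 0 ≤ η := by rw [hη]; positivity
    have hloc := abs_sub_sub_mul_le (c := b s (X s, ω)) (η := η) hs0 hh hk hX fun r hr => by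
      refine (_root_.abs_sub_le _ (b s (X r, ω)) _).trans ?_
      rw [hη]
      refine add_le_add (hε s hsT r (hsub hr) ?_ ω hω _)
        ((hb.abs_sub_le hsT _ _ _).trans (mul_le_mul_of_nonneg_left (hmove r hr) ha))
      rw [abs_of_nonneg (by linarith [hr.1])]
      linarith [hr.2]
    have hind := ih (by rw [← hs]; exact hsT.2)
    obtain ⟨y, hy⟩ : ∃ y, y = (eulerPath b h k (X 0, ω)).1 := ⟨_, rfl⟩
    have hstep : (eulerPath b h (k + 1) (X 0, ω)).1 = y + h * b s (y, ω) := by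
      have : eulerPath b h k (X 0, ω) = (y, ω) :=
        Prod.ext hy.symm (eulerPath_snd b h k (X 0, ω))
      rw [eulerPath, this, eulerStep, hs]
    rw [hstep]
    rw [← hy, ← hs, ← hη] at hind
    rw [← hη]
    have hlip := mul_le_mul_of_nonneg_left (hb.abs_sub_le hsT (X s) y ω) hh
    rw [← abs_of_nonneg hh, ← abs_mul, abs_of_nonneg hh] at hlip
    have hsplit : X (s + h) - (y + h * b s (y, ω)) = (X (s + h) - X s - h * b s (X s, ω)) +
        ((X s - y) + h * (b s (X s, ω) - b s (y, ω))) := by ring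
    have hha : 0 ≤ h * a := by positivity
    have h1 : (1 : ℝ) ≤ (1 + h * a) ^ (k + 1) := one_le_pow₀ (by linarith)
    have h2 : η * h ≤ η * h * (1 + h * a) ^ (k + 1) :=
      le_mul_of_one_le_right (by positivity) h1
    have h3 := mul_le_mul_of_nonneg_left hind (by linarith : 0 ≤ 1 + h * a)
    rw [hsplit]
    refine (abs_add_le _ _).trans ((add_le_add hloc (abs_add_le _ _)).trans ?_)
    have h4 : (1 + h * a) * (s * η * (1 + h * a) ^ k) = s * η * (1 + h * a) ^ (k + 1) := by ring
    linarith

lemma one_add_div_pow_le {x : ℝ} (hx : 0 ≤ x) (n : ℕ) : (1 + x / (n + 1)) ^ (n + 1) ≤ exp x := by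
  have h := pow_le_pow_left₀ (by positivity) (add_one_le_exp (x / (n + 1))) (n + 1)
  rw [← exp_nat_mul, add_comm] at h
  refine h.trans_eq (congrArg exp ?_)
  push_cast
  field_simp

lemma tendsto_const_div_natCast_add_one (t : ℝ) :
    Tendsto (fun n : ℕ => t / ((n : ℝ) + 1)) atTop (𝓝 0) :=
  tendsto_const_nhds.div_atTop (tendsto_natCast_atTop_atTop.atTop_add tendsto_const_nhds)

lemma tendsto_of_forall_eventually_abs_sub_le {u : ℕ → ℝ} {l C : ℝ}
    (h : ∀ ε > 0, ∀ᶠ n in atTop, |u n - l| ≤ ε * C) : Tendsto u atTop (𝓝 l) := by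
  rw [Metric.tendsto_atTop']
  intro ε hε
  obtain ⟨N, hN⟩ := eventually_atTop.1 (h (ε / (2 * (|C| + 1))) (by positivity))
  refine ⟨N, fun n hn => ?_⟩
  rw [Real.dist_eq]
  refine (hN n hn.le).trans_lt ?_
  calc ε / (2 * (|C| + 1)) * C ≤ ε / (2 * (|C| + 1)) * (|C| + 1) :=
        mul_le_mul_of_nonneg_left (by linarith [le_abs_self C]) (by positivity)
    _ = ε / 2 := by field_simp
    _ < ε := by linarith

/-- The mesh of the Euler scheme can be chosen so that the field oscillates little. -/
lemma RegularTransport.eventually_osc_le (hb : RegularTransport S T a V m b μ) (t : ℝ) {ε : ℝ}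
    (hε : 0 < ε) : ∀ᶠ n : ℕ in atTop, ∀ s ∈ Icc 0 T, ∀ r ∈ Icc 0 T,
      |r - s| ≤ t / (n + 1) → ∀ ω ∈ S, ∀ x, |b r (x, ω) - b s (x, ω)| ≤ ε := by
  obtain ⟨δ, hδ, H⟩ := hb.modulus ε hε
  filter_upwards [(tendsto_const_div_natCast_add_one t).eventually_lt_const hδ]
    with n hn s hs r hr hrs
  exact H r hr s hs (hrs.trans_lt hn)

/-- Pointwise convergence of the Euler scheme. -/
lemma RegularTransport.tendsto_eulerPath (hb : RegularTransport S T a V m b μ)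
    (ha : 0 ≤ a) (hV : 0 ≤ V) {B ω : ℝ} (hω : ω ∈ S) {X : ℝ → ℝ}
    (hX : ∀ t ∈ Icc 0 T, HasDerivWithinAt X (b t (X t, ω)) (Icc 0 T) t)
    (hB : ∀ t ∈ Icc 0 T, |X t| ≤ B) {t : ℝ} (ht : t ∈ Icc 0 T) :
    Tendsto (fun n : ℕ => (eulerPath b (t / (n + 1)) (n + 1) (X 0, ω)).1) atTop (𝓝 (X t)) := by
  have hB0 : 0 ≤ B := (abs_nonneg _).trans (hB t ht)
  refine tendsto_of_forall_eventually_abs_sub_le (C := t * 2 * exp (t * a)) fun ε hε => ?_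
  have hlim : Tendsto (fun n : ℕ => a * (V * (1 + B) * (t / (n + 1)))) atTop (𝓝 0) := by
    simpa using ((tendsto_const_div_natCast_add_one t).const_mul (V * (1 + B))).const_mul a
  filter_upwards [hb.eventually_osc_le t hε, hlim.eventually_le_const hε] with n hn hn'
  have hh : 0 ≤ t / (n + 1) := div_nonneg ht.1 (by positivity)
  have e : ((n + 1 : ℕ) : ℝ) * (t / (n + 1)) = t := by push_cast; field_simp
  have := hb.abs_eulerPath_sub_le ha hV hω hh hn hX hB (n + 1) (by rw [e]; exact ht.2)
  rw [e, abs_sub_comm] at this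
  refine this.trans ?_
  have h1 := one_add_div_pow_le (mul_nonneg ht.1 ha) n
  rw [show t / (n + 1) * a = t * a / (n + 1) by ring]
  calc t * (ε + a * (V * (1 + B) * (t / (n + 1)))) * (1 + t * a / (n + 1)) ^ (n + 1)
      ≤ t * (ε + ε) * exp (t * a) := by
        have := ht.1
        gcongr
    _ = ε * (t * 2 * exp (t * a)) := by ring

/-- Weak convergence of the Euler scheme to the solution. -/
lemma RegularTransport.tendsto_integral_eulerPath (hb : RegularTransport S T a V m b μ)
    (ha : 0 ≤ a) (hV : 0 ≤ V) (hm : 0 ≤ m) {t : ℝ} (ht : t ∈ Icc 0 T) {ψ : ℝ × ℝ → ℝ}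
    (hψ : ContDiff ℝ 2 ψ) (hψc : HasCompactSupport ψ) :
    Tendsto (fun n : ℕ => ∫ z, ψ (eulerPath b (t / (n + 1)) (n + 1) z) ∂(μ 0)) atTop
      (𝓝 (∫ z, ψ z ∂(μ t))) := by
  have hψd := hψ.differentiable (by simp)
  have hdψ : ContDiff ℝ 1 (dx ψ) := ContDiff.dx hψ (by norm_num)
  have hdψc := HasCompactSupport.dx hψd hψc
  have hddψ : ContDiff ℝ 0 (dx (dx ψ)) := ContDiff.dx hdψ (by norm_num)
  obtain ⟨C₁, h1⟩ := hdψc.exists_bound_of_continuous hdψ.continuous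
  obtain ⟨C₂, h2⟩ := (HasCompactSupport.dx (hdψ.differentiable (by simp))
    hdψc).exists_bound_of_continuous hddψ.continuous
  have hC1 : 0 ≤ C₁ := (norm_nonneg _).trans (h1 0)
  have hC2 : 0 ≤ C₂ := (norm_nonneg _).trans (h2 0)
  obtain ⟨K, hK⟩ : ∃ K, K = (a * V + 2 * V ^ 2) * (2 + 2 * m) := ⟨_, rfl⟩
  have hK0 : 0 ≤ K := by rw [hK]; positivity
  refine tendsto_of_forall_eventually_abs_sub_le
    (C := t * 2 * (C₁ + C₂) * exp (t * a) ^ 2) fun ε hε => ?_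
  have hlim : Tendsto (fun n : ℕ => t / (n + 1) * K) atTop (𝓝 0) := by
    simpa using (tendsto_const_div_natCast_add_one t).mul_const K
  have hlim' : Tendsto (fun n : ℕ => t / (n + 1) * a) atTop (𝓝 0) := by
    simpa using (tendsto_const_div_natCast_add_one t).mul_const a
  filter_upwards [hb.eventually_osc_le t hε, hlim.eventually_le_const hε,
    hlim'.eventually_lt_const one_pos] with n hn hn' hn1
  have hh : 0 ≤ t / (n + 1) := div_nonneg ht.1 (by positivity)
  have e : ((n + 1 : ℕ) : ℝ) * (t / (n + 1)) = t := by push_cast; field_simp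
  have := hb.abs_integral_sub_eulerPath_le ha hV hm hh hn1 hn hε.le (n + 1)
    (by rw [e]; exact ht.2) hψ hψc h1 h2
  rw [e, abs_sub_comm, ← hK] at this
  refine this.trans ?_
  have h3 := one_add_div_pow_le (mul_nonneg ht.1 ha) n
  rw [show t / (n + 1) * a = t * a / (n + 1) by ring, ← pow_mul, mul_comm 2, pow_mul]
  calc t * (ε + t / (n + 1) * K) * (C₁ + C₂) * ((1 + t * a / (n + 1)) ^ (n + 1)) ^ 2
      ≤ t * (ε + ε) * (C₁ + C₂) * exp (t * a) ^ 2 := by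
        have h4 := ht.1
        have h5 : 0 ≤ t * a / (n + 1) := by positivity
        gcongr
    _ = ε * (t * 2 * (C₁ + C₂) * exp (t * a) ^ 2) := by ring

end EulerConvergence

section Pushforward

/-- Two finite measures on the plane agreeing on smooth compactly supported functions are equal. -/
lemma measure_ext_of_contDiff {m m' : Measure (ℝ × ℝ)} [IsProbabilityMeasure m]
    [IsProbabilityMeasure m'] (h : ∀ ψ : ℝ × ℝ → ℝ, ContDiff ℝ 2 ψ → HasCompactSupport ψ →
      ∫ z, ψ z ∂m = ∫ z, ψ z ∂m') : m = m' := by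
  refine ext_of_generate_finite {s | IsOpen s} BorelSpace.measurable_eq isPiSystem_isOpen
    (fun U (hU : IsOpen U) => ?_) (by simp)
  obtain ⟨f, hf, hfd, hfr⟩ := hU.exists_contDiff_support_eq (n := 2)
  have hr : ∀ n : ℕ, (0 : ℝ) < n + 1 := fun n => by positivity
  let g : ℕ → ℝ × ℝ → ℝ := fun n z => smoothTransition (n * f z) * cutoff₂ (n + 1) (hr n) z
  have hgd : ∀ n, ContDiff ℝ 2 (g n) := fun n =>
    (smoothTransition.contDiff.comp (contDiff_const.mul hfd)).mul (contDiff_cutoff₂ (hr n) (n := 2))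
  have hgc : ∀ n, HasCompactSupport (g n) := fun n => (hasCompactSupport_cutoff₂ (hr n)).mul_left
  have hg1 : ∀ n z, ‖g n z‖ ≤ 1 := fun n z => by
    rw [Real.norm_eq_abs, abs_mul, cutoff₂, abs_mul, abs_of_nonneg (smoothTransition.nonneg _),
      abs_of_nonneg (cutoff _ (hr n)).nonneg, abs_of_nonneg (cutoff _ (hr n)).nonneg]
    exact mul_le_one₀ (smoothTransition.le_one _) (mul_nonneg (cutoff _ _).nonneg
      (cutoff _ _).nonneg) (mul_le_one₀ (cutoff _ _).le_one (cutoff _ _).nonneg (cutoff _ _).le_one)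
  have hlim : ∀ z, Tendsto (fun n => g n z) atTop (𝓝 (U.indicator (fun _ => (1 : ℝ)) z)) := by
    intro z
    refine tendsto_const_nhds.congr' ?_
    by_cases hz : z ∈ U
    · have hfz : 0 < f z := lt_of_le_of_ne (hfr ⟨z, rfl⟩).1
        (Ne.symm (Function.mem_support.1 (hf ▸ hz)))
      filter_upwards [tendsto_natCast_atTop_atTop.eventually_ge_atTop (1 / f z),
        tendsto_natCast_atTop_atTop.eventually_ge_atTop ‖z‖] with n hn hn'
      rw [Prod.norm_def, max_le_iff, Real.norm_eq_abs, Real.norm_eq_abs] at hn'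
      rw [div_le_iff₀ hfz] at hn
      simp only [g, cutoff₂]
      rw [smoothTransition.one_of_one_le hn, cutoff_eq_one (hr n) (by linarith [hn'.1]),
        cutoff_eq_one (hr n) (by linarith [hn'.2]), indicator_of_mem hz]
      norm_num
    · have hfz : f z = 0 := by
        rw [← hf] at hz
        exact Function.notMem_support.1 hz
      exact Eventually.of_forall fun n => by simp [g, hfz, hz]
  have key : ∀ p : Measure (ℝ × ℝ), IsProbabilityMeasure p →
      Tendsto (fun n => ∫ z, g n z ∂p) atTop (𝓝 (p.real U)) := fun p _ => by
    rw [← integral_indicator_one hU.measurableSet]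
    exact tendsto_integral_of_dominated_convergence (fun _ => 1)
      (fun n => (hgd n).continuous.aestronglyMeasurable) (integrable_const _)
      (fun n => ae_of_all _ (hg1 n)) (ae_of_all _ hlim)
  have := tendsto_nhds_unique (key m inferInstance)
    ((key m' inferInstance).congr fun n => (h _ (hgd n) (hgc n)).symm)
  rwa [Measure.real, Measure.real, ENNReal.toReal_eq_toReal_iff' (measure_ne_top _ _)
    (measure_ne_top _ _)] at this

variable {S : Set ℝ} {T a V m : ℝ} {b : ℝ → ℝ × ℝ → ℝ} {μ : ℝ → Measure (ℝ × ℝ)}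

/-- A solution is the push-forward of its initial datum by the characteristic flow. -/
lemma RegularTransport.exists_flow (hb : RegularTransport S T a V m b μ) (hT : 0 ≤ T)
    (ha : 0 ≤ a) (hV : 0 ≤ V) (hm : 0 ≤ m) : ∃ X : ℝ → ℝ × ℝ → ℝ,
      (∀ z, z.2 ∈ S → X 0 z = z.1) ∧
      (∀ z, z.2 ∈ S → ∀ t ∈ Icc 0 T,
        HasDerivWithinAt (fun s => X s z) (b t (X t z, z.2)) (Icc 0 T) t) ∧
      (∀ z, z.2 ∈ S → ∀ t ∈ Icc 0 T, |X t z| ≤ (1 + |z.1|) * exp (V * T)) ∧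
      ∀ t ∈ Icc 0 T, Measurable (X t) ∧ μ t = (μ 0).map fun z => (X t z, z.2) := by
  have h0 : (0 : ℝ) ∈ Icc 0 T := ⟨le_rfl, hT⟩
  have hex : ∀ z : ℝ × ℝ, z.2 ∈ S → ∃ X : ℝ → ℝ, X 0 = z.1 ∧
      (∀ t ∈ Icc 0 T, HasDerivWithinAt X (b t (X t, z.2)) (Icc 0 T) t) ∧
      ∀ t ∈ Icc 0 T, |X t| ≤ (1 + |z.1|) * exp (V * T) := fun z hz => by
    refine exists_integralCurve hT ha hV (g := fun t x => b t (x, z.2))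
      (fun t ht x y => hb.abs_sub_le ht x y z.2) (fun x => ?_)
      (fun t ht x => hb.growth t ht _ hz x) z.1
    rw [Metric.continuousOn_iff]
    intro t ht ε hε
    obtain ⟨δ, hδ, H⟩ := hb.modulus (ε / 2) (by positivity)
    exact ⟨δ, hδ, fun s hs hst => (H s hs t ht hst _ hz x).trans_lt (by linarith)⟩
  choose! Y hY0 hYd hYb using hex
  let X : ℝ → ℝ × ℝ → ℝ := fun t z =>
    limsup (fun n : ℕ => (eulerPath b (t / (n + 1)) (n + 1) z).1) atTop
  have hlim : ∀ z, z.2 ∈ S → ∀ t ∈ Icc 0 T,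
      Tendsto (fun n : ℕ => (eulerPath b (t / (n + 1)) (n + 1) z).1) atTop (𝓝 (Y z t)) := by
    intro z hz t ht
    have := hb.tendsto_eulerPath ha hV hz (hYd z hz) (hYb z hz) ht
    rwa [hY0 z hz] at this
  have hXY : ∀ z, z.2 ∈ S → ∀ t ∈ Icc 0 T, X t z = Y z t := fun z hz t ht =>
    (hlim z hz t ht).limsup_eq
  have hcont : ∀ t ∈ Icc 0 T, ∀ n : ℕ, Continuous (eulerPath b (t / (n + 1)) (n + 1)) :=
    fun t ht n => hb.continuous_eulerPath (div_nonneg ht.1 (by positivity)) _ (by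
      push_cast
      rw [mul_div_cancel₀ _ (by positivity)]
      exact ht.2)
  have hXm : ∀ t ∈ Icc 0 T, Measurable (X t) := fun t ht =>
    Measurable.limsup fun n => (continuous_fst.comp (hcont t ht n)).measurable
  refine ⟨X, fun z hz => by rw [hXY z hz 0 h0, hY0 z hz], fun z hz t ht => ?_,
    fun z hz t ht => by rw [hXY z hz t ht]; exact hYb z hz t ht, fun t ht => ⟨hXm t ht, ?_⟩⟩
  · rw [hXY z hz t ht]
    exact (hYd z hz t ht).congr (fun s hs => hXY z hz s hs) (hXY z hz t ht)
  · have hprob := hb.prob t ht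
    have hprob0 := hb.prob 0 h0
    have hmeas : Measurable fun z : ℝ × ℝ => (X t z, z.2) := (hXm t ht).prodMk measurable_snd
    have := Measure.isProbabilityMeasure_map (μ := μ 0) hmeas.aemeasurable
    refine measure_ext_of_contDiff fun ψ hψ hψc => ?_
    rw [integral_map hmeas.aemeasurable hψ.continuous.aestronglyMeasurable]
    obtain ⟨C, hC⟩ := hψc.exists_bound_of_continuous hψ.continuous
    refine tendsto_nhds_unique (hb.tendsto_integral_eulerPath ha hV hm ht hψ hψc) ?_
    refine tendsto_integral_of_dominated_convergence (fun _ => C)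
      (fun n => (hψ.continuous.comp (hcont t ht n)).aestronglyMeasurable) (integrable_const _)
      (fun n => ae_of_all _ fun z => hC _) ?_
    filter_upwards [hb.ae_mem 0 h0] with z hz
    refine (hψ.continuous.tendsto _).comp ?_
    rw [hXY z hz t ht]
    refine ((hlim z hz t ht).prodMk_nhds tendsto_const_nhds).congr fun n => ?_
    exact Prod.ext rfl (eulerPath_snd b _ _ z).symm

end Pushforward

section Lagrangian

/-- A Lagrangian representation of a solution: trajectories parametrised by `(ω, u)`, started
from the quantile functions of the fibres of the initial datum. -/
structure Lagrangian (ν : Measure ℝ) (T : ℝ) (b : ℝ → ℝ × ℝ → ℝ) (μ : ℝ → Measure (ℝ × ℝ))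
    (K : ℝ → ℝ → Measure ℝ) (Z : ℝ → ℝ × ℝ → ℝ) : Prop where
  aemeasurable : ∀ s ∈ Icc 0 T, AEMeasurable (Z s) (ν.prod unif)
  law : ∀ s ∈ Icc 0 T, μ s = (ν.prod unif).map fun q => (Z s q, q.1)
  dominated : ∃ G : ℝ × ℝ → ℝ, MemLp G 2 (ν.prod unif) ∧
    ∀ s ∈ Icc 0 T, ∀ᵐ q ∂(ν.prod unif), |Z s q| ≤ G q
  deriv : ∀ᵐ q ∂(ν.prod unif), q.1 ∈ msupp ν ∧ ∀ s ∈ Icc 0 T,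
    HasDerivWithinAt (fun r => Z r q) (b s (Z s q, q.1)) (Icc 0 T) s
  fiber : ∀ s ∈ Icc 0 T, ∀ᵐ ω ∂ν,
    AEMeasurable (fun u => Z s (ω, u)) unif ∧ K s ω = unif.map fun u => Z s (ω, u)
  start : ∀ᵐ q ∂(ν.prod unif), Z 0 q = quantile (K 0 q.1) q.2

variable {ν : Measure ℝ} {F : Measure (ℝ × ℝ) → ℝ × ℝ → ℝ}
  {A B I M κ γ : ℝ}

lemma ae_fst_mem_msupp : ∀ᵐ q ∂(ν.prod unif), q.1 ∈ msupp ν :=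
  Measure.quasiMeasurePreserving_fst.ae (p := fun ω => ω ∈ msupp ν) (measure_compl_msupp ν)

lemma IsSol.exists_lagrangian [IsProbabilityMeasure ν]
    {μ : ℝ → Measure (ℝ × ℝ)} {K : ℝ → ℝ → Measure ℝ}
    (hΩ : Bornology.IsBounded (msupp ν)) (hF : Framework ν F A B I M κ γ) (hI : 0 ≤ I)
    (hκ : 0 ≤ κ) (hM : 0 ≤ M) (hsol : IsSol F μ) (hP : ∀ t : ℝ, 0 ≤ t → μ t ∈ P2nu ν)
    (hK : ∀ t : ℝ, 0 ≤ t → IsDisint ν (μ t) (K t)) {T : ℝ} (hT : 0 ≤ T) :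
    ∃ Z, Lagrangian ν T (fun s => F (μ s)) μ K Z := by
  obtain ⟨V, m, hV, hm, hb⟩ := hsol.exists_regularTransport hΩ hF hI hκ hM hP hT
  obtain ⟨X, hX0, hXd, hXb, hX⟩ := hb.exists_flow hT (mul_nonneg hκ hI) hV hm
  have hprob := (hP 0 le_rfl).1
  have hK0 := hK 0 le_rfl
  have hR := hK0.aemeasurable_quantile
  have hRω : AEMeasurable (fun q : ℝ × ℝ => (quantile (K 0 q.1) q.2, q.1)) (ν.prod unif) :=
    hR.prodMk measurable_fst.aemeasurable
  refine ⟨fun s q => X s (quantile (K 0 q.1) q.2, q.1),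
    fun s hs => (hX s hs).1.comp_aemeasurable hRω, fun s hs => ?_,
    ⟨fun q => (1 + |quantile (K 0 q.1) q.2|) * exp (V * T), ?_, fun s hs => ?_⟩, ?_,
    fun s hs => ?_, ?_⟩
  · nth_rewrite 1 [(hX s hs).2, ← hK0.map_quantile]
    exact AEMeasurable.map_map_of_aemeasurable
      ((hX s hs).1.prodMk measurable_snd).aemeasurable hRω
  · have hsq : Integrable (fun q : ℝ × ℝ => quantile (K 0 q.1) q.2 ^ 2) (ν.prod unif) := by
      have := P2nu.integrable_sq (hP 0 le_rfl)
      rw [← hK0.map_quantile] at this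
      exact this.comp_aemeasurable hRω
    have h2 := ((memLp_two_iff_integrable_sq hR.aestronglyMeasurable).2 hsq).abs
    exact ((memLp_const (1 : ℝ)).add h2).mul_const _
  · filter_upwards [ae_fst_mem_msupp] with q hq using hXb (_, q.1) hq s hs
  · filter_upwards [ae_fst_mem_msupp] with q hq using ⟨hq, fun s hs => hXd (_, q.1) hq s hs⟩
  · have hKs := hK s hs.1
    rw [(hX s hs).2] at hKs
    filter_upwards [hK0.ae_eq_map (hX s hs).1 hKs] with ω hω
    have := hK0.1 ω
    have hq := aemeasurable_quantile_const (K 0 ω)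
    have hXω : Measurable fun x => X s (x, ω) := (hX s hs).1.comp measurable_prodMk_right
    refine ⟨hXω.comp_aemeasurable hq, ?_⟩
    rw [hω]
    nth_rewrite 1 [← map_quantile (K 0 ω)]
    exact AEMeasurable.map_map_of_aemeasurable hXω.aemeasurable hq
  · filter_upwards [ae_fst_mem_msupp] with q hq using hX0 (_, q.1) hq

variable {T : ℝ} {b b' : ℝ → ℝ × ℝ → ℝ} {μ μ' : ℝ → Measure (ℝ × ℝ)}
  {K K' : ℝ → ℝ → Measure ℝ} {Z Z' : ℝ → ℝ × ℝ → ℝ}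

lemma Lagrangian.memLp (h : Lagrangian ν T b μ K Z) {s : ℝ} (hs : s ∈ Icc 0 T) :
    MemLp (Z s) 2 (ν.prod unif) := by
  obtain ⟨G, hG, hZG⟩ := h.dominated
  exact hG.mono' (h.aemeasurable s hs).aestronglyMeasurable (hZG s hs)

lemma Lagrangian.integrable_abs_sub [IsProbabilityMeasure ν] (h : Lagrangian ν T b μ K Z)
    (h' : Lagrangian ν T b' μ' K' Z') {s : ℝ} (hs : s ∈ Icc 0 T) :
    Integrable (fun q => |Z s q - Z' s q|) (ν.prod unif) :=
  (((h.memLp hs).sub (h'.memLp hs)).integrable one_le_two).abs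

lemma Lagrangian.integrable_sub_sq [IsProbabilityMeasure ν] (h : Lagrangian ν T b μ K Z)
    (h' : Lagrangian ν T b' μ' K' Z') {s : ℝ} (hs : s ∈ Icc 0 T) :
    Integrable (fun q => (Z s q - Z' s q) ^ 2) (ν.prod unif) :=
  ((h.memLp hs).sub (h'.memLp hs)).integrable_sq

lemma Lagrangian.exists_integral_abs_sub_le [IsProbabilityMeasure ν] (h : Lagrangian ν T b μ K Z)
    (h' : Lagrangian ν T b' μ' K' Z') :
    ∃ C, ∀ s ∈ Icc 0 T, ∫ q, |Z s q - Z' s q| ∂(ν.prod unif) ≤ C := by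
  obtain ⟨G, hG, hZG⟩ := h.dominated
  obtain ⟨G', hG', hZG'⟩ := h'.dominated
  refine ⟨∫ q, (G q + G' q) ∂(ν.prod unif), fun s hs => integral_mono_ae
    (h.integrable_abs_sub h' hs) ((hG.add hG').integrable one_le_two) ?_⟩
  filter_upwards [hZG s hs, hZG' s hs] with q h1 h2
  exact (abs_sub _ _).trans (add_le_add h1 h2)

lemma Lagrangian.W1_le (h : Lagrangian ν T b μ K Z) (h' : Lagrangian ν T b' μ' K' Z')
    {s : ℝ} (hs : s ∈ Icc 0 T) :
    W1 (μ s) (μ' s) ≤ ∫ q, |Z s q - Z' s q| ∂(ν.prod unif) := by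
  rw [h.law s hs, h'.law s hs]
  refine (W1_map_le ((h.aemeasurable s hs).prodMk measurable_fst.aemeasurable)
    ((h'.aemeasurable s hs).prodMk measurable_fst.aemeasurable)).trans_eq ?_
  simp [Prod.dist_eq, Real.dist_eq]

lemma Lagrangian.xc_eq (h : Lagrangian ν T b μ K Z) {s : ℝ} (hs : s ∈ Icc 0 T) :
    xc (μ s) = ∫ q, Z s q ∂(ν.prod unif) := by
  rw [xc, h.law s hs, integral_map ((h.aemeasurable s hs).prodMk measurable_fst.aemeasurable)
    (by fun_prop)]

lemma Lagrangian.d1k_le [IsProbabilityMeasure ν] (h : Lagrangian ν T b μ K Z)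
    (h' : Lagrangian ν T b' μ' K' Z') {s : ℝ} (hs : s ∈ Icc 0 T) :
    d1k ν (K s) (K' s) ≤ ∫ q, |Z s q - Z' s q| ∂(ν.prod unif) := by
  have hi := h.integrable_abs_sub h' hs
  rw [integral_prod _ hi]
  refine integral_mono_of_nonneg (ae_of_all _ fun ω => W1_nonneg _ _) hi.integral_prod_left ?_
  filter_upwards [h.fiber s hs, h'.fiber s hs] with ω h1 h2
  rw [h1.2, h2.2]
  exact W1_map_le h1.1 h2.1

lemma Lagrangian.d2k_le [IsProbabilityMeasure ν] (h : Lagrangian ν T b μ K Z)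
    (h' : Lagrangian ν T b' μ' K' Z') {s : ℝ} (hs : s ∈ Icc 0 T) :
    d2k ν (K s) (K' s) ≤ √(∫ q, (Z s q - Z' s q) ^ 2 ∂(ν.prod unif)) := by
  have hi := h.integrable_sub_sq h' hs
  rw [integral_prod _ hi]
  refine Real.sqrt_le_sqrt (integral_mono_of_nonneg (ae_of_all _ fun ω => sq_nonneg _)
    hi.integral_prod_left ?_)
  filter_upwards [h.fiber s hs, h'.fiber s hs] with ω h1 h2
  rw [h1.2, h2.2]
  have := pow_le_pow_left₀ (W2_nonneg _ _) (W2_map_le h1.1 h2.1) 2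
  rw [Real.sq_sqrt (integral_nonneg fun _ => sq_nonneg _)] at this
  simpa only [Real.dist_eq, sq_abs] using this

lemma Lagrangian.d1k_zero [IsProbabilityMeasure ν] (h : Lagrangian ν T b μ K Z)
    (h' : Lagrangian ν T b' μ' K' Z')
    (hT : 0 ≤ T) (hP : μ 0 ∈ P2nu ν) (hP' : μ' 0 ∈ P2nu ν) (hK : IsDisint ν (μ 0) (K 0))
    (hK' : IsDisint ν (μ' 0) (K' 0)) :
    ∫ q, |Z 0 q - Z' 0 q| ∂(ν.prod unif) = d1k ν (K 0) (K' 0) := by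
  have := hP.1
  have := hP'.1
  have hi := h.integrable_abs_sub h' ⟨le_rfl, hT⟩
  rw [integral_prod _ hi]
  refine integral_congr_ae ?_
  have key : ∀ {m : Measure (ℝ × ℝ)}, m ∈ P2nu ν → Integrable (fun z : ℝ × ℝ => z.1) m :=
    fun {m} hm => by
      have := hm.1
      exact ((memLp_two_iff_integrable_sq (by fun_prop)).2
        (P2nu.integrable_sq hm)).integrable one_le_two
  filter_upwards [hK.ae_integrable measurable_id (key hP),
    hK'.ae_integrable measurable_id (key hP'), Measure.ae_ae_of_ae_prod h.start,
    Measure.ae_ae_of_ae_prod h'.start] with ω h1 h2 h3 h4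
  have := hK.1 ω
  have := hK'.1 ω
  rw [W1_eq_quantile h1 h2]
  refine integral_congr_ae ?_
  filter_upwards [h3, h4] with u h5 h6
  rw [h5, h6]

lemma Lagrangian.d2k_zero [IsProbabilityMeasure ν] (h : Lagrangian ν T b μ K Z)
    (h' : Lagrangian ν T b' μ' K' Z')
    (hT : 0 ≤ T) (hP : μ 0 ∈ P2nu ν) (hP' : μ' 0 ∈ P2nu ν) (hK : IsDisint ν (μ 0) (K 0))
    (hK' : IsDisint ν (μ' 0) (K' 0)) :
    √(∫ q, (Z 0 q - Z' 0 q) ^ 2 ∂(ν.prod unif)) = d2k ν (K 0) (K' 0) := by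
  have := hP.1
  have := hP'.1
  have hi := h.integrable_sub_sq h' ⟨le_rfl, hT⟩
  rw [integral_prod _ hi, d2k]
  refine congrArg _ (integral_congr_ae ?_)
  filter_upwards [hK.ae_integrable (measurable_id.pow_const 2) (P2nu.integrable_sq hP),
    hK'.ae_integrable (measurable_id.pow_const 2) (P2nu.integrable_sq hP'),
    Measure.ae_ae_of_ae_prod h.start, Measure.ae_ae_of_ae_prod h'.start] with ω h1 h2 h3 h4
  have := hK.1 ω
  have := hK'.1 ω
  rw [W2_sq_eq_quantile h1 h2]
  refine integral_congr_ae ?_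
  filter_upwards [h3, h4] with u h5 h6
  rw [h5, h6]

end Lagrangian

section Stability

lemma sq_integral_le {α : Type*} [MeasurableSpace α] {P : Measure α} [IsProbabilityMeasure P]
    {f : α → ℝ} (hf : Integrable f P) (hf2 : Integrable (fun a => f a ^ 2) P) :
    (∫ a, f a ∂P) ^ 2 ≤ ∫ a, f a ^ 2 ∂P := by
  obtain ⟨c, hc⟩ : ∃ c, c = ∫ a, f a ∂P := ⟨_, rfl⟩
  have h := integral_nonneg (μ := P) (f := fun a => (f a - c) ^ 2) fun a => sq_nonneg _
  have e : ∀ a, (f a - c) ^ 2 = (f a ^ 2 - 2 * c * f a) + c ^ 2 := fun a => by ring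
  simp only [e] at h
  have hs : Integrable (fun a => f a ^ 2 - 2 * c * f a) P := hf2.sub (hf.const_mul _)
  rw [integral_add hs (integrable_const _),
    integral_sub hf2 (hf.const_mul _), integral_const_mul, ← hc] at h
  simp only [integral_const, probReal_univ, smul_eq_mul, one_mul] at h
  rw [← hc]
  linarith

/-- The quadratic mean of a function bounded by an affine one. -/
lemma sqrt_integral_affine_sq_le {α : Type*} [MeasurableSpace α] {P : Measure α}
    [IsProbabilityMeasure P] {f g : α → ℝ} {c d : ℝ} (hc : 0 ≤ c) (hd : 0 ≤ d)
    (hf : Integrable f P) (hf2 : Integrable (fun a => f a ^ 2) P)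
    (hg : ∀ᵐ a ∂P, |g a| ≤ c * f a + d) :
    √(∫ a, g a ^ 2 ∂P) ≤ c * √(∫ a, f a ^ 2 ∂P) + d := by
  obtain ⟨ρ, hρ⟩ : ∃ ρ, ρ = √(∫ a, f a ^ 2 ∂P) := ⟨_, rfl⟩
  have hρ0 : 0 ≤ ρ := hρ ▸ Real.sqrt_nonneg _
  have hρ2 : ∫ a, f a ^ 2 ∂P = ρ ^ 2 := by
    rw [hρ, Real.sq_sqrt (integral_nonneg fun a => sq_nonneg _)]
  have h1 : ∫ a, f a ∂P ≤ ρ := by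
    rw [hρ]
    exact Real.le_sqrt_of_sq_le (sq_integral_le hf hf2)
  rw [← hρ]
  refine Real.sqrt_le_iff.2 ⟨by positivity, ?_⟩
  have e : ∀ a, (c * f a + d) ^ 2 = (c ^ 2 * f a ^ 2 + 2 * c * d * f a) + d ^ 2 :=
    fun a => by ring
  have hi : Integrable (fun a => (c * f a + d) ^ 2) P := by
    simp only [e]
    exact ((hf2.const_mul _).add (hf.const_mul _)).add (integrable_const _)
  calc ∫ a, g a ^ 2 ∂P ≤ ∫ a, (c * f a + d) ^ 2 ∂P := by
        refine integral_mono_of_nonneg (ae_of_all _ fun a => sq_nonneg _) hi ?_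
        filter_upwards [hg] with a ha
        exact sq_le_sq' (by linarith [neg_abs_le (g a)]) ((le_abs_self _).trans ha)
    _ = c ^ 2 * ρ ^ 2 + 2 * c * d * (∫ a, f a ∂P) + d ^ 2 := by
        have hs : Integrable (fun a => c ^ 2 * f a ^ 2 + 2 * c * d * f a) P :=
          (hf2.const_mul _).add (hf.const_mul _)
        simp only [e]
        rw [integral_add hs (integrable_const _),
          integral_add (hf2.const_mul _) (hf.const_mul _), integral_const_mul,
          integral_const_mul, hρ2]
        simp
    _ ≤ c ^ 2 * ρ ^ 2 + 2 * c * d * ρ + d ^ 2 := by gcongr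
    _ = (c * ρ + d) ^ 2 := by ring

variable {ν : Measure ℝ} {F : Measure (ℝ × ℝ) → ℝ × ℝ → ℝ}
  {A B I M κ γ T c : ℝ} {μ μ' : ℝ → Measure (ℝ × ℝ)} {K K' : ℝ → ℝ → Measure ℝ}
  {Z Z' : ℝ → ℝ × ℝ → ℝ}

/-- Two trajectories separate at a rate controlled by the distance of the solutions. -/
lemma Lagrangian.ae_separation (hF : Framework ν F A B I M κ γ) (hI : 0 ≤ I) (hκ : 0 ≤ κ)
    (hM : 0 ≤ M) (hP : ∀ t, 0 ≤ t → μ t ∈ P2nu ν) (hP' : ∀ t, 0 ≤ t → μ' t ∈ P2nu ν)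
    (h : Lagrangian ν T (fun s => F (μ s)) μ K Z)
    (h' : Lagrangian ν T (fun s => F (μ' s)) μ' K' Z')
    (hc : ∀ s ∈ Icc 0 T, ∫ q, |Z s q - Z' s q| ∂(ν.prod unif) ≤ c * exp (κ * (M + I) * s)) :
    ∀ᵐ q ∂(ν.prod unif), ∀ s ∈ Icc 0 T,
      |Z s q - Z' s q| ≤ exp (κ * I * s) * |Z 0 q - Z' 0 q| +
        c * (exp (κ * (M + I) * s) - exp (κ * I * s)) ∧
      |Z s q - Z' s q - (Z 0 q - Z' 0 q)| ≤ (exp (κ * I * s) - 1) * |Z 0 q - Z' 0 q| +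
        c * (exp (κ * (M + I) * s) - exp (κ * I * s)) := by
  filter_upwards [h.deriv, h'.deriv] with q hq hq'
  obtain ⟨r, hr⟩ : ∃ r, r = |Z 0 q - Z' 0 q| := ⟨_, rfl⟩
  have hexp : ∀ l s : ℝ, HasDerivAt (fun s => exp (l * s)) (l * exp (l * s)) s := fun l s =>
    (((hasDerivAt_id s).const_mul l).exp).congr_deriv (by simp [mul_comm])
  have hd : ∀ s ∈ Icc 0 T, HasDerivWithinAt (fun s => Z s q - Z' s q)
      (F (μ s) (Z s q, q.1) - F (μ' s) (Z' s q, q.1)) (Icc 0 T) s :=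
    fun s hs => (hq.2 s hs).sub (hq'.2 s hs)
  have hbd : ∀ s ∈ Icc 0 T, |F (μ s) (Z s q, q.1) - F (μ' s) (Z' s q, q.1)| ≤
      κ * I * |Z s q - Z' s q| + κ * M * (c * exp (κ * (M + I) * s)) := fun s hs => by
    refine (abs_sub_le _ (F (μ s) (Z' s q, q.1)) _).trans (add_le_add ?_ ?_)
    · simpa using hF.abs_sub_le (hP s hs.1) (Z s q, q.1) (Z' s q, q.1)
    · exact (hF.hA1 _ (hP s hs.1) _ (hP' s hs.1) _ _ hq.1).1.trans
        (mul_le_mul_of_nonneg_left ((h.W1_le h' hs).trans (hc s hs)) (by positivity))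
  have hB : ∀ s, HasDerivAt (fun s => exp (κ * I * s) * r +
      c * (exp (κ * (M + I) * s) - exp (κ * I * s))) (κ * I * exp (κ * I * s) * r +
        c * (κ * (M + I) * exp (κ * (M + I) * s) - κ * I * exp (κ * I * s))) s := fun s =>
    ((hexp _ s).mul_const r).add (((hexp _ s).sub (hexp _ s)).const_mul c)
  have h1 : ∀ s ∈ Icc 0 T, |Z s q - Z' s q| ≤ exp (κ * I * s) * r +
      c * (exp (κ * (M + I) * s) - exp (κ * I * s)) := by
    refine abs_le_of_abs_deriv_le (a := κ * I) hd hB (by simp [hr]) fun s hs => ?_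
    refine (hbd s hs).trans_eq ?_
    ring
  have h2 : ∀ s ∈ Icc 0 T, |Z s q - Z' s q - (Z 0 q - Z' 0 q)| ≤ exp (κ * I * s) * r +
      c * (exp (κ * (M + I) * s) - exp (κ * I * s)) - r := by
    refine abs_le_of_abs_deriv_le (a := 0) (fun s hs => (hd s hs).sub_const _)
      (fun s => (hB s).sub_const r) (by simp) fun s hs => ?_
    have := mul_le_mul_of_nonneg_left (h1 s hs) (mul_nonneg hκ hI)
    linarith [hbd s hs]
  rw [← hr]
  exact fun s hs => ⟨h1 s hs, by linarith [h2 s hs]⟩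

/-- Exponential growth of the mean distance between trajectories. -/
lemma Lagrangian.integral_abs_sub_le [IsProbabilityMeasure ν]
    (hF : Framework ν F A B I M κ γ) (hI : 0 ≤ I) (hκ : 0 ≤ κ) (hM : 0 ≤ M) (hT : 0 ≤ T)
    (hP : ∀ t, 0 ≤ t → μ t ∈ P2nu ν) (hP' : ∀ t, 0 ≤ t → μ' t ∈ P2nu ν)
    (h : Lagrangian ν T (fun s => F (μ s)) μ K Z)
    (h' : Lagrangian ν T (fun s => F (μ' s)) μ' K' Z') :
    ∀ s ∈ Icc 0 T, ∫ q, |Z s q - Z' s q| ∂(ν.prod unif) ≤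
      (∫ q, |Z 0 q - Z' 0 q| ∂(ν.prod unif)) * exp (κ * (M + I) * s) := by
  obtain ⟨D, hD⟩ : ∃ D : ℝ → ℝ, D = fun s => ∫ q, |Z s q - Z' s q| ∂(ν.prod unif) := ⟨_, rfl⟩
  have hD0 : ∀ s, 0 ≤ D s := fun s => by
    rw [hD]
    exact integral_nonneg fun q => abs_nonneg _
  obtain ⟨C, hC⟩ := h.exists_integral_abs_sub_le h'
  have hl : 0 ≤ κ * (M + I) := by positivity
  have h0 : (0 : ℝ) ∈ Icc 0 T := ⟨le_rfl, hT⟩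
  let E : Set ℝ := (fun s => D s * exp (-(κ * (M + I) * s))) '' Icc 0 T
  have hbdd : BddAbove E := by
    refine ⟨C, ?_⟩
    rintro _ ⟨s, hs, rfl⟩
    refine le_trans (mul_le_of_le_one_right (hD0 s) (exp_le_one_iff.2 ?_)) ?_
    · linarith [mul_nonneg hl hs.1]
    · rw [hD]
      exact hC s hs
  obtain ⟨c, hc⟩ : ∃ c, c = sSup E := ⟨_, rfl⟩
  have hle : ∀ s ∈ Icc 0 T, D s ≤ c * exp (κ * (M + I) * s) := fun s hs => by
    have := le_csSup hbdd (mem_image_of_mem _ hs)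
    rw [← hc] at this
    calc D s = D s * exp (-(κ * (M + I) * s)) * exp (κ * (M + I) * s) := by
          rw [mul_assoc, ← exp_add, neg_add_cancel, exp_zero, mul_one]
      _ ≤ _ := mul_le_mul_of_nonneg_right this (exp_pos _).le
  have hcD : D 0 ≤ c := by simpa using hle 0 h0
  have himp : ∀ s ∈ Icc 0 T, D s ≤ exp (κ * I * s) * D 0 +
      c * (exp (κ * (M + I) * s) - exp (κ * I * s)) := fun s hs => by
    have hsep := h.ae_separation hF hI hκ hM hP hP' h' (c := c)
      fun s hs => by simpa [hD] using hle s hs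
    have hi := h.integrable_abs_sub h' h0
    have := integral_mono_ae (h.integrable_abs_sub h' hs)
      ((hi.const_mul (exp (κ * I * s))).add (integrable_const _))
      (hsep.mono fun q hq => (hq s hs).1)
    simp only [Pi.add_apply] at this
    rw [integral_add (hi.const_mul _) (integrable_const _), integral_const_mul] at this
    simpa [hD] using this
  have hcle : c ≤ D 0 := by
    obtain ⟨p, hp⟩ : ∃ p, p = exp (-(κ * M * T)) := ⟨_, rfl⟩
    have hp0 : 0 < p := hp ▸ exp_pos _
    have hcp : c ≤ D 0 * p + c * (1 - p) := by
      nth_rewrite 1 [hc]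
      refine csSup_le ⟨_, mem_image_of_mem _ h0⟩ ?_
      rintro _ ⟨s, hs, rfl⟩
      have e1 : exp (κ * I * s) * exp (-(κ * (M + I) * s)) = exp (-(κ * M * s)) := by
        rw [← exp_add]
        ring_nf
      have e2 : exp (κ * (M + I) * s) * exp (-(κ * (M + I) * s)) = 1 := by
        rw [← exp_add, add_neg_cancel, exp_zero]
      have h3 := mul_le_mul_of_nonneg_right (himp s hs) (exp_pos (-(κ * (M + I) * s))).le
      have h4 : p ≤ exp (-(κ * M * s)) := by
        rw [hp]
        exact exp_le_exp.2 (neg_le_neg (mul_le_mul_of_nonneg_left hs.2 (by positivity)))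
      have h5 := mul_le_mul_of_nonneg_left h4 (sub_nonneg.2 hcD)
      have e3 : (exp (κ * I * s) * D 0 + c * (exp (κ * (M + I) * s) - exp (κ * I * s))) *
          exp (-(κ * (M + I) * s)) = exp (κ * I * s) * exp (-(κ * (M + I) * s)) * (D 0 - c) +
            c * (exp (κ * (M + I) * s) * exp (-(κ * (M + I) * s))) := by ring
      rw [e3, e1, e2] at h3
      simp only
      linarith
    have : c * p ≤ D 0 * p := by linarith
    exact le_of_mul_le_mul_right this hp0
  intro s hs
  have := (hle s hs).trans (mul_le_mul_of_nonneg_right hcle (exp_pos _).le)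
  simpa [hD] using this

end Stability

end StabilityProof

/-- Stability estimates: for two global measure-valued solutions
`μ, μ'` of the continuity equation with `F ∈ F^ν_{A,B,I,M}(κ,γ)` and disintegrations
`K, K'`, one has `d₁(μ_t,μ'_t) ≤ d₁(μ₀,μ'₀) e^{κ(M+I)t}`,
`|x_c(t) − x'_c(t)| ≤ |x_c(0) − x'_c(0)| + d₁(μ₀,μ'₀)(e^{κ(M+I)t} − 1)` and
`d₂(μ_t,μ'_t) ≤ d₂(μ₀,μ'₀) e^{κ(M+I)t}` for all `t ≥ 0`. -/
theorem stability_d1_d2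
    (ν : Measure ℝ) [IsProbabilityMeasure ν]
    (hΩ : Bornology.IsBounded (msupp ν))
    (A B I M κ γ : ℝ)
    (hpos : 0 < A ∧ 0 < B ∧ 0 < I ∧ 0 < M ∧ 0 < κ ∧ 0 < γ)
    (hγ : γ = sSup {d : ℝ | ∃ ω ∈ msupp ν, ∃ ω' ∈ msupp ν, d = |ω - ω'|})
    (F : Measure (ℝ × ℝ) → ℝ × ℝ → ℝ) (hF : Framework ν F A B I M κ γ)
    (μ μ' : ℝ → Measure (ℝ × ℝ))
    (hsol : IsSol F μ) (hsol' : IsSol F μ')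
    (hP : ∀ t : ℝ, 0 ≤ t → μ t ∈ P2nu ν)
    (hP' : ∀ t : ℝ, 0 ≤ t → μ' t ∈ P2nu ν)
    (K K' : ℝ → ℝ → Measure ℝ)
    (hK : ∀ t : ℝ, 0 ≤ t → IsDisint ν (μ t) (K t))
    (hK' : ∀ t : ℝ, 0 ≤ t → IsDisint ν (μ' t) (K' t)) :
    ∀ t : ℝ, 0 ≤ t →
      d1k ν (K t) (K' t) ≤ d1k ν (K 0) (K' 0) * Real.exp (κ * (M + I) * t) ∧
      |xc (μ t) - xc (μ' t)| ≤
        |xc (μ 0) - xc (μ' 0)| + d1k ν (K 0) (K' 0) * (Real.exp (κ * (M + I) * t) - 1) ∧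
      d2k ν (K t) (K' t) ≤ d2k ν (K 0) (K' 0) * Real.exp (κ * (M + I) * t) := by
  obtain ⟨-, -, hI, hM, hκ, -⟩ := hpos
  intro t ht
  obtain ⟨Z, hZ⟩ := hsol.exists_lagrangian hΩ hF hI.le hκ.le hM.le hP hK ht
  obtain ⟨Z', hZ'⟩ := hsol'.exists_lagrangian hΩ hF hI.le hκ.le hM.le hP' hK' ht
  have h0 : (0 : ℝ) ∈ Icc 0 t := ⟨le_rfl, ht⟩
  have htt : t ∈ Icc 0 t := ⟨ht, le_rfl⟩
  have hgrow := hZ.integral_abs_sub_le hF hI.le hκ.le hM.le ht hP hP' hZ'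
  have hd1 := hZ.d1k_zero hZ' ht (hP 0 le_rfl) (hP' 0 le_rfl) (hK 0 le_rfl) (hK' 0 le_rfl)
  have hd2 := hZ.d2k_zero hZ' ht (hP 0 le_rfl) (hP' 0 le_rfl) (hK 0 le_rfl) (hK' 0 le_rfl)
  have hsep := hZ.ae_separation hF hI.le hκ.le hM.le hP hP' hZ' hgrow
  have hi := hZ.integrable_abs_sub hZ' h0
  have hi2 := hZ.integrable_sub_sq hZ' h0
  have hz : ∀ s ∈ Icc 0 t, Integrable (fun q => Z s q - Z' s q) (ν.prod unif) := fun s hs =>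
    ((hZ.memLp hs).sub (hZ'.memLp hs)).integrable one_le_two
  have hxc : ∀ s ∈ Icc 0 t, xc (μ s) - xc (μ' s) = ∫ q, (Z s q - Z' s q) ∂(ν.prod unif) :=
    fun s hs => by
      rw [hZ.xc_eq hs, hZ'.xc_eq hs, integral_sub ((hZ.memLp hs).integrable one_le_two)
        ((hZ'.memLp hs).integrable one_le_two)]
  rw [hd1] at hgrow hsep
  obtain ⟨D, hD⟩ : ∃ D, D = d1k ν (K 0) (K' 0) := ⟨_, rfl⟩
  have hD0 : 0 ≤ D := hD ▸ integral_nonneg fun ω => W1_nonneg _ _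
  rw [← hD] at hgrow hsep hd1 ⊢
  have hexp : exp (κ * I * t) ≤ exp (κ * (M + I) * t) := by gcongr; linarith
  refine ⟨(hZ.d1k_le hZ' htt).trans (hgrow t htt), ?_, ?_⟩
  · have hbound := integral_mono_ae ((hz t htt).sub (hz 0 h0)).abs
      ((hi.const_mul (exp (κ * I * t) - 1)).add (integrable_const _))
      (hsep.mono fun q hq => (hq t htt).2)
    simp only [Pi.add_apply] at hbound
    rw [integral_add (hi.const_mul _) (integrable_const _), integral_const_mul, hd1] at hbound
    simp only [integral_const, probReal_univ, smul_eq_mul, one_mul] at hbound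
    have hsplit := abs_integral_le_integral_abs (μ := ν.prod unif)
      (f := fun q => Z t q - Z' t q - (Z 0 q - Z' 0 q))
    rw [integral_sub (hz t htt) (hz 0 h0), ← hxc t htt, ← hxc 0 h0] at hsplit
    have := abs_sub_abs_le_abs_sub (xc (μ t) - xc (μ' t)) (xc (μ 0) - xc (μ' 0))
    have hbound' := hsplit.trans hbound
    linarith
  · refine (hZ.d2k_le hZ' htt).trans ?_
    have hβ : 0 ≤ D * (exp (κ * (M + I) * t) - exp (κ * I * t)) :=
      mul_nonneg hD0 (by linarith)
    have h1 := sqrt_integral_affine_sq_le (exp_pos (κ * I * t)).le hβ hi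
      (by simpa only [sq_abs] using hi2) (hsep.mono fun q hq => (hq t htt).1)
    have h2 := sq_integral_le hi (by simpa only [sq_abs] using hi2)
    simp only [sq_abs] at h1 h2
    have h3 := Real.le_sqrt_of_sq_le h2
    rw [hd1, hd2] at h3
    rw [hd2] at h1
    have h4 := mul_le_mul_of_nonneg_right h3 (sub_nonneg.2 hexp)
    linarith
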